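/- arXiv:1602.05051 — 6 statements merged into one kernel-verified Lean document; each statement's English description precedes it below -/
import Mathlib

section
/- Let A be a nonnegative symmetric 5×5 real matrix with eigenvalues λ1 ≥ λ2 ≥ λ3 ≥ λ4 ≥ λ5 counted with multiplicity. If λ1 + λ2 + λ3 + λ4 + λ5 ≥ (1/2)·λ1, then λ3 ≤ λ1 + λ2 + λ3 + λ4 + λ5. -/
open Matrix Finset Filter Topology

structure IsSortedEigenbasis {n : ℕ} (M : Matrix (Fin n) (Fin n) ℝ)
    (l : Fin n → ℝ) (e : Fin n → Fin n → ℝ) : Prop where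
  anti : Antitone l
  eig : ∀ i, M *ᵥ e i = l i • e i
  orth : ∀ i j, e i ⬝ᵥ e j = if i = j then 1 else 0
  expand : ∀ x, x = ∑ i, (e i ⬝ᵥ x) • e i

theorem exists_isSortedEigenbasis {n : ℕ} {M : Matrix (Fin n) (Fin n) ℝ} (hM : M.IsSymm) :
    ∃ l e, IsSortedEigenbasis M l e ∧ M.det = ∏ i, l i ∧
      M.charpoly.roots = univ.val.map l := by
  have hH : M.IsHermitian := by
    rw [Matrix.IsHermitian, conjTranspose_eq_transpose_of_trivial]; exact hM
  let σ := Tuple.sort (fun i => -hH.eigenvalues i)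
  have hσ : Monotone ((fun i => -hH.eigenvalues i) ∘ σ) := Tuple.monotone_sort _
  refine ⟨fun i => hH.eigenvalues (σ i), fun i => (hH.eigenvectorBasis (σ i)).ofLp,
    ⟨fun i j hij => ?_, fun i => ?_, fun i j => ?_, fun x => ?_⟩, ?_, ?_⟩
  · have := hσ hij
    simpa using this
  · exact hH.mulVec_eigenvectorBasis (σ i)
  · have := orthonormal_iff_ite.1 hH.eigenvectorBasis.orthonormal (σ i) (σ j)
    simp only [EuclideanSpace.inner_eq_star_dotProduct, star_trivial, EmbeddingLike.apply_eq_iff_eq]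
      at this
    rw [← this, dotProduct_comm]
  · have h := hH.eigenvectorBasis.sum_repr' (WithLp.toLp 2 x)
    rw [← Equiv.sum_comp σ] at h
    have h2 := congrArg WithLp.ofLp h
    simp only [EuclideanSpace.inner_eq_star_dotProduct, star_trivial, WithLp.ofLp_sum,
      WithLp.ofLp_smul] at h2
    conv_lhs => rw [← h2]
    simp only [dotProduct_comm]
  · rw [hH.det_eq_prod_eigenvalues, ← Equiv.prod_comp σ]; simp
  · rw [hH.roots_charpoly_eq_eigenvalues]
    have : (univ.val.map σ : Multiset (Fin n)) = univ.val := by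
      have := Finset.map_univ_equiv σ
      exact congrArg Finset.val this
    conv_lhs => rw [← this]
    rw [Multiset.map_map]
    rfl

namespace IsSortedEigenbasis
variable {n : ℕ} {M : Matrix (Fin n) (Fin n) ℝ} {l : Fin n → ℝ} {e : Fin n → Fin n → ℝ}

theorem dotProduct_eq_sum (h : IsSortedEigenbasis M l e) (x y : Fin n → ℝ) :
    x ⬝ᵥ y = ∑ i, (e i ⬝ᵥ x) * (e i ⬝ᵥ y) := by
  conv_lhs => rw [h.expand x]
  simp [sum_dotProduct, smul_dotProduct]

theorem form_eq_sum (h : IsSortedEigenbasis M l e) (hM : M.IsSymm) (x : Fin n → ℝ) :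
    x ⬝ᵥ M *ᵥ x = ∑ i, l i * (e i ⬝ᵥ x) ^ 2 := by
  rw [h.dotProduct_eq_sum]
  refine sum_congr rfl fun i _ => ?_
  rw [Matrix.dotProduct_mulVec, ← mulVec_transpose, hM.eq, h.eig, smul_dotProduct, smul_eq_mul]
  ring

theorem normSq_eq_sum (h : IsSortedEigenbasis M l e) (x : Fin n → ℝ) :
    x ⬝ᵥ x = ∑ i, (e i ⬝ᵥ x) ^ 2 := by
  rw [h.dotProduct_eq_sum]; simp [sq]

theorem form_le (h : IsSortedEigenbasis M l e) (hM : M.IsSymm) (j : Fin n) {x : Fin n → ℝ}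
    (hx : ∀ i < j, e i ⬝ᵥ x = 0) : x ⬝ᵥ M *ᵥ x ≤ l j * (x ⬝ᵥ x) := by
  rw [h.form_eq_sum hM, h.normSq_eq_sum, mul_sum]
  refine sum_le_sum fun i _ => ?_
  rcases lt_or_ge i j with hij | hij
  · simp [hx i hij]
  · exact mul_le_mul_of_nonneg_right (h.anti hij) (sq_nonneg _)

theorem le_form (h : IsSortedEigenbasis M l e) (hM : M.IsSymm) (j : Fin n) {x : Fin n → ℝ}
    (hx : ∀ i, j < i → e i ⬝ᵥ x = 0) : l j * (x ⬝ᵥ x) ≤ x ⬝ᵥ M *ᵥ x := by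
  rw [h.form_eq_sum hM, h.normSq_eq_sum, mul_sum]
  refine sum_le_sum fun i _ => ?_
  rcases lt_or_ge j i with hij | hij
  · simp [hx i hij]
  · exact mul_le_mul_of_nonneg_right (h.anti hij) (sq_nonneg _)

/-- Poincaré separation for a compression of a symmetric matrix. -/
theorem compression_le {m : ℕ} (h : IsSortedEigenbasis M l e) (hM : M.IsSymm)
    {G : Fin m → Fin n → ℝ} (hG : ∀ a b, G a ⬝ᵥ G b = if a = b then 1 else 0)
    {C : Matrix (Fin m) (Fin m) ℝ} (hC : ∀ a b, C a b = G a ⬝ᵥ M *ᵥ G b)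
    {s : Fin m → ℝ} {f : Fin m → Fin m → ℝ} (hs : IsSortedEigenbasis C s f)
    {i : Fin m} {j : Fin n} (hij : i.val = j.val) : s i ≤ l j := by
  have hCs : C.IsSymm := by
    ext a b
    rw [transpose_apply, hC, hC, Matrix.dotProduct_mulVec, ← mulVec_transpose, hM.eq,
      dotProduct_comm]
  let T : ({a : Fin m // a ≤ i} → ℝ) →ₗ[ℝ] ({c : Fin n // c < j} → ℝ) :=
    { toFun := fun β c => ∑ a, β a * (e c.1 ⬝ᵥ ∑ b, f a.1 b • G b)
      map_add' := by intro x y; ext c; simp [add_mul, sum_add_distrib]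
      map_smul' := by intro r x; ext c; simp [mul_sum, mul_assoc] }
  have hT : LinearMap.ker T ≠ ⊥ := by
    apply LinearMap.ker_ne_bot_of_finrank_lt
    rw [Module.finrank_fintype_fun_eq_card, Module.finrank_fintype_fun_eq_card,
      Fintype.card_of_subtype (Iio j) (by simp), Fintype.card_of_subtype (Iic i) (by simp),
      Fin.card_Iio, Fin.card_Iic, hij]
    exact Nat.lt_succ_self _
  obtain ⟨β, hβ, hβ0⟩ := (Submodule.ne_bot_iff _).1 hT
  let y : Fin m → ℝ := ∑ a, β a • f a.1
  let x : Fin n → ℝ := ∑ b, y b • G b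
  have hfy : ∀ c : Fin m, f c ⬝ᵥ y = if hc : c ≤ i then β ⟨c, hc⟩ else 0 := by
    intro c
    simp only [y, dotProduct_sum, dotProduct_smul, hs.orth, smul_eq_mul]
    split_ifs with hc
    · rw [sum_eq_single ⟨c, hc⟩]
      · simp
      · intro b _ hb
        rw [if_neg, mul_zero]
        rintro rfl; exact hb rfl
      · simp
    · refine sum_eq_zero fun a _ => ?_
      rw [if_neg, mul_zero]
      rintro rfl; exact hc a.2
  have hxx : x ⬝ᵥ x = y ⬝ᵥ y := by
    simp only [x, sum_dotProduct, dotProduct_sum, smul_dotProduct, dotProduct_smul, hG]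
    simp [dotProduct]
  have hxM : x ⬝ᵥ M *ᵥ x = y ⬝ᵥ C *ᵥ y := by
    simp only [x, mulVec_sum, mulVec_smul, sum_dotProduct, dotProduct_sum, smul_dotProduct,
      dotProduct_smul, ← hC]
    simp only [dotProduct, mulVec, smul_eq_mul, mul_sum]
    refine sum_congr rfl fun a _ => sum_congr rfl fun b _ => ?_
    rw [← hCs.apply a b]
    ring
  have hy : 0 < y ⬝ᵥ y := by
    rw [hs.normSq_eq_sum]
    obtain ⟨a, ha⟩ := Function.ne_iff.1 hβ0
    refine sum_pos' (fun _ _ => sq_nonneg _) ⟨a.1, mem_univ _, ?_⟩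
    rw [hfy, dif_pos a.2]
    exact sq_pos_of_ne_zero ha
  have hex : ∀ c < j, e c ⬝ᵥ x = 0 := by
    intro c hc
    have := congrFun (LinearMap.mem_ker.1 hβ) ⟨c, hc⟩
    simp only [T, LinearMap.coe_mk, AddHom.coe_mk, Pi.zero_apply] at this
    rw [← this]
    simp only [x, y, dotProduct_sum, dotProduct_smul, smul_eq_mul, Finset.sum_apply, Pi.smul_apply,
      sum_mul, mul_sum]
    rw [sum_comm]
    refine sum_congr rfl fun a _ => sum_congr rfl fun b _ => ?_
    ring
  have h1 := hs.le_form hCs i (x := y) (fun c hc => by rw [hfy, dif_neg (not_le.2 hc)])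
  have h2 := h.form_le hM j hex
  rw [hxx, hxM] at h2
  exact le_of_mul_le_mul_right (h1.trans h2) hy
end IsSortedEigenbasis

theorem false_of_planar_triangle {a₁ a₂ b₁ b₂ c₁ c₂ : ℝ} (hab : a₁ * b₁ + a₂ * b₂ = 1)
    (hbc : b₁ * c₁ + b₂ * c₂ = 1) (hac : a₁ * c₁ + a₂ * c₂ = 1) (ha : 1 < a₁ ^ 2 + a₂ ^ 2)
    (hb : 1 < b₁ ^ 2 + b₂ ^ 2) (hc : 1 < c₁ ^ 2 + c₂ ^ 2) : False := by
  have gram : (a₁ ^ 2 + a₂ ^ 2) * (b₁ ^ 2 + b₂ ^ 2) * (c₁ ^ 2 + c₂ ^ 2)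
      + 2 * (a₁ * b₁ + a₂ * b₂) * (b₁ * c₁ + b₂ * c₂) * (a₁ * c₁ + a₂ * c₂)
      - (a₁ ^ 2 + a₂ ^ 2) * (b₁ * c₁ + b₂ * c₂) ^ 2 - (b₁ ^ 2 + b₂ ^ 2) * (a₁ * c₁ + a₂ * c₂) ^ 2
      - (c₁ ^ 2 + c₂ ^ 2) * (a₁ * b₁ + a₂ * b₂) ^ 2 = 0 := by ring
  rw [hab, hbc, hac] at gram
  obtain ⟨A, hA⟩ : ∃ A, A = a₁ ^ 2 + a₂ ^ 2 - 1 := ⟨_, rfl⟩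
  obtain ⟨B, hB⟩ : ∃ B, B = b₁ ^ 2 + b₂ ^ 2 - 1 := ⟨_, rfl⟩
  obtain ⟨C, hC⟩ : ∃ C, C = c₁ ^ 2 + c₂ ^ 2 - 1 := ⟨_, rfl⟩
  rw [show a₁ ^ 2 + a₂ ^ 2 = A + 1 by linarith, show b₁ ^ 2 + b₂ ^ 2 = B + 1 by linarith,
    show c₁ ^ 2 + c₂ ^ 2 = C + 1 by linarith] at gram
  have hA0 : 0 < A := by linarith
  have hB0 : 0 < B := by linarith
  have hC0 : 0 < C := by linarith
  have : A * B + B * C + A * C + A * B * C = 0 := by linarith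
  have : 0 < A * B + B * C + A * C + A * B * C := by positivity
  linarith

theorem one_sub_half_le_cos {y : ℝ} (h0 : 0 ≤ y) (h1 : y ≤ 1) :
    1 - y / 2 ≤ Real.cos (y * (Real.pi / 3)) := by
  have hπ := Real.pi_pos
  have := strictConcaveOn_cos_Icc.concaveOn.2
    (show (0 : ℝ) ∈ _ from ⟨by linarith, by linarith⟩)
    (show Real.pi / 3 ∈ _ from ⟨by linarith, by linarith⟩) (sub_nonneg.2 h1) h0 (by ring)
  simp only [smul_eq_mul, Real.cos_zero, Real.cos_pi_div_three, mul_zero, zero_add] at this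
  linarith

theorem arctan_lt_of_edge {a b g h t : ℝ} (ha : 0 ≤ a) (hb : 0 ≤ b) (hab : a + b ≤ 1)
    (hg : (1 - a) * (g - 1) < 1) (hh : (1 - b) * (h - 1) < 1) (hg1 : 1 < g) (hh1 : 1 < h)
    (hgh : 1 + t ^ 2 = g * h) :
    Real.arctan t < Real.pi / 3 + Real.pi / 6 * (a + b) := by
  have hπ := Real.pi_pos
  rcases hab.eq_or_lt with hx | hx
  · rw [hx]
    have := Real.arctan_lt_pi_div_two t
    linarith
  by_contra! hcon
  set φ := Real.pi / 3 + Real.pi / 6 * (a + b) with hφ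
  have hφ0 : 0 ≤ φ := by positivity
  have hcos := Real.cos_le_cos_of_nonneg_of_le_pi hφ0
    (by linarith [Real.arctan_lt_pi_div_two t]) hcon
  have h2 : Real.cos (Real.arctan t) ^ 2 ≤ Real.cos φ ^ 2 :=
    pow_le_pow_left₀ (Real.cos_arctan_pos t).le hcos 2
  rw [Real.cos_sq_arctan, hgh] at h2
  have h3 : Real.cos φ ^ 2 = 1 / 2 - Real.cos ((1 - (a + b)) * (Real.pi / 3)) / 2 := by
    rw [Real.cos_sq, show 2 * φ = Real.pi - (1 - (a + b)) * (Real.pi / 3) by rw [hφ]; ring,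
      Real.cos_pi_sub]
    ring
  have h4 := one_sub_half_le_cos (y := 1 - (a + b)) (by linarith) (by linarith)
  have h5 : 1 / (g * h) ≤ (1 - (a + b)) / 4 := by rw [h3] at h2; linarith
  rw [div_le_iff₀ (by positivity)] at h5
  have p1 : (1 - a) * g < 2 - a := by linarith
  have p2 : (1 - b) * h < 2 - b := by linarith
  have p3 : ((1 - a) * g) * ((1 - b) * h) < (2 - a) * (2 - b) :=
    mul_lt_mul'' p1 p2 (mul_nonneg (by linarith) (by linarith))
      (mul_nonneg (by linarith) (by linarith))
  have p4 : (1 - a) * (1 - b) ≤ (1 - a) * (1 - b) * ((1 - (a + b)) / 4 * (g * h)) :=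
    le_mul_of_one_le_right (mul_nonneg (by linarith) (by linarith)) h5
  have p5 : (1 - (a + b)) / 4 * (((1 - a) * g) * ((1 - b) * h)) <
      (1 - (a + b)) / 4 * ((2 - a) * (2 - b)) := mul_lt_mul_of_pos_left p3 (by linarith)
  have p6 : (1 - (a + b)) / 4 * ((2 - a) * (2 - b)) ≤ (1 - a) * (1 - b) := by
    nlinarith [mul_nonneg ha hb, mul_nonneg (add_nonneg ha hb) (mul_nonneg ha hb)]
  linarith

theorem mul_cross_pos {x₀ y₀ x₁ y₁ x₂ y₂ : ℝ} (h01 : x₀ * x₁ + y₀ * y₁ = 1)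
    (h12 : x₁ * x₂ + y₁ * y₂ = 1) (h02 : x₀ * x₂ + y₀ * y₂ ≤ 1) (h0 : 1 < x₀ ^ 2 + y₀ ^ 2)
    (h1 : 1 < x₁ ^ 2 + y₁ ^ 2) (h2 : 1 < x₂ ^ 2 + y₂ ^ 2) :
    0 < (x₀ * y₁ - y₀ * x₁) * (x₁ * y₂ - y₁ * x₂) := by
  obtain ⟨s, hs⟩ : ∃ s, s = x₀ * y₁ - y₀ * x₁ := ⟨_, rfl⟩
  obtain ⟨t, ht⟩ : ∃ t, t = x₁ * y₂ - y₁ * x₂ := ⟨_, rfl⟩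
  rw [← hs, ← ht]
  have e1 : 1 + s ^ 2 = (x₀ ^ 2 + y₀ ^ 2) * (x₁ ^ 2 + y₁ ^ 2) := by
    rw [hs]; linear_combination (-1 - (x₀ * x₁ + y₀ * y₁)) * h01
  have e2 : 1 + t ^ 2 = (x₁ ^ 2 + y₁ ^ 2) * (x₂ ^ 2 + y₂ ^ 2) := by
    rw [ht]; linear_combination (-1 - (x₁ * x₂ + y₁ * y₂)) * h12
  have e3 : 1 - s * t = (x₁ ^ 2 + y₁ ^ 2) * (x₀ * x₂ + y₀ * y₂) := by
    rw [hs, ht]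
    linear_combination (-1) * h12 - (x₁ * x₂ + y₁ * y₂) * h01
  set g := x₁ ^ 2 + y₁ ^ 2
  have l1 : g - 1 < s ^ 2 := by nlinarith
  have l2 : g - 1 < t ^ 2 := by nlinarith
  have l3 : -(s * t) ≤ g - 1 := by nlinarith
  by_contra! hneg
  have : (g - 1) * (g - 1) < s ^ 2 * t ^ 2 := mul_lt_mul'' l1 l2 (by linarith) (by linarith)
  nlinarith

theorem false_of_planar_pentagon_of_pos {x y d : Fin 5 → ℝ}
    (hadj : ∀ k, x k * x (k + 1) + y k * y (k + 1) = 1)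
    (hcross : ∀ k, 0 < x k * y (k + 1) - y k * x (k + 1))
    (hG : ∀ k, 1 < x k ^ 2 + y k ^ 2) (hd1 : ∀ k, d k ≤ 1)
    (hd : ∀ k, d k * (x k ^ 2 + y k ^ 2 - 1) < 1) (hsum : ∑ k, d k = 4) : False := by
  set t : Fin 5 → ℝ := fun k => x k * y (k + 1) - y k * x (k + 1) with ht
  have hprod : ∏ k, ((⟨1, t k⟩ : ℂ)) = ((∏ k, (x k ^ 2 + y k ^ 2) : ℝ) : ℂ) := by
    have hw : ∀ k, (⟨1, t k⟩ : ℂ) = (⟨x k, -y k⟩ : ℂ) * ⟨x (k + 1), y (k + 1)⟩ := by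
      intro k
      apply Complex.ext
      · simp only [Complex.mul_re]; linarith [hadj k]
      · simp only [Complex.mul_im, ht]; ring
    have hz : ∀ k, (⟨x k, -y k⟩ : ℂ) * ⟨x k, y k⟩ = ((x k ^ 2 + y k ^ 2 : ℝ) : ℂ) := by
      intro k
      apply Complex.ext
      · simp only [Complex.mul_re, Complex.ofReal_re]; ring
      · simp only [Complex.mul_im, Complex.ofReal_im]; ring
    simp only [hw, prod_mul_distrib, Complex.ofReal_prod, ← hz]
    congr 1
    exact Equiv.prod_comp (Equiv.addRight (1 : Fin 5)) (fun k => (⟨x k, y k⟩ : ℂ))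
  have hpolar : ∀ k, (⟨1, t k⟩ : ℂ) =
      (Real.sqrt (1 + t k ^ 2) : ℂ) * Complex.exp (Real.arctan (t k) * Complex.I) := by
    intro k
    have hs : Real.sqrt (1 + t k ^ 2) ≠ 0 := by positivity
    apply Complex.ext
    · rw [Complex.re_ofReal_mul, Complex.exp_ofReal_mul_I_re, Real.cos_arctan]
      field_simp
    · rw [Complex.im_ofReal_mul, Complex.exp_ofReal_mul_I_im, Real.sin_arctan]
      field_simp
  have hcos : Real.cos (∑ k, Real.arctan (t k)) = 1 := by
    simp only [hpolar, prod_mul_distrib, ← Complex.exp_sum, ← sum_mul, ← Complex.ofReal_prod,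
      ← Complex.ofReal_sum] at hprod
    have hn := congrArg norm hprod
    rw [norm_mul, Complex.norm_exp_ofReal_mul_I, mul_one, Complex.norm_real, Complex.norm_real,
      Real.norm_of_nonneg (by positivity), Real.norm_of_nonneg (by positivity)] at hn
    have hp : (0 : ℝ) < ∏ k, (x k ^ 2 + y k ^ 2) :=
      prod_pos fun k _ => by linarith [hG k]
    rw [hn] at hprod
    have he := mul_left_cancel₀ (Complex.ofReal_ne_zero.2 hp.ne') (hprod.trans (mul_one _).symm)
    have := congrArg Complex.re he
    rwa [Complex.exp_ofReal_mul_I_re] at this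
  have hS0 : 0 < ∑ k, Real.arctan (t k) :=
    sum_pos (fun k _ => Real.arctan_pos.2 (hcross k)) univ_nonempty
  have ha : ∀ k, 0 ≤ 1 - d k := fun k => by linarith [hd1 k]
  have hlt : ∀ k, Real.arctan (t k) <
      Real.pi / 3 + Real.pi / 6 * ((1 - d k) + (1 - d (k + 1))) := by
    intro k
    refine arctan_lt_of_edge (ha k) (ha _) ?_ (by simpa using hd k) (by simpa using hd (k + 1))
      (hG k) (hG (k + 1)) ?_
    · have e : ∑ i, (1 - d i) = 1 := by rw [sum_sub_distrib, hsum]; norm_num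
      have hp := sum_le_univ_sum_of_nonneg (s := {k, k + 1}) ha
      rwa [sum_pair (by simp), e] at hp
    · simp only [ht]
      linear_combination (-1 - (x k * x (k + 1) + y k * y (k + 1))) * hadj k
  have hS : ∑ k, Real.arctan (t k) < 2 * Real.pi := by
    refine (sum_lt_sum_of_nonempty univ_nonempty fun k _ => hlt k).trans_eq ?_
    have e2 : ∑ k, d (k + 1) = 4 := by
      rw [← hsum]; exact Equiv.sum_comp (Equiv.addRight (1 : Fin 5)) d
    rw [sum_add_distrib, ← mul_sum, sum_add_distrib, sum_sub_distrib, sum_sub_distrib, hsum, e2]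
    norm_num
    ring
  have := (Real.cos_eq_one_iff_of_lt_of_lt (by linarith [Real.pi_pos]) hS).1 hcos
  linarith

theorem false_of_planar_pentagon {x y d : Fin 5 → ℝ}
    (hadj : ∀ k, x k * x (k + 1) + y k * y (k + 1) = 1)
    (hnonadj : ∀ k, x k * x (k + 2) + y k * y (k + 2) ≤ 1)
    (hG : ∀ k, 1 < x k ^ 2 + y k ^ 2) (hd1 : ∀ k, d k ≤ 1)
    (hd : ∀ k, d k * (x k ^ 2 + y k ^ 2 - 1) < 1) (hsum : ∑ k, d k = 4) : False := by
  have hmul : ∀ k, 0 < (x k * y (k + 1) - y k * x (k + 1)) *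
      (x (k + 1) * y (k + 1 + 1) - y (k + 1) * x (k + 1 + 1)) := by
    intro k
    have h2 := hnonadj k
    rw [show k + 2 = k + 1 + 1 by rw [add_assoc]; rfl] at h2
    exact mul_cross_pos (hadj k) (hadj (k + 1)) h2 (hG k) (hG _) (hG _)
  rcases lt_or_ge 0 (x 0 * y (0 + 1) - y 0 * x (0 + 1)) with h0 | h0
  · have key : ∀ k, 0 < x k * y (k + 1) - y k * x (k + 1) := by
      intro k
      induction k using Fin.induction with
      | zero => exact h0
      | succ i ih =>
        have := (pos_iff_pos_of_mul_pos (hmul i.castSucc)).1 ih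
        simpa using this
    exact false_of_planar_pentagon_of_pos hadj key hG hd1 hd hsum
  · have key : ∀ k, x k * y (k + 1) - y k * x (k + 1) < 0 := by
      intro k
      induction k using Fin.induction with
      | zero => exact lt_of_le_of_ne h0 (left_ne_zero_of_mul (hmul 0).ne')
      | succ i ih =>
        have := (neg_iff_neg_of_mul_pos (hmul i.castSucc)).1 ih
        simpa using this
    refine false_of_planar_pentagon_of_pos (x := x) (y := fun k => -y k) (d := d)
      ?_ ?_ ?_ hd1 ?_ hsum
    · intro k; simpa using hadj k
    · intro k; linarith [key k]
    · intro k; simpa using hG k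
    · intro k; simpa using hd k

set_option synthInstance.maxSize 1000 in
set_option synthInstance.maxHeartbeats 0 in
theorem exists_five_cycle_of_bool : ∀ e₀₁ e₀₂ e₁₂ : Bool, ¬(e₀₁ = e₀₂ ∧ e₀₂ = e₁₂) →
    ∀ e₀₃ e₁₃, ¬(e₀₁ = e₀₃ ∧ e₀₃ = e₁₃) → ∀ e₂₃, ¬(e₀₂ = e₀₃ ∧ e₀₃ = e₂₃) →
    ¬(e₁₂ = e₁₃ ∧ e₁₃ = e₂₃) → ∀ e₀₄ e₁₄, ¬(e₀₁ = e₀₄ ∧ e₀₄ = e₁₄) →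
    ∀ e₂₄, ¬(e₀₂ = e₀₄ ∧ e₀₄ = e₂₄) → ¬(e₁₂ = e₁₄ ∧ e₁₄ = e₂₄) →
    ∀ e₃₄, ¬(e₀₃ = e₀₄ ∧ e₀₄ = e₃₄) → ¬(e₁₃ = e₁₄ ∧ e₁₄ = e₃₄) → ¬(e₂₃ = e₂₄ ∧ e₂₄ = e₃₄) →
    let e : Fin 5 → Fin 5 → Bool := ![![false, e₀₁, e₀₂, e₀₃, e₀₄], ![e₀₁, false, e₁₂, e₁₃, e₁₄],
      ![e₀₂, e₁₂, false, e₂₃, e₂₄], ![e₀₃, e₁₃, e₂₃, false, e₃₄], ![e₀₄, e₁₄, e₂₄, e₃₄, false]]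
    ∃ a, e 0 a ∧ ∃ b, b ≠ 0 ∧ e a b ∧ ∃ c, c ≠ 0 ∧ c ≠ a ∧ e b c ∧
      ∃ d, d ≠ a ∧ d ≠ b ∧ e c d ∧ e d 0 := by
  decide +kernel

theorem exists_five_cycle {R : Fin 5 → Fin 5 → Prop} (hsymm : ∀ i j, R i j → R j i)
    (htri : ∀ i j k, i < j → j < k → R i j → R j k → R i k → False)
    (hind : ∀ i j k, i < j → j < k → R i j ∨ R j k ∨ R i k) :
    ∃ σ : Fin 5 → Fin 5, σ.Injective ∧ ∀ k, R (σ k) (σ (k + 1)) := by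
  classical
  let e : Fin 5 → Fin 5 → Bool := fun i j => i ≠ j ∧ R i j
  have hs : ∀ i j, e i j = e j i := fun i j => by
    simp only [e, ne_comm (a := i), (⟨hsymm i j, hsymm j i⟩ : R i j ↔ R j i)]
  have he : e = ![![false, e 0 1, e 0 2, e 0 3, e 0 4], ![e 0 1, false, e 1 2, e 1 3, e 1 4],
      ![e 0 2, e 1 2, false, e 2 3, e 2 4], ![e 0 3, e 1 3, e 2 3, false, e 3 4],
      ![e 0 4, e 1 4, e 2 4, e 3 4, false]] := by
    have h0 : ∀ i, e i i = false := fun i => by simp [e]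
    funext i j
    fin_cases i <;> fin_cases j <;> first | exact h0 _ | rfl | exact hs _ _
  have hne : ∀ i j k, i < j → j < k → ¬(e i j = e i k ∧ e i k = e j k) := by
    intro i j k hij hjk
    have h1 := htri i j k hij hjk
    have h2 := hind i j k hij hjk
    simp only [e, decide_eq_decide, hij.ne, hjk.ne, (hij.trans hjk).ne, ne_eq, not_false_eq_true,
      true_and]
    tauto
  have key := exists_five_cycle_of_bool (e 0 1) (e 0 2) (e 1 2) (hne 0 1 2 (by decide) (by decide))
    (e 0 3) (e 1 3) (hne 0 1 3 (by decide) (by decide)) (e 2 3) (hne 0 2 3 (by decide) (by decide))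
    (hne 1 2 3 (by decide) (by decide)) (e 0 4) (e 1 4) (hne 0 1 4 (by decide) (by decide)) (e 2 4)
    (hne 0 2 4 (by decide) (by decide)) (hne 1 2 4 (by decide) (by decide)) (e 3 4)
    (hne 0 3 4 (by decide) (by decide)) (hne 1 3 4 (by decide) (by decide))
    (hne 2 3 4 (by decide) (by decide))
  simp only [← he] at key
  simp only [e, decide_eq_true_eq] at key
  obtain ⟨a, ⟨ha, h0a⟩, b, hb, ⟨hab, hRab⟩, c, hc, hca, ⟨hbc, hRbc⟩, d, hda, hdb, ⟨hcd, hRcd⟩,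
    hd, hRd⟩ := key
  refine ⟨![0, a, b, c, d], fun i j hij => ?_, fun k => ?_⟩
  · fin_cases i <;> fin_cases j <;> simp at hij ⊢ <;> grind
  · fin_cases k <;> simpa

theorem exists_ne_zero_orthogonal_of_triple_eq_zero {u v w : Fin 3 → ℝ} (h : u ⬝ᵥ v ⨯₃ w = 0) :
    ∃ a ≠ 0, a ⬝ᵥ u = 0 ∧ a ⬝ᵥ v = 0 ∧ a ⬝ᵥ w = 0 := by
  rw [triple_product_eq_det] at h
  obtain ⟨a, ha, h⟩ := Matrix.exists_mulVec_eq_zero_iff.2 h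
  refine ⟨a, ha, ?_, ?_, ?_⟩ <;> rw [dotProduct_comm]
  · exact congrFun h 0
  · exact congrFun h 1
  · exact congrFun h 2

section SignPattern
variable {R : Fin 5 → Fin 5 → Prop} {r : Fin 5 → Fin 3 → ℝ}

theorem rel_of_forall_exists_mul_pos (hR : ∀ p q, R p q → R q p)
    (H : ∀ a ≠ 0, ∃ p q, p ≠ q ∧ R p q ∧ 0 < (a ⬝ᵥ r p) * (a ⬝ᵥ r q)) {i j k : Fin 5}
    (hij : i ≠ j) (hjk : j ≠ k) (hik : i ≠ k) : R i j ∨ R j k ∨ R i k := by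
  obtain ⟨l, m, hcov⟩ : ∃ l m, ∀ p, p = i ∨ p = j ∨ p = k ∨ p = l ∨ p = m := by
    revert i j k; decide +kernel
  obtain ⟨a, ha, h1, h2, -⟩ := exists_ne_zero_orthogonal_of_triple_eq_zero
    (u := r l) (v := r m) (w := 0) (by simp)
  obtain ⟨p, q, hpq, hR', h⟩ := H a ha
  have hR'' := hR _ _ hR'
  rcases hcov p with rfl | rfl | rfl | rfl | rfl <;>
    rcases hcov q with rfl | rfl | rfl | rfl | rfl <;>
    first | (simp only [h1, h2, mul_zero, zero_mul, lt_irrefl] at h) | tauto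

theorem exists_rel_of_forall_exists_mul_pos (hR : ∀ p q, R p q → R q p)
    (H : ∀ a ≠ 0, ∃ p q, p ≠ q ∧ R p q ∧ 0 < (a ⬝ᵥ r p) * (a ⬝ᵥ r q)) {i m : Fin 5}
    (him : i ≠ m) : ∃ j, j ≠ i ∧ j ≠ m ∧ R i j := by
  by_contra! hno
  have hno' : ∀ j, j ≠ i → j ≠ m → ¬ R j i := fun j h1 h2 h => hno j h1 h2 (hR _ _ h)
  have key : ∀ j k l, (∀ p, p = i ∨ p = m ∨ p = j ∨ p = k ∨ p = l) → j ≠ i → j ≠ m → k ≠ i → k ≠ m →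
      0 < (r m ⬝ᵥ r l ⨯₃ r j) * (r m ⬝ᵥ r l ⨯₃ r k) := by
    intro j k l hcov hji hjm hki hkm
    have hne : r m ⬝ᵥ r l ⨯₃ r j ≠ 0 := by
      intro h0
      obtain ⟨a, ha, h1, h2, h3⟩ := exists_ne_zero_orthogonal_of_triple_eq_zero h0
      obtain ⟨p, q, hpq, hR', h⟩ := H a ha
      rcases hcov p with rfl | rfl | rfl | rfl | rfl <;>
        rcases hcov q with rfl | rfl | rfl | rfl | rfl <;>
        first
          | (simp only [h1, h2, h3, mul_zero, zero_mul, lt_irrefl] at h)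
          | exact absurd rfl hpq
          | exact hno _ ‹_› ‹_› hR'
          | exact hno' _ ‹_› ‹_› hR'
    have hx : ∀ p, (r m ⨯₃ r l) ⬝ᵥ r p = r m ⬝ᵥ r l ⨯₃ r p := fun p => by
      rw [triple_product_permutation (r m), triple_product_permutation (r l), dotProduct_comm]
    have h1 : (r m ⨯₃ r l) ⬝ᵥ r m = 0 := by rw [dotProduct_comm]; exact dot_self_cross _ _
    have h2 : (r m ⨯₃ r l) ⬝ᵥ r l = 0 := by rw [dotProduct_comm]; exact dot_cross_self _ _
    obtain ⟨p, q, hpq, hR', h⟩ := H (r m ⨯₃ r l) (by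
      intro h0
      rw [← hx, h0, zero_dotProduct] at hne
      exact hne rfl)
    rw [← hx, ← hx]
    rcases hcov p with rfl | rfl | rfl | rfl | rfl <;>
      rcases hcov q with rfl | rfl | rfl | rfl | rfl <;>
      first
        | (simp only [h1, h2, mul_zero, zero_mul, lt_irrefl] at h)
        | exact absurd rfl hpq
        | exact absurd hR' (hno _ ‹_› ‹_›)
        | exact absurd hR' (hno' _ ‹_› ‹_›)
        | exact h
        | exact (mul_comm _ _).trans_gt h
  obtain ⟨j, k, l, hcov, hji, hjm, hki, hkm, hli, hlm⟩ : ∃ j k l,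
      (∀ p, p = i ∨ p = m ∨ p = j ∨ p = k ∨ p = l) ∧ j ≠ i ∧ j ≠ m ∧ k ≠ i ∧ k ≠ m ∧
        l ≠ i ∧ l ≠ m := by
    clear key hno hno'
    revert i m; decide +kernel
  have e1 := key j k l hcov hji hjm hki hkm
  have e2 := key k l j (fun p => by have := hcov p; tauto) hki hkm hli hlm
  have e3 := key l j k (fun p => by have := hcov p; tauto) hli hlm hji hjm
  have anti : ∀ p q, r m ⬝ᵥ r p ⨯₃ r q = -(r m ⬝ᵥ r q ⨯₃ r p) := fun p q => by
    rw [← cross_anticomm, dotProduct_neg]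
  rw [anti l k] at e1
  rw [anti j l] at e2
  rw [anti k j] at e3
  have := mul_pos (mul_pos e1 e2) e3
  nlinarith [sq_nonneg ((r m ⬝ᵥ r l ⨯₃ r j) * (r m ⬝ᵥ r j ⨯₃ r k) * (r m ⬝ᵥ r k ⨯₃ r l))]
end SignPattern

/-- The symmetric matrices with diagonal `-d`, nonnegative off-diagonal entries and all
eigenvalues at most one. -/
structure IsFeasible (d : Fin 5 → ℝ) (M : Matrix (Fin 5) (Fin 5) ℝ) : Prop where
  symm : M.IsSymm
  diag : ∀ i, M i i = -d i
  offDiag : ∀ i j, i ≠ j → 0 ≤ M i j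
  form_le : ∀ x, x ⬝ᵥ M *ᵥ x ≤ x ⬝ᵥ x

theorem dotProduct_mulVec_eq_sum {n : ℕ} (M : Matrix (Fin n) (Fin n) ℝ) (x y : Fin n → ℝ) :
    x ⬝ᵥ M *ᵥ y = ∑ p, ∑ q, M p q * (x p * y q) := by
  simp only [dotProduct, mulVec, mul_sum]
  exact sum_congr rfl fun p _ => sum_congr rfl fun q _ => by ring

theorem IsSortedEigenbasis.mulVec_eq_of_form_eq {n : ℕ} {M : Matrix (Fin (n + 1)) (Fin (n + 1)) ℝ}
    {l : Fin (n + 1) → ℝ} {e : Fin (n + 1) → Fin (n + 1) → ℝ} (h : IsSortedEigenbasis M l e)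
    (hM : M.IsSymm) {x : Fin (n + 1) → ℝ} (hx : l 0 * (x ⬝ᵥ x) ≤ x ⬝ᵥ M *ᵥ x) :
    M *ᵥ x = l 0 • x := by
  rw [h.form_eq_sum hM, h.normSq_eq_sum, mul_sum, ← sub_nonpos, ← sum_sub_distrib] at hx
  have hnn : ∀ i ∈ univ, 0 ≤ l 0 * (e i ⬝ᵥ x) ^ 2 - l i * (e i ⬝ᵥ x) ^ 2 := fun i _ => by
    rw [← sub_mul]
    exact mul_nonneg (sub_nonneg.2 (h.anti (Fin.zero_le i))) (sq_nonneg _)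
  have h0 := (sum_eq_zero_iff_of_nonneg hnn).1 (le_antisymm hx (sum_nonneg hnn))
  conv_lhs => rw [h.expand x]
  conv_rhs => rw [h.expand x]
  rw [mulVec_sum, smul_sum]
  refine sum_congr rfl fun i hi => ?_
  rw [mulVec_smul, h.eig, smul_smul, smul_smul]
  congr 1
  have := h0 i hi
  rw [← sub_mul, mul_eq_zero, sq_eq_zero_iff] at this
  rcases this with h1 | h1
  · rw [sub_eq_zero.1 h1, mul_comm]
  · rw [h1, zero_mul, mul_zero]

namespace IsFeasible
variable {d : Fin 5 → ℝ} {M : Matrix (Fin 5) (Fin 5) ℝ} {l : Fin 5 → ℝ} {e : Fin 5 → Fin 5 → ℝ}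

theorem eigenvalue_le_one (h : IsFeasible d M) (he : IsSortedEigenbasis M l e) (i : Fin 5) :
    l i ≤ 1 := by
  have := h.form_le (e i)
  rwa [he.eig, dotProduct_smul, he.orth, if_pos rfl, smul_eq_mul, mul_one] at this

theorem exists_mul_pos (h : IsFeasible d M) (hd : ∀ i, 0 ≤ d i) (he : IsSortedEigenbasis M l e)
    (h2 : 0 < l 2) {a : Fin 3 → ℝ} (ha : a ≠ 0) : ∃ p q, p ≠ q ∧ 0 < M p q ∧
      0 < (a ⬝ᵥ ![e 0 p, e 1 p, e 2 p]) * (a ⬝ᵥ ![e 0 q, e 1 q, e 2 q]) := by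
  let x : Fin 5 → ℝ := a 0 • e 0 + a 1 • e 1 + a 2 • e 2
  have hx : ∀ p, a ⬝ᵥ ![e 0 p, e 1 p, e 2 p] = x p := fun p => by
    simp [x, dotProduct, Fin.sum_univ_three]
  simp only [hx]
  have hpos : 0 < x ⬝ᵥ M *ᵥ x := by
    rw [he.form_eq_sum h.symm]
    have h01 : l 2 ≤ l 1 := he.anti (by decide)
    have h00 : l 2 ≤ l 0 := he.anti (by decide)
    have hsq : 0 < a 0 ^ 2 + a 1 ^ 2 + a 2 ^ 2 := by
      obtain ⟨k, hk⟩ := Function.ne_iff.1 ha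
      have := sq_pos_of_ne_zero hk
      fin_cases k <;> simp at this <;> positivity
    simp only [x, dotProduct_add, dotProduct_smul, he.orth, Fin.sum_univ_five, smul_eq_mul]
    simp
    nlinarith [mul_nonneg (sub_nonneg.2 h01) (sq_nonneg (a 1)),
      mul_nonneg (sub_nonneg.2 h00) (sq_nonneg (a 0)), mul_pos h2 hsq]
  rw [dotProduct_mulVec_eq_sum] at hpos
  obtain ⟨p, -, hp⟩ := exists_lt_of_sum_lt (hpos.trans_eq' sum_const_zero.symm)
  obtain ⟨q, -, hq⟩ := exists_lt_of_sum_lt (hp.trans_eq' sum_const_zero.symm)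
  have hpq : p ≠ q := by
    rintro rfl
    rw [h.diag] at hq
    nlinarith [mul_nonneg (hd p) (mul_self_nonneg (x p))]
  have hM := h.offDiag p q hpq
  exact ⟨p, q, hpq, lt_of_le_of_ne hM (left_ne_zero_of_mul hq.ne').symm,
    pos_of_mul_pos_right hq hM⟩

theorem pos_of_eigenvector (h : IsFeasible d M) {c : ℝ} {y : Fin 5 → ℝ}
    (hdeg : ∀ i m, i ≠ m → ∃ j, j ≠ i ∧ j ≠ m ∧ 0 < M i j)
    (hy : ∀ i, 0 ≤ y i) (hMy : M *ᵥ y = c • y) (hy0 : y ≠ 0) (i : Fin 5) : 0 < y i := by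
  have hclosed : ∀ i j, 0 < M i j → y i = 0 → y j = 0 := by
    intro i j hij hi
    have := congrFun hMy i
    simp only [Pi.smul_apply, hi, smul_zero, mulVec, dotProduct] at this
    have hnn : ∀ q ∈ univ, 0 ≤ M i q * y q := fun q _ => by
      rcases eq_or_ne i q with rfl | hq
      · rw [hi, mul_zero]
      · exact mul_nonneg (h.offDiag i q hq) (hy q)
    exact (mul_eq_zero.1 ((sum_eq_zero_iff_of_nonneg hnn).1 this j (mem_univ j))).resolve_left
      hij.ne'
  have htwo : ∀ i, ∃ j k, j ≠ i ∧ k ≠ i ∧ j ≠ k ∧ 0 < M i j ∧ 0 < M i k := by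
    intro i
    obtain ⟨j, hj, -, hij⟩ := hdeg i (i + 1) (by simp)
    obtain ⟨k, hk, hkj, hik⟩ := hdeg i j hj.symm
    exact ⟨j, k, hj, hk, hkj.symm, hij, hik⟩
  have hcard : ∀ s : Finset (Fin 5), s.Nonempty → (∀ i j, i ∈ s → 0 < M i j → j ∈ s) →
      3 ≤ s.card := by
    rintro s ⟨i, hi⟩ hs
    obtain ⟨j, k, hji, hki, hjk, hij, hik⟩ := htwo i
    have : ({i, j, k} : Finset (Fin 5)).card = 3 := card_eq_three.2
      ⟨i, j, k, hji.symm, hki.symm, hjk, rfl⟩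
    rw [← this]
    refine card_le_card fun t ht => ?_
    simp only [mem_insert, mem_singleton] at ht
    rcases ht with rfl | rfl | rfl
    exacts [hi, hs _ _ hi hij, hs _ _ hi hik]
  by_contra hi
  have hi0 : y i = 0 := le_antisymm (not_lt.1 hi) (hy i)
  obtain ⟨k, hk⟩ := Function.ne_iff.1 hy0
  have c1 := hcard {i | y i = 0} ⟨i, by simpa using hi0⟩
    (by simpa using fun i j h1 h2 => hclosed i j h2 h1)
  have c2 := hcard {i | ¬ y i = 0} ⟨k, by simpa using hk⟩ (by
    simp only [mem_filter_univ]
    exact fun i j h1 h2 h3 => h1 (hclosed j i (h.symm.apply i j ▸ h2) h3))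
  have := card_filter_add_card_filter_not (s := (univ : Finset (Fin 5))) (fun i => y i = 0)
  simp at this
  omega

theorem sign_of_top_eigenvector (h : IsFeasible d M) (he : IsSortedEigenbasis M l e)
    (hdeg : ∀ i m, i ≠ m → ∃ j, j ≠ i ∧ j ≠ m ∧ 0 < M i j) {x : Fin 5 → ℝ}
    (hx : M *ᵥ x = l 0 • x) (hx0 : x ≠ 0) : (∀ i, 0 < x i) ∨ ∀ i, x i < 0 := by
  let y : Fin 5 → ℝ := fun i => |x i|
  have hy0 : y ≠ 0 := fun hy => hx0 (funext fun i => abs_eq_zero.1 (congrFun hy i))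
  have hy : M *ᵥ y = l 0 • y := by
    apply he.mulVec_eq_of_form_eq h.symm
    have h1 : y ⬝ᵥ y = x ⬝ᵥ x := by simp [y, dotProduct]
    have h2 : x ⬝ᵥ M *ᵥ x = l 0 * (x ⬝ᵥ x) := by rw [hx, dotProduct_smul, smul_eq_mul]
    rw [h1, ← h2, dotProduct_mulVec_eq_sum, dotProduct_mulVec_eq_sum]
    refine sum_le_sum fun p _ => sum_le_sum fun q _ => ?_
    rcases eq_or_ne p q with rfl | hpq
    · simp [y]
    · refine mul_le_mul_of_nonneg_left ?_ (h.offDiag p q hpq)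
      rw [← abs_mul]
      exact le_abs_self _
  have hpos := h.pos_of_eigenvector hdeg (fun i => abs_nonneg _) hy hy0
  by_cases hz : y + x = 0
  · refine Or.inr fun i => ?_
    have h1 := congrFun hz i
    have h2 := hpos i
    simp only [Pi.add_apply, Pi.zero_apply] at h1
    linarith
  · refine Or.inl fun i => ?_
    have h1 := h.pos_of_eigenvector hdeg (y := y + x) (c := l 0)
      (fun i => by simp only [Pi.add_apply, y]; linarith [neg_abs_le (x i)])
      (by rw [mulVec_add, hx, hy, smul_add]) hz i
    by_contra! hneg
    simp only [Pi.add_apply, y, abs_of_nonpos hneg] at h1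
    linarith

theorem top_eigenvector_mul_pos (h : IsFeasible d M) (he : IsSortedEigenbasis M l e)
    (hdeg : ∀ i m, i ≠ m → ∃ j, j ≠ i ∧ j ≠ m ∧ 0 < M i j) (i j : Fin 5) :
    0 < e 0 i * e 0 j := by
  rcases h.sign_of_top_eigenvector he hdeg (he.eig 0) (fun h0 => by
    simpa [h0] using he.orth 0 0) with h1 | h1
  · exact mul_pos (h1 i) (h1 j)
  · exact mul_pos_of_neg_of_neg (h1 i) (h1 j)

theorem top_eigenvalue_simple (h : IsFeasible d M) (he : IsSortedEigenbasis M l e)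
    (hdeg : ∀ i m, i ≠ m → ∃ j, j ≠ i ∧ j ≠ m ∧ 0 < M i j) : l 1 < l 0 := by
  refine lt_of_le_of_ne (he.anti (Fin.zero_le 1)) fun heq => ?_
  have hs := h.top_eigenvector_mul_pos he hdeg
  have horth : ∑ i, e 0 i * e 1 i = 0 := he.orth 0 1
  have h0 := h.sign_of_top_eigenvector he hdeg (he.eig 0) (fun h0 => by
    simpa [h0] using he.orth 0 0)
  have h1 := h.sign_of_top_eigenvector he hdeg (x := e 1) (heq ▸ he.eig 1) (fun h0 => by
    simpa [h0] using he.orth 1 1)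
  rcases h0 with h0 | h0 <;> rcases h1 with h1 | h1
  · exact (sum_pos (fun i _ => mul_pos (h0 i) (h1 i)) univ_nonempty).ne' horth
  · exact (sum_neg (fun i _ => mul_neg_of_pos_of_neg (h0 i) (h1 i)) univ_nonempty).ne horth
  · exact (sum_neg (fun i _ => mul_neg_of_neg_of_pos (h0 i) (h1 i)) univ_nonempty).ne horth
  · exact (sum_pos (fun i _ => mul_pos_of_neg_of_neg (h0 i) (h1 i)) univ_nonempty).ne' horth
end IsFeasible

/-- The compression of `M` to the span of the vectors `G a`. -/
def compression {m n : ℕ} (M : Matrix (Fin n) (Fin n) ℝ) (G : Fin m → Fin n → ℝ) :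
    Matrix (Fin m) (Fin m) ℝ :=
  of fun a b => G a ⬝ᵥ M *ᵥ G b

theorem compression_isSymm {m n : ℕ} {M : Matrix (Fin n) (Fin n) ℝ} (hM : M.IsSymm)
    (G : Fin m → Fin n → ℝ) : (compression M G).IsSymm := by
  ext a b
  simp only [compression, transpose_apply, of_apply]
  rw [Matrix.dotProduct_mulVec, ← mulVec_transpose, hM.eq, dotProduct_comm]

theorem IsSortedEigenbasis.det_compression_le {M : Matrix (Fin 5) (Fin 5) ℝ} {l : Fin 5 → ℝ}
    {e : Fin 5 → Fin 5 → ℝ} (he : IsSortedEigenbasis M l e) (hM : M.IsSymm)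
    {G : Fin 3 → Fin 5 → ℝ} (hG : ∀ a b, G a ⬝ᵥ G b = if a = b then 1 else 0)
    (hpos : ∀ y, 0 ≤ y ⬝ᵥ compression M G *ᵥ y) :
    (compression M G).det ≤ l 0 * l 1 * l 2 ∧ (0 < (compression M G).det → 0 < l 2) := by
  obtain ⟨s, f, hs, hdet, -⟩ := exists_isSortedEigenbasis (compression_isSymm hM G)
  have h0 : ∀ i, 0 ≤ s i := fun i => by
    have := hpos (f i)
    rwa [hs.eig, dotProduct_smul, hs.orth, if_pos rfl, smul_eq_mul, mul_one] at this
  have hle {i : Fin 3} {j : Fin 5} (hij : i.val = j.val) : s i ≤ l j :=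
    he.compression_le hM hG (fun _ _ => rfl) hs hij
  rw [hdet, Fin.prod_univ_three]
  have l0 := hle (i := 0) (j := 0) rfl
  have l1 := hle (i := 1) (j := 1) rfl
  have l2 := hle (i := 2) (j := 2) rfl
  refine ⟨mul_le_mul (mul_le_mul l0 l1 (h0 _) ((h0 _).trans l0)) l2 (h0 _)
    (mul_nonneg ((h0 _).trans l0) ((h0 _).trans l1)), fun h => ?_⟩
  exact (lt_of_le_of_ne (h0 2) (right_ne_zero_of_mul h.ne').symm).trans_le l2

theorem IsSortedEigenbasis.compression_eq_diagonal {m n : ℕ} {M : Matrix (Fin n) (Fin n) ℝ}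
    {l : Fin n → ℝ} {e : Fin n → Fin n → ℝ} (he : IsSortedEigenbasis M l e) {ι : Fin m → Fin n}
    (hι : ι.Injective) : compression M (e ∘ ι) = diagonal (l ∘ ι) := by
  ext a b
  simp only [compression, of_apply, Function.comp_apply, he.eig, dotProduct_smul, he.orth,
    hι.eq_iff, diagonal_apply, smul_eq_mul]
  split_ifs with h
  · rw [h, mul_one]
  · rw [mul_zero]

theorem IsFeasible.abs_apply_le {d : Fin 5 → ℝ} {M : Matrix (Fin 5) (Fin 5) ℝ} (h : IsFeasible d M)
    (hd : ∀ i, 0 ≤ d i) (hd1 : ∀ i, d i ≤ 1) (i j : Fin 5) : |M i j| ≤ 2 := by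
  rcases eq_or_ne i j with rfl | hij
  · rw [h.diag, abs_neg, abs_of_nonneg (hd i)]
    linarith [hd1 i]
  · have := h.form_le (Pi.single i 1 + Pi.single j 1)
    simp only [mulVec_add, add_dotProduct, dotProduct_add, single_one_dotProduct,
      mulVec_single_one, col_apply, h.diag, Pi.single_eq_same, Pi.single_eq_of_ne hij,
      Pi.single_eq_of_ne hij.symm, h.symm.apply i j] at this
    rw [abs_of_nonneg (h.offDiag i j hij)]
    linarith [hd1 i, hd1 j]

theorem IsFeasible.exists_optimal {d : Fin 5 → ℝ} {M₀ : Matrix (Fin 5) (Fin 5) ℝ}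
    {l₀ : Fin 5 → ℝ} {e₀ : Fin 5 → Fin 5 → ℝ} (h₀ : IsFeasible d M₀)
    (hd : ∀ i, 0 ≤ d i) (hd1 : ∀ i, d i ≤ 1) (he₀ : IsSortedEigenbasis M₀ l₀ e₀)
    (hpos : 0 < l₀ 2) :
    ∃ M l e, IsFeasible d M ∧ IsSortedEigenbasis M l e ∧ 0 < l 2 ∧
      ∀ M' (G : Fin 3 → Fin 5 → ℝ), IsFeasible d M' → (∀ a b, G a ⬝ᵥ G b = if a = b then 1 else 0) →
        (∀ y, 0 ≤ y ⬝ᵥ compression M' G *ᵥ y) →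
        (compression M' G).det ≤ l 0 * l 1 * l 2 := by
  let S : Set ((Fin 5 → Fin 5 → ℝ) × (Fin 3 → Fin 5 → ℝ)) := {p | IsFeasible d (of p.1) ∧
    (∀ a b, p.2 a ⬝ᵥ p.2 b = if a = b then 1 else 0) ∧
    ∀ y, 0 ≤ y ⬝ᵥ compression (of p.1) p.2 *ᵥ y}
  let ι : Fin 3 → Fin 5 := Fin.castLE (by norm_num)
  have hι : ι.Injective := Fin.castLE_injective _
  have top_mem : ∀ {M l e}, IsFeasible d M → IsSortedEigenbasis M l e → 0 < l 2 →
      (⟨M, e ∘ ι⟩ : (Fin 5 → Fin 5 → ℝ) × (Fin 3 → Fin 5 → ℝ)) ∈ S ∧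
        (compression M (e ∘ ι)).det = l 0 * l 1 * l 2 := by
    intro M l e hM he hl
    have hl' : ∀ k, 0 ≤ l (ι k) := fun k => hl.le.trans (he.anti (by
      fin_cases k <;> decide))
    refine ⟨⟨hM, fun a b => ?_, fun y => ?_⟩, ?_⟩
    · simp only [Function.comp_apply, he.orth, hι.eq_iff]
    · change 0 ≤ y ⬝ᵥ compression M (e ∘ ι) *ᵥ y
      rw [he.compression_eq_diagonal hι, dotProduct]
      refine sum_nonneg fun k _ => ?_
      rw [mulVec_diagonal, mul_left_comm]
      exact mul_nonneg (hl' k) (mul_self_nonneg _)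
    · rw [he.compression_eq_diagonal hι, det_diagonal, Fin.prod_univ_three]
      rfl
  have hclosed : IsClosed S := by
    have : S = {p | (∀ i j, p.1 i j = p.1 j i) ∧ (∀ i, p.1 i i = -d i) ∧
        (∀ i j, i ≠ j → 0 ≤ p.1 i j) ∧ (∀ x, x ⬝ᵥ of p.1 *ᵥ x ≤ x ⬝ᵥ x) ∧
        (∀ a b, p.2 a ⬝ᵥ p.2 b = if a = b then 1 else 0) ∧
        ∀ y, 0 ≤ y ⬝ᵥ compression (of p.1) p.2 *ᵥ y} := by
      ext p
      constructor
      · rintro ⟨⟨h1, h2, h3, h4⟩, h5, h6⟩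
        exact ⟨fun i j => h1.apply j i, h2, h3, h4, h5, h6⟩
      · rintro ⟨h1, h2, h3, h4, h5, h6⟩
        exact ⟨⟨Matrix.ext fun i j => h1 j i, h2, h3, h4⟩, h5, h6⟩
    rw [this]
    simp only [Set.ofPred_and, Set.ofPred_forall, compression, dotProduct, mulVec, of_apply]
    refine .inter ?_ (.inter ?_ (.inter ?_ (.inter ?_ (.inter ?_ ?_))))
    · exact isClosed_iInter fun i => isClosed_iInter fun j =>
        isClosed_eq (by fun_prop) (by fun_prop)
    · exact isClosed_iInter fun i => isClosed_eq (by fun_prop) (by fun_prop)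
    · exact isClosed_iInter fun i => isClosed_iInter fun j => isClosed_iInter fun _ =>
        isClosed_le (by fun_prop) (by fun_prop)
    · exact isClosed_iInter fun i => isClosed_le (by fun_prop) (by fun_prop)
    · exact isClosed_iInter fun i => isClosed_iInter fun j =>
        isClosed_eq (by fun_prop) (by fun_prop)
    · exact isClosed_iInter fun i => isClosed_le (by fun_prop) (by fun_prop)
  have hcompact : IsCompact S := by
    refine (isCompact_closedBall 0 2).of_isClosed_subset hclosed fun p hp => ?_
    rw [mem_closedBall_zero_iff, norm_prod_le_iff]
    constructor
    · refine (pi_norm_le_iff_of_nonneg zero_le_two).2 fun i =>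
        (pi_norm_le_iff_of_nonneg zero_le_two).2 fun j => hp.1.abs_apply_le hd hd1 i j
    · refine (pi_norm_le_iff_of_nonneg zero_le_two).2 fun a =>
        (pi_norm_le_iff_of_nonneg zero_le_two).2 fun j => ?_
      have h1 : ∑ i, p.2 a i * p.2 a i = 1 := by simpa [dotProduct] using hp.2.1 a a
      have h2 := single_le_sum (f := fun i => p.2 a i * p.2 a i)
        (fun i _ => mul_self_nonneg _) (mem_univ j)
      rw [h1] at h2
      rw [Real.norm_eq_abs, abs_le]
      constructor <;> nlinarith
  have hcont : Continuous fun p : (Fin 5 → Fin 5 → ℝ) × (Fin 3 → Fin 5 → ℝ) =>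
      (compression (of p.1) p.2).det := by
    refine Continuous.matrix_det (continuous_matrix fun a b => ?_)
    simp only [compression, dotProduct, mulVec, of_apply]
    fun_prop
  obtain ⟨hm, hdet₀⟩ := top_mem h₀ he₀ hpos
  obtain ⟨⟨M, G⟩, ⟨hM, hG, hC⟩, hmax⟩ := hcompact.exists_isMaxOn ⟨_, hm⟩ hcont.continuousOn
  obtain ⟨l, e, he, -⟩ := exists_isSortedEigenbasis hM.symm
  obtain ⟨hle, himp⟩ := he.det_compression_le hM.symm hG hC
  have hge : 0 < (compression (of M) G).det := by
    have h1 := hmax hm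
    have h2 : l₀ 2 ≤ l₀ 1 := he₀.anti (by decide)
    have h3 : l₀ 2 ≤ l₀ 0 := he₀.anti (by decide)
    have h4 : 0 < l₀ 0 * l₀ 1 * l₀ 2 := by
      have := hpos.trans_le h2
      have := hpos.trans_le h3
      positivity
    exact (h4.trans_eq hdet₀.symm).trans_le h1
  exact ⟨of M, l, e, hM, he, himp hge, fun M' G' hM' hG' hC' =>
    (hmax (⟨hM', hG', hC'⟩ : (⟨M', G'⟩ : (Fin 5 → Fin 5 → ℝ) × (Fin 3 → Fin 5 → ℝ)) ∈ S)).trans hle⟩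

theorem IsSortedEigenbasis.form_add_smul_le {n : ℕ} {M X : Matrix (Fin (n + 2)) (Fin (n + 2)) ℝ}
    {l : Fin (n + 2) → ℝ} {e : Fin (n + 2) → Fin (n + 2) → ℝ} (he : IsSortedEigenbasis M l e)
    (hM : M.IsSymm) (h0 : l 0 ≤ 1) (h1 : l 1 < l 0) (hX : X.IsSymm) (hX0 : e 0 ⬝ᵥ X *ᵥ e 0 = 0) :
    ∃ K, 0 ≤ K ∧ ∀ᶠ ε in 𝓝[>] (0 : ℝ), ∀ x, x ⬝ᵥ (M + ε • X) *ᵥ x ≤ (1 + K * ε ^ 2) * (x ⬝ᵥ x) := by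
  obtain ⟨lX, eX, hs, -, -⟩ := exists_isSortedEigenbasis hX
  obtain ⟨γ, hγ⟩ : ∃ γ, γ = l 0 - l 1 := ⟨_, rfl⟩
  have hγ0 : 0 < γ := by linarith
  obtain ⟨w, hw⟩ : ∃ w, w = (X *ᵥ e 0) ⬝ᵥ (X *ᵥ e 0) := ⟨_, rfl⟩
  have hw0 : 0 ≤ w := hw ▸ sum_nonneg fun i _ => mul_self_nonneg _
  have hsmall : ∀ᶠ ε in 𝓝[>] (0 : ℝ), ε * lX 0 < γ / 2 := by
    refine eventually_nhdsWithin_of_eventually_nhds ?_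
    refine Tendsto.eventually_lt_const (u := γ / 2) (v := 0 * lX 0) (by simpa using hγ0) ?_
    exact (continuous_id.mul continuous_const).tendsto 0
  refine ⟨2 * w / γ, by positivity, ?_⟩
  filter_upwards [hsmall, self_mem_nhdsWithin] with ε hε hε0 x
  rw [Set.mem_Ioi] at hε0
  obtain ⟨s, hs'⟩ : ∃ s, s = e 0 ⬝ᵥ x := ⟨_, rfl⟩
  obtain ⟨z, hz⟩ : ∃ z, z = x - s • e 0 := ⟨_, rfl⟩
  have hee : e 0 ⬝ᵥ e 0 = 1 := by rw [he.orth, if_pos rfl]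
  have hez : e 0 ⬝ᵥ z = 0 := by
    rw [hz, dotProduct_sub, dotProduct_smul, hee, ← hs', smul_eq_mul, mul_one, sub_self]
  have hze : z ⬝ᵥ e 0 = 0 := by rw [dotProduct_comm, hez]
  have hx : x = s • e 0 + z := by rw [hz]; abel
  have hsym : ∀ {Y : Matrix (Fin (n + 2)) (Fin (n + 2)) ℝ}, Y.IsSymm → ∀ u v : Fin (n + 2) → ℝ,
      u ⬝ᵥ Y *ᵥ v = (Y *ᵥ u) ⬝ᵥ v := fun hY u v => by
    rw [Matrix.dotProduct_mulVec, ← mulVec_transpose, hY.eq]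
  have hMz : z ⬝ᵥ M *ᵥ z ≤ l 1 * (z ⬝ᵥ z) := he.form_le hM 1 fun i hi => by
    have : i = 0 := by
      ext
      have h1 : i.val < 1 := by simpa using Fin.lt_def.1 hi
      simpa using h1
    rw [this, hez]
  have hXz : z ⬝ᵥ X *ᵥ z ≤ lX 0 * (z ⬝ᵥ z) :=
    hs.form_le hX 0 fun i hi => absurd hi (Fin.not_lt_zero i)
  have exx : x ⬝ᵥ x = s ^ 2 + z ⬝ᵥ z := by
    rw [hx]
    simp only [add_dotProduct, dotProduct_add, smul_dotProduct, dotProduct_smul, hee, hez, hze,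
      smul_eq_mul]
    ring
  have eM : x ⬝ᵥ M *ᵥ x = l 0 * s ^ 2 + z ⬝ᵥ M *ᵥ z := by
    rw [hx]
    simp only [mulVec_add, mulVec_smul, he.eig, add_dotProduct, dotProduct_add, smul_dotProduct,
      dotProduct_smul, hee, hze, hsym hM (e 0) z, hez, smul_eq_mul]
    ring
  obtain ⟨p, hp⟩ : ∃ p, p = (X *ᵥ e 0) ⬝ᵥ z := ⟨_, rfl⟩
  have eX' : x ⬝ᵥ X *ᵥ x = 2 * s * p + z ⬝ᵥ X *ᵥ z := by
    rw [hx]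
    simp only [mulVec_add, mulVec_smul, add_dotProduct, dotProduct_add, smul_dotProduct,
      dotProduct_smul, hX0, hsym hX (e 0) z, dotProduct_comm z (X *ᵥ e 0), ← hp, smul_eq_mul]
    ring
  have hsq : 0 ≤ ((ε * s) • X *ᵥ e 0 - (γ / 2) • z) ⬝ᵥ ((ε * s) • X *ᵥ e 0 - (γ / 2) • z) :=
    sum_nonneg fun i _ => mul_self_nonneg _
  have esq : ((ε * s) • X *ᵥ e 0 - (γ / 2) • z) ⬝ᵥ ((ε * s) • X *ᵥ e 0 - (γ / 2) • z) =
      ε ^ 2 * s ^ 2 * w - ε * s * γ * p + γ ^ 2 / 4 * (z ⬝ᵥ z) := by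
    simp only [sub_dotProduct, dotProduct_sub, smul_dotProduct, dotProduct_smul, smul_eq_mul,
      dotProduct_comm z (X *ᵥ e 0), ← hp, ← hw]
    ring
  rw [esq] at hsq
  have hZ : 0 ≤ z ⬝ᵥ z := sum_nonneg fun i _ => mul_self_nonneg _
  rw [add_mulVec, dotProduct_add, smul_mulVec, dotProduct_smul, smul_eq_mul, eM, eX', exx]
  set Z := z ⬝ᵥ z
  have hcross : 2 * ε * s * p ≤ 2 * w / γ * ε ^ 2 * s ^ 2 + γ / 2 * Z := by
    have : 2 * w / γ * ε ^ 2 * s ^ 2 + γ / 2 * Z - 2 * ε * s * p =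
        2 / γ * (ε ^ 2 * s ^ 2 * w - ε * s * γ * p + γ ^ 2 / 4 * Z) := by
      field_simp
      ring
    have := mul_nonneg (by positivity : 0 ≤ 2 / γ) hsq
    linarith
  have hK : 0 ≤ 2 * w / γ * ε ^ 2 * Z := by positivity
  have a1 := mul_le_mul_of_nonneg_left hXz hε0.le
  have a2 := mul_le_mul_of_nonneg_right hε.le hZ
  have a3 := mul_le_mul_of_nonneg_right h0 (sq_nonneg s)
  have a4 : l 1 * Z ≤ (1 - γ) * Z := mul_le_mul_of_nonneg_right (by linarith) hZ
  nlinarith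

theorem hasDerivAt_det_of_diagonal {g : Fin 3 → Fin 3 → ℝ → ℝ} {Y : Fin 3 → Fin 3 → ℝ}
    {c : Fin 3 → ℝ} (hg : ∀ a b, HasDerivAt (g a b) (Y a b) 0)
    (h0 : ∀ a b, g a b 0 = if a = b then c a else 0) :
    HasDerivAt (fun ε => (of fun a b => g a b ε : Matrix (Fin 3) (Fin 3) ℝ).det)
      (Y 0 0 * c 1 * c 2 + c 0 * Y 1 1 * c 2 + c 0 * c 1 * Y 2 2) 0 := by
  simp only [det_fin_three, of_apply]
  have h := (((((((hg 0 0).mul (hg 1 1)).mul (hg 2 2)).sub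
    (((hg 0 0).mul (hg 1 2)).mul (hg 2 1))).sub
    (((hg 0 1).mul (hg 1 0)).mul (hg 2 2))).add (((hg 0 1).mul (hg 1 2)).mul (hg 2 0))).add
    (((hg 0 2).mul (hg 1 0)).mul (hg 2 1))).sub (((hg 0 2).mul (hg 1 1)).mul (hg 2 0))
  exact h.congr_deriv (by simp [h0]; ring)

theorem form_nonneg_of_near_diagonal {C : Matrix (Fin 3) (Fin 3) ℝ} {c : Fin 3 → ℝ} {δ : ℝ}
    (hc : ∀ a, 3 * δ ≤ c a) (hC : ∀ a b, |C a b - if a = b then c a else 0| ≤ δ) (y : Fin 3 → ℝ) :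
    0 ≤ y ⬝ᵥ C *ᵥ y := by
  have hterm : ∀ a b, (if a = b then c a * y a ^ 2 else 0) - δ * (y a ^ 2 + y b ^ 2) / 2 ≤
      C a b * (y a * y b) := by
    intro a b
    have h1 : |(C a b - if a = b then c a else 0) * (y a * y b)| ≤
        δ * ((y a ^ 2 + y b ^ 2) / 2) := by
      rw [abs_mul]
      refine mul_le_mul (hC a b) ?_ (abs_nonneg _) ((abs_nonneg _).trans (hC a b))
      rw [abs_le]
      constructor <;> nlinarith [sq_nonneg (y a + y b), sq_nonneg (y a - y b)]
    have h2 := (abs_le.1 h1).1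
    split_ifs at h2 ⊢ with h
    · subst h; linarith
    · linarith
  rw [dotProduct_mulVec_eq_sum]
  refine le_trans ?_ (sum_le_sum fun a _ => sum_le_sum fun b _ => hterm a b)
  simp only [Fin.sum_univ_three]
  simp
  nlinarith [mul_nonneg (sub_nonneg.2 (hc 0)) (sq_nonneg (y 0)),
    mul_nonneg (sub_nonneg.2 (hc 1)) (sq_nonneg (y 1)),
    mul_nonneg (sub_nonneg.2 (hc 2)) (sq_nonneg (y 2))]

namespace IsFeasible
variable {d : Fin 5 → ℝ} {M X : Matrix (Fin 5) (Fin 5) ℝ} {l : Fin 5 → ℝ} {e : Fin 5 → Fin 5 → ℝ}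

theorem perturb (h : IsFeasible d M) (hd : ∀ i, 0 ≤ d i) (hX : X.IsSymm) (hX0 : ∀ i, X i i = 0)
    {κ ε : ℝ} (hκ0 : 0 ≤ κ) (hκ1 : κ ≤ 1) (hnn : ∀ i j, i ≠ j → 0 ≤ M i j + ε * X i j)
    (hle : ∀ x, x ⬝ᵥ (M + ε • X) *ᵥ x ≤ (1 + κ) * (x ⬝ᵥ x)) :
    IsFeasible d ((1 - κ) • (M + ε • X) - κ • diagonal d) where
  symm := by
    have hD : (diagonal d).IsSymm := diagonal_transpose d
    exact ((h.symm.add (hX.smul ε)).smul _).sub (hD.smul _)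
  diag i := by simp [h.diag, hX0]; ring
  offDiag i j hij := by
    simp only [Matrix.sub_apply, Matrix.smul_apply, Matrix.add_apply, smul_eq_mul,
      diagonal_apply_ne d hij, mul_zero, sub_zero]
    exact mul_nonneg (sub_nonneg.2 hκ1) (hnn i j hij)
  form_le x := by
    have hZ : 0 ≤ x ⬝ᵥ x := sum_nonneg fun i _ => mul_self_nonneg _
    have hD : 0 ≤ x ⬝ᵥ diagonal d *ᵥ x := sum_nonneg fun i _ => by
      rw [mulVec_diagonal, mul_left_comm]
      exact mul_nonneg (hd i) (mul_self_nonneg _)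
    rw [sub_mulVec, dotProduct_sub, smul_mulVec, smul_mulVec, dotProduct_smul, dotProduct_smul,
      smul_eq_mul, smul_eq_mul]
    have h1 := mul_le_mul_of_nonneg_left (hle x) (sub_nonneg.2 hκ1)
    nlinarith [mul_nonneg hκ0 hD, mul_nonneg (mul_nonneg hκ0 hκ0) hZ]

theorem first_order (h : IsFeasible d M) (hd : ∀ i, 0 ≤ d i) (he : IsSortedEigenbasis M l e)
    (h10 : l 1 < l 0) (h2 : 0 < l 2)
    (hopt : ∀ M' (G : Fin 3 → Fin 5 → ℝ), IsFeasible d M' →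
      (∀ a b, G a ⬝ᵥ G b = if a = b then 1 else 0) → (∀ y, 0 ≤ y ⬝ᵥ compression M' G *ᵥ y) →
      (compression M' G).det ≤ l 0 * l 1 * l 2)
    (hX : X.IsSymm) (hXd : ∀ i, X i i = 0) (hXM : ∀ i j, i ≠ j → X i j < 0 → 0 < M i j)
    (hX0 : e 0 ⬝ᵥ X *ᵥ e 0 = 0) :
    (e 1 ⬝ᵥ X *ᵥ e 1) / l 1 + (e 2 ⬝ᵥ X *ᵥ e 2) / l 2 ≤ 0 := by
  obtain ⟨K, hK, hform⟩ := he.form_add_smul_le h.symm (h.eigenvalue_le_one he 0) h10 hX hX0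
  let ι : Fin 3 → Fin 5 := Fin.castLE (by norm_num)
  have hι : ι.Injective := Fin.castLE_injective _
  let M' : ℝ → Matrix (Fin 5) (Fin 5) ℝ := fun ε =>
    (1 - K * ε ^ 2) • (M + ε • X) - (K * ε ^ 2) • diagonal d
  let g : Fin 3 → Fin 3 → ℝ → ℝ := fun a b ε =>
    (1 - K * ε ^ 2) * (e (ι a) ⬝ᵥ M *ᵥ e (ι b) + ε * (e (ι a) ⬝ᵥ X *ᵥ e (ι b))) -
      (K * ε ^ 2) * (e (ι a) ⬝ᵥ diagonal d *ᵥ e (ι b))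
  have hcomp : ∀ ε, compression (M' ε) (e ∘ ι) = of fun a b => g a b ε := by
    intro ε
    ext a b
    simp only [compression, M', g, of_apply, Function.comp_apply, sub_mulVec, add_mulVec,
      smul_mulVec, dotProduct_sub, dotProduct_add, dotProduct_smul, smul_eq_mul]
  have hg0 : ∀ a b, g a b 0 = if a = b then l (ι a) else 0 := by
    intro a b
    have := congrFun (congrFun (he.compression_eq_diagonal hι) a) b
    simp only [compression, of_apply, Function.comp_apply, diagonal_apply] at this
    simp [g, this]
  have hg : ∀ a b, HasDerivAt (g a b) (e (ι a) ⬝ᵥ X *ᵥ e (ι b)) 0 := by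
    intro a b
    have hq : HasDerivAt (fun ε : ℝ => K * ε ^ 2) (K * (2 * 0)) 0 := by
      simpa using ((hasDerivAt_id (0 : ℝ)).pow 2).const_mul K
    have hl := ((hasDerivAt_id (0 : ℝ)).mul_const (e (ι a) ⬝ᵥ X *ᵥ e (ι b))).const_add
      (e (ι a) ⬝ᵥ M *ᵥ e (ι b))
    exact ((hq.const_sub 1).mul hl |>.sub (hq.mul_const _)).congr_deriv (by simp)
  have hdet := hasDerivAt_det_of_diagonal hg hg0
  have hcont : ∀ a b, Tendsto (g a b) (𝓝[>] 0) (𝓝 (g a b 0)) := fun a b =>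
    (hg a b).continuousAt.tendsto.mono_left nhdsWithin_le_nhds
  have hfeas : ∀ᶠ ε in 𝓝[>] (0 : ℝ), IsFeasible d (M' ε) := by
    have hκ : ∀ᶠ ε in 𝓝[>] (0 : ℝ), K * ε ^ 2 < 1 := by
      refine eventually_nhdsWithin_of_eventually_nhds ?_
      refine Tendsto.eventually_lt_const (u := 1) (v := K * 0 ^ 2) (by norm_num) ?_
      exact (continuous_const.mul (continuous_pow 2)).tendsto 0
    have hnn : ∀ᶠ ε in 𝓝[>] (0 : ℝ), ∀ i j, i ≠ j → 0 ≤ M i j + ε * X i j := by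
      refine eventually_all.2 fun i => eventually_all.2 fun j => ?_
      by_cases hij : i = j
      · exact Eventually.of_forall fun _ h => absurd hij h
      rcases lt_or_ge (X i j) 0 with hneg | hpos
      · refine (eventually_nhdsWithin_of_eventually_nhds
          (Tendsto.eventually_const_lt (u := 0) (v := M i j + 0 * X i j)
            (by simpa using hXM i j hij hneg) ?_)).mono fun ε hε _ => hε.le
        exact (continuous_const.add (continuous_id.mul continuous_const)).tendsto 0
      · filter_upwards [self_mem_nhdsWithin] with ε hε _
        exact add_nonneg (h.offDiag i j hij) (mul_nonneg (le_of_lt hε) hpos)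
    filter_upwards [hform, hκ, hnn] with ε h1 h2 h3
    exact h.perturb hd hX hXd (by positivity) h2.le h3 h1
  have hpsd : ∀ᶠ ε in 𝓝[>] (0 : ℝ), ∀ a b, |g a b ε - if a = b then l (ι a) else 0| ≤ l 2 / 3 := by
    refine eventually_all.2 fun a => eventually_all.2 fun b => ?_
    rw [← hg0]
    have := (((hcont a b).sub_const (g a b 0)).abs).eventually_lt_const (u := l 2 / 3)
      (by simpa using h2)
    exact this.mono fun ε hε => hε.le
  have hle : ∀ᶠ ε in 𝓝[>] (0 : ℝ), (of fun a b => g a b ε).det ≤ (of fun a b => g a b 0).det := by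
    filter_upwards [hfeas, hpsd] with ε h1 h3
    have hc : ∀ a, 3 * (l 2 / 3) ≤ l (ι a) := fun a => by
      rw [mul_div_cancel₀ _ (by norm_num : (3 : ℝ) ≠ 0)]
      exact he.anti (by fin_cases a <;> decide)
    have := hopt (M' ε) (e ∘ ι) h1 (fun a b => by
      simp only [Function.comp_apply, he.orth, hι.eq_iff]) (by
        rw [hcomp]; exact form_nonneg_of_near_diagonal hc h3)
    rw [hcomp] at this
    refine this.trans_eq ?_
    rw [det_fin_three]
    simp [hg0]
    rfl
  have hslope := hdet.tendsto_slope_zero_right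
  have hnonpos := le_of_tendsto hslope (b := 0) (by
    filter_upwards [hle, self_mem_nhdsWithin] with ε h1 h3
    rw [zero_add, smul_eq_mul]
    exact mul_nonpos_of_nonneg_of_nonpos (inv_nonneg.2 (le_of_lt h3)) (sub_nonpos.2 h1))
  have l21 : l 2 ≤ l 1 := he.anti (by decide)
  have l1 : 0 < l 1 := h2.trans_le l21
  have l0 : 0 < l 0 := l1.trans h10
  have hsimp : (e 0 ⬝ᵥ X *ᵥ e 0) * l 1 * l 2 + l 0 * (e 1 ⬝ᵥ X *ᵥ e 1) * l 2 +
      l 0 * l 1 * (e 2 ⬝ᵥ X *ᵥ e 2) ≤ 0 := hnonpos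
  rw [hX0] at hsimp
  have : (e 1 ⬝ᵥ X *ᵥ e 1) / l 1 + (e 2 ⬝ᵥ X *ᵥ e 2) / l 2 =
      (0 * l 1 * l 2 + l 0 * (e 1 ⬝ᵥ X *ᵥ e 1) * l 2 +
      l 0 * l 1 * (e 2 ⬝ᵥ X *ᵥ e 2)) / (l 0 * l 1 * l 2) := by
    field_simp
    ring
  rw [this]
  exact div_nonpos_of_nonpos_of_nonneg hsimp (by positivity)
end IsFeasible

theorem single_add_single_form {n : ℕ} (i j : Fin n) (x : Fin n → ℝ) :
    x ⬝ᵥ (single i j (1 : ℝ) + single j i 1) *ᵥ x = 2 * (x i * x j) := by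
  rw [add_mulVec, dotProduct_add, single_mulVec, single_mulVec]
  simp [dotProduct, Function.update_apply]
  ring

theorem exists_planar_vectors_of_stationary {M : Matrix (Fin 5) (Fin 5) ℝ} {l : Fin 5 → ℝ}
    {e : Fin 5 → Fin 5 → ℝ} {d : Fin 5 → ℝ} (h : IsFeasible d M) (hd : ∀ i, 0 ≤ d i)
    (he : IsSortedEigenbasis M l e) (h10 : l 1 < l 0) (h2 : 0 < l 2)
    (hu : ∀ i j, 0 < e 0 i * e 0 j) {μ : ℝ}
    (hle : ∀ i j, i ≠ j → e 1 i * e 1 j / l 1 + e 2 i * e 2 j / l 2 ≤ μ * (e 0 i * e 0 j))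
    (hedge : ∀ i j, i ≠ j → 0 < M i j →
      e 1 i * e 1 j / l 1 + e 2 i * e 2 j / l 2 = μ * (e 0 i * e 0 j)) :
    ∃ x y : Fin 5 → ℝ, (∀ i j, i ≠ j → x i * x j + y i * y j ≤ 1) ∧
      (∀ i j, i ≠ j → 0 < M i j → x i * x j + y i * y j = 1) ∧
      ∀ i, 1 < x i ^ 2 + y i ^ 2 ∧ d i * (x i ^ 2 + y i ^ 2 - 1) < 1 := by
  have h21 : l 2 ≤ l 1 := he.anti (by decide)
  have h1 : 0 < l 1 := h2.trans_le h21
  have h01 : l 0 ≤ 1 := h.eigenvalue_le_one he 0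
  obtain ⟨V, hV⟩ : ∃ V : Fin 5 → Fin 5 → ℝ, ∀ i j,
    V i j = e 1 i * e 1 j / l 1 + e 2 i * e 2 j / l 2 := ⟨_, fun _ _ => rfl⟩
  simp only [← hV] at hle hedge
  have hsum : ∀ i, e 1 i ^ 2 + e 2 i ^ 2 + d i * V i i = μ * (l 0 + d i) * e 0 i ^ 2 := by
    intro i
    have hrow : ∀ k, ∑ j, M i j * e k j = l k * e k i := fun k => congrFun (he.eig k) i
    have e1 : ∑ j, M i j * V i j = e 1 i ^ 2 + e 2 i ^ 2 := by
      have : ∀ j, M i j * V i j = e 1 i / l 1 * (M i j * e 1 j) + e 2 i / l 2 * (M i j * e 2 j) :=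
        fun j => by rw [hV]; ring
      simp only [this, sum_add_distrib, ← mul_sum, hrow]
      field_simp
    have e2 : ∑ j, M i j * (V i j - μ * (e 0 i * e 0 j)) =
        -d i * (V i i - μ * (e 0 i * e 0 i)) := by
      rw [sum_eq_single i, h.diag]
      · intro j _ hj
        rcases (h.offDiag i j hj.symm).eq_or_lt with h0 | h0
        · rw [← h0, zero_mul]
        · rw [hedge i j hj.symm h0, sub_self, mul_zero]
      · simp
    have e3 : ∑ j, M i j * (μ * (e 0 i * e 0 j)) = μ * l 0 * e 0 i ^ 2 := by
      have : ∀ j, M i j * (μ * (e 0 i * e 0 j)) = μ * e 0 i * (M i j * e 0 j) := fun j => by ring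
      simp only [this, ← mul_sum, hrow]
      ring
    simp only [mul_sub, sum_sub_distrib] at e2
    rw [e1, e3] at e2
    linear_combination e2
  have hVle : ∀ i, e 1 i ^ 2 + e 2 i ^ 2 ≤ l 1 * V i i := by
    intro i
    rw [hV]
    have : l 1 * (e 1 i * e 1 i / l 1 + e 2 i * e 2 i / l 2) =
        e 1 i ^ 2 + l 1 / l 2 * e 2 i ^ 2 := by
      field_simp
    rw [this]
    have := mul_le_mul_of_nonneg_right ((one_le_div h2).2 h21) (sq_nonneg (e 2 i))
    linarith
  have hVnn : ∀ i, 0 ≤ V i i := fun i => by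
    rw [hV]
    exact add_nonneg (div_nonneg (mul_self_nonneg _) h1.le) (div_nonneg (mul_self_nonneg _) h2.le)
  have hu2 : ∀ i, 0 < e 0 i ^ 2 := fun i => by rw [sq]; exact hu i i
  have hμ : 0 < μ := by
    obtain ⟨i, hi⟩ : ∃ i, e 1 i ≠ 0 := by
      by_contra! h0
      have := he.orth 1 1
      rw [show e 1 = 0 from funext h0] at this
      simp at this
    have hpos : 0 < μ * ((l 0 + d i) * e 0 i ^ 2) := by
      rw [← mul_assoc, ← hsum]
      have := mul_nonneg (hd i) (hVnn i)
      have := sq_pos_of_ne_zero hi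
      positivity
    exact pos_of_mul_pos_left hpos (mul_nonneg (by linarith [hd i]) (hu2 i).le)
  have hs : ∀ i, e 0 i ≠ 0 := fun i h0 => by simpa [h0] using hu2 i
  have hdot : ∀ i j, e 1 i / (√(l 1) * e 0 i * √μ) * (e 1 j / (√(l 1) * e 0 j * √μ)) +
      e 2 i / (√(l 2) * e 0 i * √μ) * (e 2 j / (√(l 2) * e 0 j * √μ)) =
      V i j / (μ * (e 0 i * e 0 j)) := by
    intro i j
    rw [hV, div_mul_div_comm, div_mul_div_comm,
      show √(l 1) * e 0 i * √μ * (√(l 1) * e 0 j * √μ) =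
        (√(l 1) * √(l 1)) * (√μ * √μ) * (e 0 i * e 0 j) by ring,
      show √(l 2) * e 0 i * √μ * (√(l 2) * e 0 j * √μ) =
        (√(l 2) * √(l 2)) * (√μ * √μ) * (e 0 i * e 0 j) by ring,
      Real.mul_self_sqrt h1.le, Real.mul_self_sqrt h2.le, Real.mul_self_sqrt hμ.le, add_div,
      div_div, div_div, mul_assoc, mul_assoc]
  refine ⟨fun i => e 1 i / (√(l 1) * e 0 i * √μ), fun i => e 2 i / (√(l 2) * e 0 i * √μ),
    fun i j hij => ?_, fun i j hij hM => ?_, fun i => ?_⟩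
  · rw [hdot]
    exact div_le_one_of_le₀ (hle i j hij) (mul_pos hμ (hu i j)).le
  · rw [hdot, hedge i j hij hM]
    exact div_self (mul_pos hμ (hu i j)).ne'
  · rw [sq, sq, hdot, ← sq]
    have hU : 0 < μ * e 0 i ^ 2 := mul_pos hμ (hu2 i)
    have hVpos : 0 < e 1 i ^ 2 + e 2 i ^ 2 := by
      by_contra! hn
      have h3 : e 1 i = 0 := by nlinarith [sq_nonneg (e 1 i), sq_nonneg (e 2 i)]
      have h4 : e 2 i = 0 := by nlinarith [sq_nonneg (e 1 i), sq_nonneg (e 2 i)]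
      have h5 := hsum i
      rw [hV, h3, h4] at h5
      have : 0 < μ * (l 0 + d i) * e 0 i ^ 2 := by
        have : 0 < l 0 + d i := by linarith [hd i]
        have := hu2 i
        positivity
      simp at h5
      rcases h5 with (h5 | h5) | h5
      · exact hμ.ne' h5
      · linarith [hd i]
      · exact hs i h5
    have h5 := hsum i
    have h6 := hVle i
    obtain ⟨U, hUdef⟩ : ∃ U, U = μ * e 0 i ^ 2 := ⟨_, rfl⟩
    have h7 : μ * (l 0 + d i) * e 0 i ^ 2 = (l 0 + d i) * U := by rw [hUdef]; ring
    rw [h7] at h5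
    rw [← hUdef] at hU ⊢
    constructor
    · rw [one_lt_div hU]
      have := mul_lt_mul_of_pos_right h10 hU
      have hpos : 0 < l 1 + d i := by linarith [hd i]
      refine lt_of_mul_lt_mul_left (a := l 1 + d i) ?_ hpos.le
      linarith
    · have : d i * V i i < (1 + d i) * U := by nlinarith
      rw [show d i * (V i i / U - 1) = (d i * V i i - d i * U) / U by field_simp, div_lt_one hU]
      linarith

theorem false_of_planar_vectors {R : Fin 5 → Fin 5 → Prop} {x y d : Fin 5 → ℝ}
    (hR : ∀ i j, R i j → R j i) (hind : ∀ i j k, i ≠ j → j ≠ k → i ≠ k → R i j ∨ R j k ∨ R i k)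
    (hle : ∀ i j, i ≠ j → x i * x j + y i * y j ≤ 1)
    (heq : ∀ i j, i ≠ j → R i j → x i * x j + y i * y j = 1)
    (hG : ∀ i, 1 < x i ^ 2 + y i ^ 2) (hd1 : ∀ i, d i ≤ 1)
    (hd : ∀ i, d i * (x i ^ 2 + y i ^ 2 - 1) < 1) (hsum : ∑ i, d i = 4) : False := by
  obtain ⟨σ, hσ, hcyc⟩ := exists_five_cycle hR
    (fun i j k hij hjk h1 h2 h3 => false_of_planar_triangle (heq i j hij.ne h1)
      (heq j k hjk.ne h2) (heq i k (hij.trans hjk).ne h3) (hG i) (hG j) (hG k))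
    (fun i j k hij hjk => hind i j k hij.ne hjk.ne (hij.trans hjk).ne)
  refine false_of_planar_pentagon (x := x ∘ σ) (y := y ∘ σ) (d := d ∘ σ)
    (fun k => heq _ _ (hσ.ne (by simp)) (hcyc k)) (fun k => hle _ _ (hσ.ne (by simp)))
    (fun k => hG _) (fun k => hd1 _) (fun k => hd _) ?_
  rw [← hsum]
  exact (Equiv.ofBijective σ (Finite.injective_iff_bijective.1 hσ)).sum_comp d

theorem IsFeasible.third_eigenvalue_nonpos {d : Fin 5 → ℝ} {M : Matrix (Fin 5) (Fin 5) ℝ}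
    {l : Fin 5 → ℝ} {e : Fin 5 → Fin 5 → ℝ} (h : IsFeasible d M) (he : IsSortedEigenbasis M l e)
    (hd : ∀ i, 0 ≤ d i) (hd1 : ∀ i, d i ≤ 1) (hsum : ∑ i, d i = 4) : l 2 ≤ 0 := by
  by_contra! hpos
  obtain ⟨M, l, e, h, he, hpos, hopt⟩ := h.exists_optimal hd hd1 he hpos
  have hsymm : ∀ p q, 0 < M p q → 0 < M q p := fun p q hpq => by rwa [h.symm.apply]
  have hpair : ∀ a ≠ 0, ∃ p q, p ≠ q ∧ 0 < M p q ∧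
      0 < (a ⬝ᵥ ![e 0 p, e 1 p, e 2 p]) * (a ⬝ᵥ ![e 0 q, e 1 q, e 2 q]) :=
    fun a ha => h.exists_mul_pos hd he hpos ha
  have hdeg : ∀ i m, i ≠ m → ∃ j, j ≠ i ∧ j ≠ m ∧ 0 < M i j := fun i m him =>
    exists_rel_of_forall_exists_mul_pos (R := fun p q => 0 < M p q)
      (r := fun p => ![e 0 p, e 1 p, e 2 p]) hsymm hpair him
  have hu := h.top_eigenvector_mul_pos he hdeg
  have h10 := h.top_eigenvalue_simple he hdeg
  let ratio : Fin 5 → Fin 5 → ℝ := fun i j =>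
    (e 1 i * e 1 j / l 1 + e 2 i * e 2 j / l 2) / (e 0 i * e 0 j)
  have hcomp : ∀ i j p q, i ≠ j → p ≠ q → 0 < M p q → ratio i j ≤ ratio p q := by
    intro i j p q hij hpq hM
    have hsE : ∀ i j : Fin 5, (single i j (1 : ℝ) + single j i 1).IsSymm := fun i j => by
      rw [IsSymm, transpose_add, transpose_single, transpose_single, add_comm]
    have key := h.first_order hd he h10 hpos hopt
      (X := (e 0 i * e 0 j)⁻¹ • (single i j 1 + single j i 1) -
        (e 0 p * e 0 q)⁻¹ • (single p q 1 + single q p 1))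
      (((hsE i j).smul _).sub ((hsE p q).smul _)) (fun a => ?_) (fun a b hab hneg => ?_) ?_
    · simp only [sub_mulVec, smul_mulVec, dotProduct_sub, dotProduct_smul, single_add_single_form,
        smul_eq_mul] at key
      have e1 : ratio i j - ratio p q = (((e 0 i * e 0 j)⁻¹ * (2 * (e 1 i * e 1 j)) -
          (e 0 p * e 0 q)⁻¹ * (2 * (e 1 p * e 1 q))) / l 1 +
          ((e 0 i * e 0 j)⁻¹ * (2 * (e 2 i * e 2 j)) -
          (e 0 p * e 0 q)⁻¹ * (2 * (e 2 p * e 2 q))) / l 2) / 2 := by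
        simp only [ratio]
        ring
      linarith
    · have h1 : ∀ i j : Fin 5, i ≠ j → single i j (1 : ℝ) a a = 0 := fun i j hij =>
        single_apply_of_ne _ _ _ _ _ (fun h => hij (h.1.trans h.2.symm))
      rw [Matrix.sub_apply, Matrix.smul_apply, Matrix.smul_apply, Matrix.add_apply,
        Matrix.add_apply, h1 i j hij, h1 j i hij.symm, h1 p q hpq, h1 q p hpq.symm]
      simp
    · have h1 : 0 ≤ (e 0 i * e 0 j)⁻¹ * (single i j 1 a b + single j i (1 : ℝ) a b) := by
        refine mul_nonneg (inv_nonneg.2 (hu i j).le) (add_nonneg ?_ ?_) <;>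
          · rw [single_apply]; positivity
      by_contra hab'
      have h2 : single p q (1 : ℝ) a b = 0 :=
        single_apply_of_ne _ _ _ _ _ (fun h => hab' (h.1 ▸ h.2 ▸ hM))
      have h3 : single q p (1 : ℝ) a b = 0 :=
        single_apply_of_ne _ _ _ _ _ (fun h => hab' (h.1 ▸ h.2 ▸ hsymm _ _ hM))
      rw [Matrix.sub_apply, Matrix.smul_apply, Matrix.smul_apply, Matrix.add_apply,
        Matrix.add_apply, h2, h3, smul_eq_mul, add_zero, smul_zero, sub_zero] at hneg
      exact absurd hneg (not_lt.2 h1)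
    · simp only [sub_mulVec, smul_mulVec, dotProduct_sub, dotProduct_smul, single_add_single_form,
        smul_eq_mul]
      rw [mul_left_comm, mul_left_comm (e 0 p * e 0 q)⁻¹, inv_mul_cancel₀ (hu i j).ne',
        inv_mul_cancel₀ (hu p q).ne', sub_self]
  obtain ⟨q, hq, -, hM⟩ := hdeg 0 1 (by decide)
  have hle : ∀ i j, i ≠ j → e 1 i * e 1 j / l 1 + e 2 i * e 2 j / l 2 ≤
      ratio 0 q * (e 0 i * e 0 j) := fun i j hij =>
    (div_le_iff₀ (hu i j)).1 (hcomp i j 0 q hij hq.symm hM)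
  obtain ⟨x, y, h1, h2, h3⟩ := exists_planar_vectors_of_stationary h hd he h10 hpos hu hle
    fun i j hij hM' => le_antisymm (hle i j hij)
      ((le_div_iff₀ (hu i j)).1 (hcomp 0 q i j hq.symm hij hM'))
  exact false_of_planar_vectors (R := fun p q => 0 < M p q) hsymm
    (fun i j k hij hjk hik => rel_of_forall_exists_mul_pos
      (r := fun p => ![e 0 p, e 1 p, e 2 p]) hsymm hpair hij hjk hik)
    h1 h2 (fun i => (h3 i).1) hd1 (fun i => (h3 i).2) hsum

theorem IsSortedEigenbasis.eigenvalues_eq {M : Matrix (Fin 5) (Fin 5) ℝ} {l : Fin 5 → ℝ}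
    {e : Fin 5 → Fin 5 → ℝ} (he : IsSortedEigenbasis M l e) (hl : M.charpoly.roots = univ.val.map l)
    {s : Fin 5 → ℝ} (hs : Antitone s) (hroots : M.charpoly.roots = univ.val.map s) : l = s := by
  rw [hl, Fin.univ_val_map, Fin.univ_val_map, Multiset.coe_eq_coe] at hroots
  exact List.ofFn_injective (hroots.eq_of_sortedGE he.anti.sortedGE_ofFn hs.sortedGE_ofFn)

/-- Let `A` be a nonnegative symmetric 5×5 real matrix with eigenvalues
`l1 ≥ l2 ≥ l3 ≥ l4 ≥ l5` counted with multiplicity (i.e. the roots of its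
characteristic polynomial). If `l1 + l2 + l3 + l4 + l5 ≥ (1/2) * l1`, then
`l3 ≤ l1 + l2 + l3 + l4 + l5`. -/
theorem stmt_0 (A : Matrix (Fin 5) (Fin 5) ℝ)
    (hsymm : A.IsSymm) (hnonneg : ∀ i j, 0 ≤ A i j)
    (l1 l2 l3 l4 l5 : ℝ)
    (hord1 : l1 ≥ l2) (hord2 : l2 ≥ l3) (hord3 : l3 ≥ l4) (hord4 : l4 ≥ l5)
    (heig : A.charpoly.roots = {l1, l2, l3, l4, l5})
    (hsum : l1 + l2 + l3 + l4 + l5 ≥ (1 / 2) * l1) :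
    l3 ≤ l1 + l2 + l3 + l4 + l5 := by
  obtain ⟨l, e, he, -, hl⟩ := exists_isSortedEigenbasis hsymm
  have hls : l = ![l1, l2, l3, l4, l5] := by
    refine he.eigenvalues_eq hl (Fin.antitone_iff_succ_le.2 fun i => ?_) ?_
    · fin_cases i <;> assumption
    · rw [heig, Fin.univ_val_map]; rfl
  have hH : A.IsHermitian := by
    rwa [Matrix.IsHermitian, conjTranspose_eq_transpose_of_trivial]
  have htr : ∑ i, A i i = l1 + l2 + l3 + l4 + l5 := by
    have := trace_eq_sum_roots_charpoly_of_splits hH.splits_charpoly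
    rw [heig] at this
    simpa [trace, add_assoc] using this
  by_contra! hlt
  set t := l1 + l2 + l3 + l4 + l5
  have ht : 0 < t := by linarith
  have hAt : ∀ i, A i i ≤ t := fun i => htr ▸ single_le_sum
    (f := fun i => A i i) (fun j _ => hnonneg j j) (mem_univ i)
  have hM : IsFeasible (fun i => 1 - t⁻¹ * A i i) (t⁻¹ • A - 1) := by
    refine ⟨(hsymm.smul _).sub isSymm_one, fun i => by simp, fun i j hij => ?_, fun x => ?_⟩
    · simpa [one_apply_ne hij] using mul_nonneg (inv_nonneg.2 ht.le) (hnonneg i j)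
    · have h1 : x ⬝ᵥ A *ᵥ x ≤ l 0 * (x ⬝ᵥ x) :=
        he.form_le hsymm 0 fun i hi => absurd hi (Fin.not_lt_zero i)
      have h2 : l 0 ≤ 2 * t := by
        rw [hls]
        change l1 ≤ 2 * t
        linarith
      have h3 : 0 ≤ x ⬝ᵥ x :=
        sum_nonneg fun i _ => mul_self_nonneg (x i)
      rw [sub_mulVec, smul_mulVec, one_mulVec, dotProduct_sub, dotProduct_smul, smul_eq_mul,
        sub_le_iff_le_add, inv_mul_le_iff₀ ht]
      nlinarith
  have heM : IsSortedEigenbasis (t⁻¹ • A - 1) (fun i => t⁻¹ * l i - 1) e :=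
    ⟨fun i j hij => sub_le_sub_right
      (mul_le_mul_of_nonneg_left (he.anti hij) (inv_nonneg.2 ht.le)) _,
      fun i => by rw [sub_mulVec, smul_mulVec, one_mulVec, he.eig, smul_smul, sub_smul, one_smul],
      he.orth, he.expand⟩
  have key := hM.third_eigenvalue_nonpos heM
    (fun i => sub_nonneg.2 ((inv_mul_le_one₀ ht).2 (hAt i)))
    (fun i => sub_le_self _ (mul_nonneg (inv_nonneg.2 ht.le) (hnonneg i i))) (by
      rw [sum_sub_distrib, ← mul_sum, htr, inv_mul_cancel₀ ht.ne']
      simp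
      norm_num)
  rw [sub_nonpos, inv_mul_le_one₀ ht, hls] at key
  exact absurd hlt (not_lt.2 key)
end

section
/- Let λ1 ≥ λ2 ≥ λ3 ≥ λ4 ≥ λ5 be real numbers with λ1 + λ2 + λ3 + λ4 + λ5 ≥ (1/2)·λ1. Then there exists a nonnegative symmetric 5×5 real matrix whose eigenvalues counted with multiplicity are λ1, λ2, λ3, λ4, λ5 if and only if the following three conditions hold: (1) λ1 = max over i of |λi|; (2) λ2 + λ5 ≤ λ1 + λ2 + λ3 + λ4 + λ5; (3) λ3 ≤ λ1 + λ2 + λ3 + λ4 + λ5. -/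
section

open Matrix

/-- Two families with the same multiset of values differ by a permutation of the index set. -/
lemma exists_perm_of_map_univ_eq {ι α : Type*} [Fintype ι] [DecidableEq α] {f g : ι → α}
    (h : Finset.univ.val.map f = Finset.univ.val.map g) : ∃ σ : Equiv.Perm ι, f ∘ σ = g := by
  have e : ∀ a, Nonempty ({i // g i = a} ≃ {i // f i = a}) := by
    intro a
    refine ⟨Fintype.equivOfCardEq ?_⟩
    have := congrArg (Multiset.count a) h
    rw [Multiset.count_map, Multiset.count_map] at this
    rw [Fintype.card_subtype, Fintype.card_subtype, Finset.card_def, Finset.card_def,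
      Finset.filter_val, Finset.filter_val]
    simpa only [eq_comm] using this.symm
  refine ⟨(Equiv.sigmaFiberEquiv g).symm.trans
    ((Equiv.sigmaCongrRight fun a => (e a).some).trans (Equiv.sigmaFiberEquiv f)), funext
      fun i => ?_⟩
  exact ((e (g i)).some ⟨i, rfl⟩).2

lemma exists_orthonormal_eigenvectors {n : Type*} [Fintype n] [DecidableEq n] {B : Matrix n n ℝ}
    (hB : B.IsSymm) :
    ∃ (μ : n → ℝ) (v : n → n → ℝ), (∀ i j, v i ⬝ᵥ v j = if i = j then 1 else 0) ∧
      (∀ i, B *ᵥ v i = μ i • v i) ∧ (∀ x, x ⬝ᵥ x = ∑ i, (v i ⬝ᵥ x) ^ 2) ∧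
      (∀ x, x ⬝ᵥ B *ᵥ x = ∑ i, μ i * (v i ⬝ᵥ x) ^ 2) ∧
      B.charpoly.roots = Finset.univ.val.map μ ∧ B.trace = ∑ i, μ i := by
  have hH : B.IsHermitian := by
    rw [Matrix.IsHermitian, Matrix.conjTranspose_eq_transpose_of_trivial]; exact hB
  have parseval : ∀ x y : n → ℝ, x ⬝ᵥ y =
      ∑ i, ((hH.eigenvectorBasis i).ofLp ⬝ᵥ x) * ((hH.eigenvectorBasis i).ofLp ⬝ᵥ y) := by
    intro x y
    have := hH.eigenvectorBasis.sum_inner_mul_inner (WithLp.toLp 2 x) (WithLp.toLp 2 y)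
    simp only [EuclideanSpace.inner_eq_star_dotProduct, star_trivial] at this
    rw [dotProduct_comm x y, ← this]
    refine Finset.sum_congr rfl fun i _ => ?_
    rw [dotProduct_comm y]
  refine ⟨hH.eigenvalues, fun i => (hH.eigenvectorBasis i).ofLp, ?_, ?_, ?_, ?_, ?_, ?_⟩
  · intro i j
    have := orthonormal_iff_ite.1 hH.eigenvectorBasis.orthonormal j i
    simp only [EuclideanSpace.inner_eq_star_dotProduct, star_trivial] at this
    rw [this]; simp [eq_comm]
  · exact hH.mulVec_eigenvectorBasis
  · intro x; rw [parseval]; simp [sq]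
  · intro x
    rw [parseval]
    refine Finset.sum_congr rfl fun i _ => ?_
    rw [dotProduct_mulVec, ← mulVec_transpose, hB.eq, hH.mulVec_eigenvectorBasis, smul_dotProduct,
      smul_eq_mul]
    ring
  · simpa using! hH.roots_charpoly_eq_eigenvalues
  · simpa using hH.trace_eq_sum_eigenvalues

lemma exists_disjoint_nonneg_of_eigenvectors {n : Type*} [Fintype n] {B : Matrix n n ℝ}
    (hB : B.IsSymm) {u v : n → ℝ} {a b c : ℝ} (hu : u ≠ 0) (hv : v ≠ 0)
    (huv : u ⬝ᵥ v = 0) (hBu : B *ᵥ u = a • u) (hBv : B *ᵥ v = b • v) (ha : c ≤ a) (hb : c ≤ b) :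
    ∃ p q : n → ℝ, 0 ≤ p ∧ 0 ≤ q ∧ p ≠ 0 ∧ q ≠ 0 ∧ (∀ i, p i = 0 ∨ q i = 0) ∧
      c * (p ⬝ᵥ p) + p ⬝ᵥ B *ᵥ q ≤ p ⬝ᵥ B *ᵥ p ∧ c * (q ⬝ᵥ q) + p ⬝ᵥ B *ᵥ q ≤ q ⬝ᵥ B *ᵥ q := by
  have hsymm : ∀ x y : n → ℝ, x ⬝ᵥ B *ᵥ y = y ⬝ᵥ B *ᵥ x := fun x y => by
    rw [dotProduct_mulVec, ← mulVec_transpose, hB.eq, dotProduct_comm]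
  by_contra! H
  have nodal : ∀ (w : n → ℝ) (m : ℝ), w ≠ 0 → B *ᵥ w = m • w → c ≤ m →
      ∃ w' : n → ℝ, 0 ≤ w' ∧ w' ≠ 0 ∧ B *ᵥ w' = m • w' ∧ (w' = w ∨ w' = -w) := by
    intro w m hw hBw hm
    have hd : ∀ i, w⁺ i = 0 ∨ w⁻ i = 0 := fun i => by
      rw [Pi.posPart_apply, Pi.negPart_apply]
      rcases le_total 0 (w i) with h | h
      · exact Or.inr (negPart_eq_zero.2 h)
      · exact Or.inl (posPart_eq_zero.2 h)
    have hd0 : w⁺ ⬝ᵥ w⁻ = 0 := Finset.sum_eq_zero fun i _ => mul_eq_zero.2 (hd i)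
    by_cases hp : w⁺ = 0
    · exact ⟨-w, neg_nonneg.2 (posPart_eq_zero.1 hp), neg_ne_zero.2 hw,
        by rw [mulVec_neg, hBw, smul_neg], Or.inr rfl⟩
    by_cases hq : w⁻ = 0
    · exact ⟨w, negPart_eq_zero.1 hq, hw, hBw, Or.inl rfl⟩
    have hB' : B *ᵥ w⁺ - B *ᵥ w⁻ = m • w⁺ - m • w⁻ := by
      rw [← mulVec_sub, ← smul_sub, posPart_sub_negPart, hBw]
    have e₁ := congrArg (w⁺ ⬝ᵥ ·) hB'
    have e₂ := congrArg (w⁻ ⬝ᵥ ·) hB'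
    simp only [dotProduct_sub, dotProduct_smul, smul_eq_mul, hd0, dotProduct_comm w⁻ w⁺,
      hsymm w⁻ w⁺] at e₁ e₂
    have hp2 : 0 ≤ w⁺ ⬝ᵥ w⁺ := Finset.sum_nonneg fun i _ => mul_self_nonneg _
    have hq2 : 0 ≤ w⁻ ⬝ᵥ w⁻ := Finset.sum_nonneg fun i _ => mul_self_nonneg _
    have := H w⁺ w⁻ (posPart_nonneg _) (negPart_nonneg _) hp hq hd
      (by nlinarith [mul_le_mul_of_nonneg_right hm hp2])
    nlinarith [mul_le_mul_of_nonneg_right hm hq2]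
  obtain ⟨u', hu0, hu', hBu', hu''⟩ := nodal u a hu hBu ha
  obtain ⟨v', hv0, hv', hBv', hv''⟩ := nodal v b hv hBv hb
  have h0 : u' ⬝ᵥ v' = 0 := by
    rcases hu'' with rfl | rfl <;> rcases hv'' with rfl | rfl <;> simp [huv]
  have hd : ∀ i, u' i = 0 ∨ v' i = 0 := fun i => mul_eq_zero.1 <|
    (Finset.sum_eq_zero_iff_of_nonneg fun i _ => mul_nonneg (hu0 i) (hv0 i)).1 h0 i
      (Finset.mem_univ i)
  have huu : 0 ≤ u' ⬝ᵥ u' := Finset.sum_nonneg fun i _ => mul_self_nonneg _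
  have hvv : 0 ≤ v' ⬝ᵥ v' := Finset.sum_nonneg fun i _ => mul_self_nonneg _
  have := H u' v' hu0 hv0 hu' hv' hd
  simp only [hBu', hBv', dotProduct_smul, smul_eq_mul, h0] at this
  nlinarith [mul_le_mul_of_nonneg_right ha huu, mul_le_mul_of_nonneg_right hb hvv,
    this (by nlinarith [mul_le_mul_of_nonneg_right ha huu])]

lemma add_le_trace_of_eigenvectors {A : Matrix (Fin 5) (Fin 5) ℝ} (hA : A.IsSymm)
    (h0 : ∀ i j, 0 ≤ A i j) {u v : Fin 5 → ℝ} {a b c d : ℝ} (hu : u ≠ 0) (hv : v ≠ 0)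
    (huv : u ⬝ᵥ v = 0) (hAu : A *ᵥ u = a • u) (hAv : A *ᵥ v = b • v) (ha : c ≤ a) (hb : c ≤ b)
    (hd : ∀ x : Fin 5 → ℝ, d * (x ⬝ᵥ x) ≤ x ⬝ᵥ A *ᵥ x) : c + d ≤ A.trace := by
  obtain ⟨p, q, hp, hq, hp0, hq0, hpq, h₁, h₂⟩ :=
    exists_disjoint_nonneg_of_eigenvectors hA hu hv huv hAu hAv ha hb
  have hnn : 0 ≤ p ⬝ᵥ A *ᵥ q := Finset.sum_nonneg fun i _ =>
    mul_nonneg (hp i) <| show 0 ≤ ∑ j, A i j * q j from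
      Finset.sum_nonneg fun j _ => mul_nonneg (h0 i j) (hq j)
  have key : ∀ w : Fin 5 → ℝ, w ≠ 0 → c * (w ⬝ᵥ w) ≤ w ⬝ᵥ A *ᵥ w →
      (Finset.univ.filter fun i => w i ≠ 0).card ≤ 2 → c + d ≤ A.trace := by
    intro w hw hcw hcard
    obtain ⟨s, hs, hs2⟩ := Finset.exists_superset_card_eq hcard (by simp)
    obtain ⟨i, j, hij, rfl⟩ := Finset.card_eq_two.1 hs2
    have hw0 : ∀ k, k ≠ i → k ≠ j → w k = 0 := fun k hki hkj => by
      by_contra hk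
      have := hs (Finset.mem_filter.2 ⟨Finset.mem_univ k, hk⟩)
      simp [hki, hkj] at this
    have form : ∀ s t : ℝ, (Pi.single i s + Pi.single j t : Fin 5 → ℝ) ⬝ᵥ
        (Pi.single i s + Pi.single j t) = s ^ 2 + t ^ 2 ∧
        (Pi.single i s + Pi.single j t : Fin 5 → ℝ) ⬝ᵥ A *ᵥ (Pi.single i s + Pi.single j t) =
        A i i * s ^ 2 + A j j * t ^ 2 + 2 * A i j * s * t := by
      intro s t
      have := hA.apply i j
      simp [mulVec_add, hij, hij.symm, this]
      constructor <;> ring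
    have hwe : w = Pi.single i (w i) + Pi.single j (w j) := by
      ext k
      rcases eq_or_ne k i with rfl | hki
      · simp [hij]
      rcases eq_or_ne k j with rfl | hkj
      · simp [hki]
      simp [hki, hkj, hw0]
    rw [hwe, (form _ _).1, (form _ _).2] at hcw
    have hd' := hd (Pi.single i (-w j) + Pi.single j (w i))
    rw [(form _ _).1, (form _ _).2] at hd'
    have htr : A i i + A j j ≤ A.trace := by
      rw [← Finset.sum_pair hij (f := fun k => A k k)]
      exact Finset.sum_le_sum_of_subset_of_nonneg (Finset.subset_univ _) fun k _ _ => h0 k k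
    have hpos : 0 < w i ^ 2 + w j ^ 2 := by
      refine lt_of_le_of_ne (by positivity) fun h => hw ?_
      have h1 : w i = 0 := by nlinarith [sq_nonneg (w i), sq_nonneg (w j)]
      have h2 : w j = 0 := by nlinarith [sq_nonneg (w i), sq_nonneg (w j)]
      rw [hwe, h1, h2]; simp
    by_contra! hlt
    nlinarith [mul_pos hpos (sub_pos.2 (htr.trans_lt hlt))]
  have hdisj : Disjoint (Finset.univ.filter fun i => p i ≠ 0)
      (Finset.univ.filter fun i => q i ≠ 0) := Finset.disjoint_left.2 fun i => by
    simpa using fun h => (hpq i).resolve_left h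
  have := Finset.card_union_of_disjoint hdisj ▸ Finset.card_le_univ _
  simp only [Fintype.card_fin] at this
  rcases le_or_gt (Finset.univ.filter fun i => p i ≠ 0).card 2 with h | h
  · exact key p hp0 (by linarith) h
  · exact key q hq0 (by linarith) (by omega)

/-- Nonnegative symmetric matrices of trace one, with largest eigenvalue at most two and third
largest eigenvalue greater than one. No such matrix exists, see `not_isCandidate`. -/
def IsCandidate (A : Matrix (Fin 5) (Fin 5) ℝ) : Prop :=
  A.IsSymm ∧ (∀ i j, 0 ≤ A i j) ∧ A.trace = 1 ∧ (∀ x, x ⬝ᵥ A *ᵥ x ≤ 2 * (x ⬝ᵥ x)) ∧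
    ∀ f g : Fin 5 → ℝ, ∃ x, f ⬝ᵥ x = 0 ∧ g ⬝ᵥ x = 0 ∧ x ⬝ᵥ x < x ⬝ᵥ A *ᵥ x

/-- The principal submatrix of `A` on `{i, j}` has an eigenvalue greater than one. -/
def IsStrong (A : Matrix (Fin 5) (Fin 5) ℝ) (i j : Fin 5) : Prop :=
  (1 - A i i) * (1 - A j j) < A i j ^ 2

/-- Some positive vectors supported on `{i, j}` and `{k, l}` both have values of the quadratic form
of `A - 1` exceeding their mutual pairing under `A`. -/
def IsSplit (A : Matrix (Fin 5) (Fin 5) ℝ) (i j k l : Fin 5) : Prop :=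
  ∃ p p' q q' : ℝ, 0 < p ∧ 0 < p' ∧ 0 < q ∧ 0 < q' ∧
    A i k * p * q + A i l * p * q' + A j k * p' * q + A j l * p' * q' <
      2 * A i j * p * p' - (1 - A i i) * p ^ 2 - (1 - A j j) * p' ^ 2 ∧
    A i k * p * q + A i l * p * q' + A j k * p' * q + A j l * p' * q' <
      2 * A k l * q * q' - (1 - A k k) * q ^ 2 - (1 - A l l) * q' ^ 2

lemma IsSplit.symm {A : Matrix (Fin 5) (Fin 5) ℝ} {i j k l : Fin 5} (h : IsSplit A i j k l)
    (hA : A.IsSymm) : IsSplit A k l i j := by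
  obtain ⟨p, p', q, q', h₁, h₂, h₃, h₄, h₅, h₆⟩ := h
  refine ⟨q, q', p, p', h₃, h₄, h₁, h₂, ?_, ?_⟩ <;>
    · rw [hA.apply i k, hA.apply i l, hA.apply j k, hA.apply j l]
      linarith

lemma IsSplit.swap_left {A : Matrix (Fin 5) (Fin 5) ℝ} {i j k l : Fin 5} (h : IsSplit A i j k l)
    (hA : A.IsSymm) : IsSplit A j i k l := by
  obtain ⟨p, p', q, q', h₁, h₂, h₃, h₄, h₅, h₆⟩ := h
  have := hA.apply i j
  refine ⟨p', p, q, q', h₂, h₁, h₃, h₄, ?_, ?_⟩ <;> (try rw [this]) <;> linarith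

lemma IsSplit.swap_right {A : Matrix (Fin 5) (Fin 5) ℝ} {i j k l : Fin 5} (h : IsSplit A i j k l)
    (hA : A.IsSymm) : IsSplit A i j l k := ((h.symm hA).swap_left hA).symm hA

lemma IsStrong.symm {A : Matrix (Fin 5) (Fin 5) ℝ} {i j : Fin 5} (h : IsStrong A i j)
    (hA : A.IsSymm) : IsStrong A j i := by
  rw [IsStrong, hA.apply i j, mul_comm]; exact h

lemma IsSplit.isStrong {A : Matrix (Fin 5) (Fin 5) ℝ} {i j k l : Fin 5} (h : IsSplit A i j k l)
    (h0 : ∀ i j, 0 ≤ A i j) (hd : ∀ i, 0 ≤ 1 - A i i) : IsStrong A i j := by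
  obtain ⟨p, p', q, q', h₁, h₂, h₃, h₄, h₅, -⟩ := h
  have : 0 ≤ A i k * p * q + A i l * p * q' + A j k * p' * q + A j l * p' * q' := by
    have := h0 i k; have := h0 i l; have := h0 j k; have := h0 j l
    positivity
  have h₇ : 0 < 2 * A i j * p * p' - (1 - A i i) * p ^ 2 - (1 - A j j) * p' ^ 2 := by linarith
  unfold IsStrong
  by_contra! hc
  have h₈ : 2 * A i j * p * p' ≤ (1 - A i i) * p ^ 2 + (1 - A j j) * p' ^ 2 := by
    refine le_of_sq_le_sq ?_ (add_nonneg (mul_nonneg (hd i) (sq_nonneg p))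
      (mul_nonneg (hd j) (sq_nonneg p')))
    have := mul_le_mul_of_nonneg_right hc (sq_nonneg (p * p'))
    linarith [sq_nonneg ((1 - A i i) * p ^ 2 - (1 - A j j) * p' ^ 2)]
  linarith

namespace IsCandidate

variable {A : Matrix (Fin 5) (Fin 5) ℝ}

lemma submatrix (h : IsCandidate A) (σ : Equiv.Perm (Fin 5)) : IsCandidate (A.submatrix σ σ) := by
  obtain ⟨h₁, h₂, h₃, h₄, h₅⟩ := h
  have hdot : ∀ x y : Fin 5 → ℝ, (x ∘ σ) ⬝ᵥ (y ∘ σ) = x ⬝ᵥ y :=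
    fun x y => comp_equiv_dotProduct_comp_equiv x y σ
  have hmul : ∀ x : Fin 5 → ℝ, A.submatrix σ σ *ᵥ (x ∘ σ) = (A *ᵥ x) ∘ σ := fun x => by
    rw [submatrix_mulVec_equiv]; simp [Function.comp_assoc]
  have hcomp : ∀ x : Fin 5 → ℝ, x = (x ∘ σ.symm) ∘ σ := fun x => by simp [Function.comp_assoc]
  refine ⟨h₁.submatrix σ, fun i j => h₂ _ _, ?_, fun x => ?_, fun f g => ?_⟩
  · rw [← h₃]; exact Equiv.sum_comp σ fun i => A i i
  · rw [hcomp x, hmul, hdot, hdot]; exact h₄ _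
  · obtain ⟨x, hf, hg, hx⟩ := h₅ (f ∘ σ.symm) (g ∘ σ.symm)
    refine ⟨x ∘ σ, ?_, ?_, ?_⟩
    · rw [hcomp f, hdot, hf]
    · rw [hcomp g, hdot, hg]
    · rwa [hmul, hdot, hdot]

lemma trace_eq (h : IsCandidate A) : A 0 0 + A 1 1 + A 2 2 + A 3 3 + A 4 4 = 1 := by
  rw [← h.2.2.1]; simp [Matrix.trace, Fin.sum_univ_five]

lemma diag_le_one (h : IsCandidate A) (i : Fin 5) : 0 ≤ 1 - A i i := by
  rw [← h.2.2.1, sub_nonneg]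
  exact Finset.single_le_sum (f := fun i => A i i) (fun j _ => h.2.1 j j) (Finset.mem_univ i)

lemma form_eq (h : A.IsSymm) (x : Fin 5 → ℝ) : x ⬝ᵥ A *ᵥ x =
    A 0 0 * x 0 ^ 2 + A 1 1 * x 1 ^ 2 + A 2 2 * x 2 ^ 2 + A 3 3 * x 3 ^ 2 + A 4 4 * x 4 ^ 2 +
    2 * (A 0 1 * x 0 * x 1 + A 0 2 * x 0 * x 2 + A 0 3 * x 0 * x 3 + A 0 4 * x 0 * x 4 +
      A 1 2 * x 1 * x 2 + A 1 3 * x 1 * x 3 + A 1 4 * x 1 * x 4 + A 2 3 * x 2 * x 3 +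
      A 2 4 * x 2 * x 4 + A 3 4 * x 3 * x 4) := by
  simp only [dotProduct, mulVec, Fin.sum_univ_five, h.apply 0 1, h.apply 0 2, h.apply 0 3,
    h.apply 0 4, h.apply 1 2, h.apply 1 3, h.apply 1 4, h.apply 2 3, h.apply 2 4, h.apply 3 4]
  ring

lemma dot_self_eq (x : Fin 5 → ℝ) :
    x ⬝ᵥ x = x 0 ^ 2 + x 1 ^ 2 + x 2 ^ 2 + x 3 ^ 2 + x 4 ^ 2 := by
  simp only [dotProduct, Fin.sum_univ_five]
  ring

lemma exists_linear {a b : ℝ} (ha : 0 ≤ a) (hb : 0 ≤ b) :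
    ∃ f g : ℝ, ∀ x y : ℝ, f * x + g * y = 0 → x * y ≤ 0 ∧ a * x + b * y = 0 := by
  rcases ha.eq_or_lt with rfl | ha'
  · rcases hb.eq_or_lt with rfl | hb'
    · exact ⟨1, 1, fun x y h => ⟨by
        rw [eq_neg_of_add_eq_zero_right (by linarith : x + y = 0)]
        nlinarith [sq_nonneg x], by ring⟩⟩
    · refine ⟨0, b, fun x y h => ?_⟩
      have : y = 0 := by simpa [hb'.ne'] using h
      simp [this]
  · refine ⟨a, b, fun x y h => ⟨?_, h⟩⟩
    have hx : x = -(b / a) * y := by field_simp; linarith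
    rw [hx]
    nlinarith [mul_nonneg (div_nonneg hb ha) (sq_nonneg y)]

lemma mul_le_of_not_isStrong (h : IsCandidate A) {i j : Fin 5} (hij : ¬ IsStrong A i j) (x y : ℝ) :
    A i j * x * y ≤ (√(1 - A i i) * |x|) * (√(1 - A j j) * |y|) := by
  have h₁ : A i j ≤ √(1 - A i i) * √(1 - A j j) := by
    rw [← Real.sqrt_mul (h.diag_le_one i)]
    exact Real.le_sqrt_of_sq_le (not_lt.1 hij)
  calc A i j * x * y ≤ A i j * (|x| * |y|) := by
        rw [mul_assoc, ← abs_mul]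
        exact mul_le_mul_of_nonneg_left (le_abs_self _) (h.2.1 i j)
    _ ≤ (√(1 - A i i) * √(1 - A j j)) * (|x| * |y|) :=
        mul_le_mul_of_nonneg_right h₁ (by positivity)
    _ = _ := by ring

lemma add_sq_le_of_isStrong (h : IsCandidate A) {i j : Fin 5} (hij : IsStrong A i j) {x y : ℝ}
    (hxy : x * y ≤ 0) : (√(1 - A i i) * |x| + √(1 - A j j) * |y|) ^ 2 ≤
      (1 - A i i) * x ^ 2 + (1 - A j j) * y ^ 2 - 2 * (A i j * x * y) := by
  have h₁ : √(1 - A i i) * √(1 - A j j) ≤ A i j := by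
    rw [← Real.sqrt_mul (h.diag_le_one i)]
    exact Real.sqrt_le_iff.2 ⟨h.2.1 i j, hij.le⟩
  have h₂ : |x| * |y| = -(x * y) := by rw [← abs_mul, abs_of_nonpos hxy]
  have h₃ := mul_le_mul_of_nonneg_right h₁ (neg_nonneg.2 hxy)
  have e : (√(1 - A i i) * |x| + √(1 - A j j) * |y|) ^ 2 = √(1 - A i i) ^ 2 * |x| ^ 2 +
    √(1 - A j j) ^ 2 * |y| ^ 2 + 2 * (√(1 - A i i) * √(1 - A j j) * (|x| * |y|)) := by ring
  rw [e, Real.sq_sqrt (h.diag_le_one i), Real.sq_sqrt (h.diag_le_one j), sq_abs, sq_abs, h₂]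
  linarith

lemma exists_cross_isStrong (h : IsCandidate A) (h12 : IsStrong A 1 2) (h34 : IsStrong A 3 4) :
    IsStrong A 1 3 ∨ IsStrong A 1 4 ∨ IsStrong A 2 3 ∨ IsStrong A 2 4 := by
  by_contra! hc
  obtain ⟨h13, h14, h23, h24⟩ := hc
  obtain ⟨f₁, f₂, hf⟩ := exists_linear (h.2.1 0 1) (h.2.1 0 2)
  obtain ⟨f₃, f₄, hg⟩ := exists_linear (h.2.1 0 3) (h.2.1 0 4)
  obtain ⟨x, hx₁, hx₂, hx⟩ := h.2.2.2.2 ![0, f₁, f₂, 0, 0] ![0, 0, 0, f₃, f₄]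
  obtain ⟨hxy, hf⟩ := hf (x 1) (x 2) (by simpa [dotProduct, Fin.sum_univ_five] using hx₁)
  obtain ⟨hzw, hg⟩ := hg (x 3) (x 4) (by simpa [dotProduct, Fin.sum_univ_five] using hx₂)
  rw [form_eq h.1, dot_self_eq] at hx
  have e₁ := h.add_sq_le_of_isStrong h12 hxy
  have e₂ := h.add_sq_le_of_isStrong h34 hzw
  have e₃ := h.mul_le_of_not_isStrong h13 (x 1) (x 3)
  have e₄ := h.mul_le_of_not_isStrong h14 (x 1) (x 4)
  have e₅ := h.mul_le_of_not_isStrong h23 (x 2) (x 3)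
  have e₆ := h.mul_le_of_not_isStrong h24 (x 2) (x 4)
  have e₇ := mul_nonneg (h.diag_le_one 0) (sq_nonneg (x 0))
  have e₈ : A 0 1 * x 0 * x 1 + A 0 2 * x 0 * x 2 = 0 := by linear_combination x 0 * hf
  have e₉ : A 0 3 * x 0 * x 3 + A 0 4 * x 0 * x 4 = 0 := by linear_combination x 0 * hg
  have e₁₀ := two_mul_le_add_sq (√(1 - A 1 1) * |x 1| + √(1 - A 2 2) * |x 2|)
    (√(1 - A 3 3) * |x 3| + √(1 - A 4 4) * |x 4|)
  linarith

lemma pos_of_lt_form {a d d' m x y : ℝ} (hd : 0 ≤ d) (hd' : 0 ≤ d') (hm : 0 ≤ m) (hx : 0 ≤ x)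
    (hy : 0 ≤ y) (h : m < 2 * a * x * y - d * x ^ 2 - d' * y ^ 2) : 0 < x ∧ 0 < y := by
  refine ⟨hx.lt_of_ne ?_, hy.lt_of_ne ?_⟩ <;> intro h0 <;> rw [← h0] at h <;>
    nlinarith [mul_nonneg hd (sq_nonneg x), mul_nonneg hd' (sq_nonneg y)]

lemma exists_isSplit (h : IsCandidate A) :
    IsSplit A 1 2 3 4 ∨ IsSplit A 1 3 2 4 ∨ IsSplit A 1 4 2 3 := by
  set B : Matrix (Fin 5) (Fin 5) ℝ := .of fun i j => if i = 0 ∨ j = 0 then 0 else A i j with hB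
  have hBs : B.IsSymm := by
    ext i j
    simp [hB, or_comm, h.1.apply i j]
  obtain ⟨μ, v, hvv, hBv, hsq, hform, -, -⟩ := exists_orthonormal_eigenvectors hBs
  have key : ∃ i j, i ≠ j ∧ 1 < μ i ∧ 1 < μ j := by
    by_contra! hc
    obtain ⟨i, hi⟩ : ∃ i, ∀ j, j ≠ i → μ j ≤ 1 := by
      by_cases hi : ∃ i, 1 < μ i
      · obtain ⟨i, hi⟩ := hi
        exact ⟨i, fun j hj => hc i j hj.symm hi⟩
      · exact ⟨0, fun j _ => not_lt.1 fun hj => hi ⟨j, hj⟩⟩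
    obtain ⟨x, hx0, hxi, hx⟩ := h.2.2.2.2 (Pi.single 0 1) (v i)
    rw [single_one_dotProduct] at hx0
    have : x ⬝ᵥ A *ᵥ x = x ⬝ᵥ B *ᵥ x := by
      rw [form_eq h.1, form_eq hBs]
      simp [hB, hx0]
    rw [this, hsq, hform] at hx
    refine hx.not_ge (Finset.sum_le_sum fun j _ => ?_)
    rcases eq_or_ne j i with rfl | hj
    · simp [hxi]
    · nlinarith [hi j hj, sq_nonneg (v j ⬝ᵥ x)]
  obtain ⟨i, j, hij, hi, hj⟩ := key
  have hv0 : ∀ i, v i ≠ 0 := fun i hi => by simpa [hi] using hvv i i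
  obtain ⟨p, q, hp, hq, hp0, hq0, hpq, h₁, h₂⟩ := exists_disjoint_nonneg_of_eigenvectors hBs
    (hv0 i) (hv0 j) (by rw [hvv, if_neg hij]) (hBv i) (hBv j) (min_le_left (μ i) (μ j))
    (min_le_right _ _)
  have hc : 1 < min (μ i) (μ j) := lt_min hi hj
  have hpos : ∀ w : Fin 5 → ℝ, w ≠ 0 → w ⬝ᵥ w < min (μ i) (μ j) * (w ⬝ᵥ w) := fun w hw => by
    have : 0 < w ⬝ᵥ w := lt_of_le_of_ne (Finset.sum_nonneg fun i _ => mul_self_nonneg _)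
      fun h => hw (dotProduct_self_eq_zero.1 h.symm)
    nlinarith
  have hp1 := hpos p hp0
  have hq1 := hpos q hq0
  have hm : p ⬝ᵥ B *ᵥ q = A 1 1 * p 1 * q 1 + A 2 2 * p 2 * q 2 + A 3 3 * p 3 * q 3 +
      A 4 4 * p 4 * q 4 + A 1 2 * (p 1 * q 2 + p 2 * q 1) + A 1 3 * (p 1 * q 3 + p 3 * q 1) +
      A 1 4 * (p 1 * q 4 + p 4 * q 1) + A 2 3 * (p 2 * q 3 + p 3 * q 2) +
      A 2 4 * (p 2 * q 4 + p 4 * q 2) + A 3 4 * (p 3 * q 4 + p 4 * q 3) := by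
    simp [dotProduct, mulVec, Fin.sum_univ_five, hB, h.1.apply 1 2, h.1.apply 1 3, h.1.apply 1 4,
      h.1.apply 2 3, h.1.apply 2 4, h.1.apply 3 4]
    ring
  rw [form_eq hBs, hm] at h₁ h₂
  rw [dot_self_eq] at hp1 hq1 h₁ h₂
  simp only [hB, of_apply, Fin.isValue, true_or, if_true, Fin.reduceEq, or_self, if_false,
    zero_mul, zero_add] at h₁ h₂
  have hm0 : ∀ i j, 0 ≤ A i j * p i * q j := fun i j =>
    mul_nonneg (mul_nonneg (h.2.1 i j) (hp i)) (hq j)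
  have hm1 : ∀ i j, 0 ≤ A i j * p j * q i := fun i j => h.1.apply i j ▸ hm0 j i
  have hd := h.diag_le_one
  have hdp : ∀ i, 0 ≤ (1 - A i i) * p i ^ 2 := fun i => mul_nonneg (hd i) (sq_nonneg _)
  have hdq : ∀ i, 0 ≤ (1 - A i i) * q i ^ 2 := fun i => mul_nonneg (hd i) (sq_nonneg _)
  have split : ∀ i j k l : Fin 5,
      A i k * p i * q k + A i l * p i * q l + A j k * p j * q k + A j l * p j * q l <
        2 * A i j * p i * p j - (1 - A i i) * p i ^ 2 - (1 - A j j) * p j ^ 2 →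
      A i k * p i * q k + A i l * p i * q l + A j k * p j * q k + A j l * p j * q l <
        2 * A k l * q k * q l - (1 - A k k) * q k ^ 2 - (1 - A l l) * q l ^ 2 →
      IsSplit A i j k l := by
    intro i j k l h₁ h₂
    have hm : 0 ≤ A i k * p i * q k + A i l * p i * q l + A j k * p j * q k + A j l * p j * q l := by
      linarith [hm0 i k, hm0 i l, hm0 j k, hm0 j l]
    obtain ⟨a₁, a₂⟩ := pos_of_lt_form (hd i) (hd j) hm (hp i) (hp j) h₁
    obtain ⟨a₃, a₄⟩ := pos_of_lt_form (hd k) (hd l) hm (hq k) (hq l) h₂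
    exact ⟨_, _, _, _, a₁, a₂, a₃, a₄, h₁, h₂⟩
  have hp2 : p 0 ^ 2 + p 1 ^ 2 + p 2 ^ 2 + p 3 ^ 2 + p 4 ^ 2 + _ < _ :=
    (add_lt_add_left hp1 _).trans_le h₁
  have hq2 : q 0 ^ 2 + q 1 ^ 2 + q 2 ^ 2 + q 3 ^ 2 + q 4 ^ 2 + _ < _ :=
    (add_lt_add_left hq1 _).trans_le h₂
  have hp3 := sq_nonneg (p 0)
  have hq3 := sq_nonneg (q 0)
  clear hform hsq hBv hvv hpos hv0 hm hBs h₁ h₂ hp1 hq1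
  rcases hpq 1 with h1 | h1 <;> rcases hpq 2 with h2 | h2 <;> rcases hpq 3 with h3 | h3 <;>
    rcases hpq 4 with h4 | h4 <;>
    simp only [h1, h2, h3, h4, mul_zero, zero_mul, add_zero, zero_add, ne_eq, OfNat.ofNat_ne_zero,
      not_false_eq_true, zero_pow] at hp2 hq2
  · linarith [hp2, hp3]
  · linarith [hdp 4, hm1 1 4, hm1 2 4, hm1 3 4, hp2, hp3]
  · linarith [hdp 3, hm1 1 3, hm1 2 3, hm0 3 4, hp2, hp3]
  · exact Or.inl <| (split 3 4 1 2
      (by rw [h.1.apply 1 3, h.1.apply 1 4, h.1.apply 2 3, h.1.apply 2 4]; linarith)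
      (by rw [h.1.apply 1 3, h.1.apply 1 4, h.1.apply 2 3, h.1.apply 2 4]; linarith)).symm h.1
  · linarith [hdp 2, hm1 1 2, hm0 2 3, hm0 2 4, hp2, hp3]
  · exact Or.inr <| Or.inl <| (split 2 4 1 3
      (by rw [h.1.apply 1 2, h.1.apply 1 4, h.1.apply 3 4]; linarith)
      (by rw [h.1.apply 1 2, h.1.apply 1 4, h.1.apply 3 4]; linarith)).symm h.1
  · exact Or.inr <| Or.inr <| (split 2 3 1 4 (by rw [h.1.apply 1 2, h.1.apply 1 3]; linarith)
      (by rw [h.1.apply 1 2, h.1.apply 1 3]; linarith)).symm h.1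
  · linarith [hdq 1, hm1 1 2, hm1 1 3, hm1 1 4, hq2, hq3]
  · linarith [hdp 1, hm0 1 2, hm0 1 3, hm0 1 4, hp2, hp3]
  · exact Or.inr <| Or.inr <| split 1 4 2 3 (by rw [h.1.apply 2 4, h.1.apply 3 4]; linarith)
      (by rw [h.1.apply 2 4, h.1.apply 3 4]; linarith)
  · exact Or.inr <| Or.inl <| split 1 3 2 4 (by rw [h.1.apply 2 3]; linarith)
      (by rw [h.1.apply 2 3]; linarith)
  · linarith [hdq 2, hm0 1 2, hm1 2 3, hm1 2 4, hq2, hq3]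
  · exact Or.inl <| split 1 2 3 4 (by linarith) (by linarith)
  · linarith [hdq 3, hm0 1 3, hm0 2 3, hm1 3 4, hq2, hq3]
  · linarith [hdq 4, hm0 1 4, hm0 2 4, hm0 3 4, hq2, hq3]
  · linarith [hq2, hq3]

lemma of_bijective (h : IsCandidate A) {a b c d e : Fin 5}
    (hσ : Function.Bijective ![a, b, c, d, e]) :
    IsCandidate (A.submatrix ![a, b, c, d, e] ![a, b, c, d, e]) :=
  h.submatrix (Equiv.ofBijective _ hσ)

lemma exists_isStrong (h : IsCandidate A) :
    (IsStrong A 1 2 ∧ IsStrong A 3 4 ∧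
      (IsStrong A 1 3 ∨ IsStrong A 1 4 ∨ IsStrong A 2 3 ∨ IsStrong A 2 4)) ∨
    (IsStrong A 1 3 ∧ IsStrong A 2 4 ∧
      (IsStrong A 1 2 ∨ IsStrong A 1 4 ∨ IsStrong A 2 3 ∨ IsStrong A 3 4)) ∨
    (IsStrong A 1 4 ∧ IsStrong A 2 3 ∧
      (IsStrong A 1 2 ∨ IsStrong A 1 3 ∨ IsStrong A 2 4 ∨ IsStrong A 3 4)) := by
  have strong : ∀ {i j k l}, IsSplit A i j k l → IsStrong A i j ∧ IsStrong A k l := fun hs =>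
    ⟨hs.isStrong h.2.1 h.diag_le_one, (hs.symm h.1).isStrong h.2.1 h.diag_le_one⟩
  rcases h.exists_isSplit with hs | hs | hs
  · obtain ⟨h₁, h₂⟩ := strong hs
    exact .inl ⟨h₁, h₂, h.exists_cross_isStrong h₁ h₂⟩
  · obtain ⟨h₁, h₂⟩ := strong hs
    have : IsStrong A 1 2 ∨ IsStrong A 1 4 ∨ IsStrong A 3 2 ∨ IsStrong A 3 4 :=
      (h.of_bijective (a := 0) (b := 1) (c := 3) (d := 2) (e := 4) (by decide)).exists_cross_isStrong
        h₁ h₂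
    exact .inr <| .inl ⟨h₁, h₂, this.imp_right (.imp_right (.imp_left (·.symm h.1)))⟩
  · obtain ⟨h₁, h₂⟩ := strong hs
    have : IsStrong A 1 2 ∨ IsStrong A 1 3 ∨ IsStrong A 4 2 ∨ IsStrong A 4 3 :=
      (h.of_bijective (a := 0) (b := 1) (c := 4) (d := 2) (e := 3) (by decide)).exists_cross_isStrong
        h₁ h₂
    exact .inr <| .inr ⟨h₁, h₂, this.imp_right (.imp_right (.imp (·.symm h.1) (·.symm h.1)))⟩

lemma exists_isStrong_cycle (h : IsCandidate A) (hs : IsSplit A 1 2 3 4) :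
    IsStrong A 1 3 ∧ IsStrong A 2 4 ∨ IsStrong A 1 4 ∧ IsStrong A 2 3 ∨
    IsStrong A 0 1 ∧ IsStrong A 2 3 ∧ IsStrong A 0 4 ∨
    IsStrong A 0 2 ∧ IsStrong A 1 3 ∧ IsStrong A 0 4 ∨
    IsStrong A 0 1 ∧ IsStrong A 2 4 ∧ IsStrong A 0 3 ∨
    IsStrong A 0 2 ∧ IsStrong A 1 4 ∧ IsStrong A 0 3 := by
  have s12 := hs.isStrong h.2.1 h.diag_le_one
  have s34 := (hs.symm h.1).isStrong h.2.1 h.diag_le_one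
  have f0 := h.exists_cross_isStrong s12 s34
  have f1 := (h.of_bijective (a := 1) (b := 0) (c := 2) (d := 3) (e := 4) (by decide)).exists_isStrong
  have f2 := (h.of_bijective (a := 2) (b := 0) (c := 1) (d := 3) (e := 4) (by decide)).exists_isStrong
  have f3 := (h.of_bijective (a := 3) (b := 0) (c := 1) (d := 2) (e := 4) (by decide)).exists_isStrong
  have f4 := (h.of_bijective (a := 4) (b := 0) (c := 1) (d := 2) (e := 3) (by decide)).exists_isStrong
  change IsStrong A 0 2 ∧ IsStrong A 3 4 ∧
      (IsStrong A 0 3 ∨ IsStrong A 0 4 ∨ IsStrong A 2 3 ∨ IsStrong A 2 4) ∨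
    IsStrong A 0 3 ∧ IsStrong A 2 4 ∧
      (IsStrong A 0 2 ∨ IsStrong A 0 4 ∨ IsStrong A 2 3 ∨ IsStrong A 3 4) ∨
    IsStrong A 0 4 ∧ IsStrong A 2 3 ∧
      (IsStrong A 0 2 ∨ IsStrong A 0 3 ∨ IsStrong A 2 4 ∨ IsStrong A 3 4) at f1
  change IsStrong A 0 1 ∧ IsStrong A 3 4 ∧
      (IsStrong A 0 3 ∨ IsStrong A 0 4 ∨ IsStrong A 1 3 ∨ IsStrong A 1 4) ∨
    IsStrong A 0 3 ∧ IsStrong A 1 4 ∧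
      (IsStrong A 0 1 ∨ IsStrong A 0 4 ∨ IsStrong A 1 3 ∨ IsStrong A 3 4) ∨
    IsStrong A 0 4 ∧ IsStrong A 1 3 ∧
      (IsStrong A 0 1 ∨ IsStrong A 0 3 ∨ IsStrong A 1 4 ∨ IsStrong A 3 4) at f2
  change IsStrong A 0 1 ∧ IsStrong A 2 4 ∧
      (IsStrong A 0 2 ∨ IsStrong A 0 4 ∨ IsStrong A 1 2 ∨ IsStrong A 1 4) ∨
    IsStrong A 0 2 ∧ IsStrong A 1 4 ∧
      (IsStrong A 0 1 ∨ IsStrong A 0 4 ∨ IsStrong A 1 2 ∨ IsStrong A 2 4) ∨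
    IsStrong A 0 4 ∧ IsStrong A 1 2 ∧
      (IsStrong A 0 1 ∨ IsStrong A 0 2 ∨ IsStrong A 1 4 ∨ IsStrong A 2 4) at f3
  change IsStrong A 0 1 ∧ IsStrong A 2 3 ∧
      (IsStrong A 0 2 ∨ IsStrong A 0 3 ∨ IsStrong A 1 2 ∨ IsStrong A 1 3) ∨
    IsStrong A 0 2 ∧ IsStrong A 1 3 ∧
      (IsStrong A 0 1 ∨ IsStrong A 0 3 ∨ IsStrong A 1 2 ∨ IsStrong A 2 3) ∨
    IsStrong A 0 3 ∧ IsStrong A 1 2 ∧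
      (IsStrong A 0 1 ∨ IsStrong A 0 2 ∨ IsStrong A 1 3 ∨ IsStrong A 2 3) at f4
  clear h hs
  generalize IsStrong A 0 1 = a, IsStrong A 0 2 = b, IsStrong A 0 3 = c, IsStrong A 0 4 = d,
    IsStrong A 1 2 = e, IsStrong A 1 3 = f, IsStrong A 1 4 = g, IsStrong A 2 3 = i,
    IsStrong A 2 4 = j, IsStrong A 3 4 = k at *
  grind

lemma half_le (h : IsCandidate A) (hmax : ∀ i, A i i ≤ A 0 0) {i : Fin 5} (hi : i ≠ 0) :
    1 / 2 ≤ 1 - A i i := by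
  have := h.trace_eq
  have := h.2.1 1 1
  have := h.2.1 2 2
  have := h.2.1 3 3
  have := h.2.1 4 4
  fin_cases i <;> simp_all <;> linarith [hmax 1, hmax 2, hmax 3, hmax 4]

lemma prod_sub_ge {a b c d : ℝ} (ha : 0 ≤ a) (hb : 0 ≤ b) (hc : 0 ≤ c) (hd : 0 ≤ d)
    (h : a + b + c + d ≤ 1) : 1 - (a + b + c + d) ≤ (1 - a) * (1 - b) * ((1 - c) * (1 - d)) := by
  have h₁ : 1 - (a + b) ≤ (1 - a) * (1 - b) := by nlinarith [mul_nonneg ha hb]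
  have h₂ : 1 - (c + d) ≤ (1 - c) * (1 - d) := by nlinarith [mul_nonneg hc hd]
  calc _ ≤ (1 - (a + b)) * (1 - (c + d)) := by
        nlinarith [mul_nonneg (add_nonneg ha hb) (add_nonneg hc hd)]
    _ ≤ _ := mul_le_mul h₁ h₂ (by linarith) (mul_nonneg (by linarith) (by linarith))

lemma four_mul_lt_of_split {X Y W s t p p' q q' k l : ℝ} (hs : 0 < s) (ht : 0 < t)
    (hst : s * t = W) (hp : 0 < p) (hp' : 0 < p') (hq : 0 < q) (hq' : 0 < q') (hk : 0 ≤ k)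
    (hl : 0 ≤ l) (hkl : W ≤ k * l)
    (h₁ : k * p * q + l * p' * q' < 2 * (X - s) * p * p')
    (h₂ : k * p * q + l * p' * q' < 2 * (Y - t) * q * q') :
    0 < X ∧ 0 < Y ∧ 4 * W < X * Y := by
  have hm : 0 ≤ k * p * q + l * p' * q' := by positivity
  have hX : 0 < X - s := by
    by_contra! hc
    have := mul_nonneg (mul_nonneg (neg_nonneg.2 hc) hp.le) hp'.le
    linarith
  have hY : 0 < Y - t := by
    by_contra! hc
    have := mul_nonneg (mul_nonneg (neg_nonneg.2 hc) hq.le) hq'.le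
    linarith
  have hW : 0 < W := hst ▸ mul_pos hs ht
  have h₃ : (k * p * q + l * p' * q') ^ 2 < (2 * (X - s) * p * p') * (2 * (Y - t) * q * q') := by
    rw [sq]; exact mul_lt_mul'' h₁ h₂ hm hm
  have h₄ : 4 * (W * (p * p' * q * q')) ≤ (k * p * q + l * p' * q') ^ 2 := by
    have : W * (p * p' * q * q') ≤ (k * l) * (p * p' * q * q') :=
      mul_le_mul_of_nonneg_right hkl (by positivity)
    linarith [sq_nonneg (k * p * q - l * p' * q')]
  have h₅ : W < (X - s) * (Y - t) := by
    by_contra! hc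
    have : (X - s) * (Y - t) * (p * p' * q * q') ≤ W * (p * p' * q * q') :=
      mul_le_mul_of_nonneg_right hc (by positivity)
    linarith
  refine ⟨by linarith, by linarith, ?_⟩
  have hX' : 0 < X := by linarith
  have hY' : 0 < Y := by linarith
  have h₆ : s * Y + t * X < X * Y := by linarith
  have h₇ : (s * Y + t * X) ^ 2 < (X * Y) ^ 2 := by
    exact pow_lt_pow_left₀ h₆ (by positivity) (by norm_num)
  have h₈ : 4 * (W * (X * Y)) ≤ (s * Y + t * X) ^ 2 := by
    rw [← hst]; linarith [sq_nonneg (s * Y - t * X)]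
  have : 0 < X * Y := by positivity
  by_contra! hc
  have := mul_le_mul_of_nonneg_right hc this.le
  linarith

lemma not_isStrong_of_isSplit (h : IsCandidate A) (hmax : ∀ i, A i i ≤ A 0 0)
    (hs : IsSplit A 1 2 3 4) (h13 : IsStrong A 1 3) : ¬ IsStrong A 2 4 := by
  intro h24
  obtain ⟨p, p', q, q', hp, hp', hq, hq', h₁, h₂⟩ := hs
  have hd : ∀ i : Fin 5, i ≠ 0 → 0 < 1 - A i i := fun i hi => by linarith [h.half_le hmax hi]
  have hd1 := hd 1 (by decide)
  have hd2 := hd 2 (by decide)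
  have hd3 := hd 3 (by decide)
  have hd4 := hd 4 (by decide)
  have hW : A 0 0 ≤ (1 - A 1 1) * (1 - A 2 2) * ((1 - A 3 3) * (1 - A 4 4)) := by
    have := h.trace_eq
    refine le_trans ?_ (prod_sub_ge (h.2.1 1 1) (h.2.1 2 2) (h.2.1 3 3) (h.2.1 4 4) ?_) <;>
      linarith [h.2.1 0 0]
  have hones : A 1 2 + A 3 4 + A 1 3 + A 2 4 ≤ 4 := by
    have := h.2.2.2.1 ![0, 1, 1, 1, 1]
    rw [form_eq h.1, dot_self_eq] at this
    simp at this
    linarith [h.2.1 1 4, h.2.1 2 3, h.2.1 1 1, h.2.1 2 2, h.2.1 3 3, h.2.1 4 4]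
  have amgm : ∀ {a b : ℝ} (x y : ℝ), 0 ≤ a → 0 ≤ b →
      - a * x ^ 2 - b * y ^ 2 ≤ -2 * (√(a * b) * (x * y)) := by
    intro a b x y ha hb
    rw [Real.sqrt_mul ha]
    have := sq_nonneg (√a * x - √b * y)
    rw [sub_sq, mul_pow, mul_pow, Real.sq_sqrt ha, Real.sq_sqrt hb] at this
    linarith
  set s := √((1 - A 1 1) * (1 - A 2 2)) with hsdef
  set t := √((1 - A 3 3) * (1 - A 4 4)) with htdef
  have hs0 : 0 < s := Real.sqrt_pos.2 (mul_pos hd1 hd2)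
  have ht0 : 0 < t := Real.sqrt_pos.2 (mul_pos hd3 hd4)
  have hst2 : A 0 0 ≤ (s * t) ^ 2 := by
    rwa [mul_pow, Real.sq_sqrt (mul_pos hd1 hd2).le, Real.sq_sqrt (mul_pos hd3 hd4).le]
  have hkl : s * t ≤ A 1 3 * A 2 4 := by
    refine le_of_sq_le_sq ?_ (mul_nonneg (h.2.1 _ _) (h.2.1 _ _))
    rw [mul_pow, mul_pow, Real.sq_sqrt (mul_pos hd1 hd2).le, Real.sq_sqrt (mul_pos hd3 hd4).le]
    have := mul_le_mul h13.le h24.le (mul_pos hd2 hd4).le (sq_nonneg _)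
    linarith
  have c14 := mul_nonneg (mul_nonneg (h.2.1 1 4) hp.le) hq'.le
  have c23 := mul_nonneg (mul_nonneg (h.2.1 2 3) hp'.le) hq.le
  obtain ⟨hX, hY, hXY⟩ := four_mul_lt_of_split (X := A 1 2) (Y := A 3 4) hs0 ht0 rfl hp hp' hq hq'
    (h.2.1 1 3) (h.2.1 2 4) hkl
    (by linarith [amgm p p' hd1.le hd2.le]) (by linarith [amgm q q' hd3.le hd4.le])
  obtain ⟨r, hr, hrW⟩ : ∃ r, 0 < r ∧ r ^ 2 = s * t :=
    ⟨√(s * t), Real.sqrt_pos.2 (mul_pos hs0 ht0), Real.sq_sqrt (mul_pos hs0 ht0).le⟩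
  rw [← hrW] at hst2 hkl hXY
  have e₁ : 4 * r ≤ A 1 2 + A 3 4 := by
    refine le_of_sq_le_sq ?_ (by linarith)
    linarith [sq_nonneg (A 1 2 - A 3 4)]
  have e₂ : 2 * r ≤ A 1 3 + A 2 4 := by
    refine le_of_sq_le_sq ?_ (add_nonneg (h.2.1 _ _) (h.2.1 _ _))
    linarith [sq_nonneg (A 1 3 - A 2 4)]
  have e₃ : r ≤ 2 / 3 := by linarith
  have e₄ : 1 / 5 ≤ A 0 0 := by linarith [h.trace_eq, hmax 1, hmax 2, hmax 3, hmax 4]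
  have e₅ := pow_le_pow_left₀ hr.le e₃ 4
  rw [← pow_mul] at hst2
  norm_num at e₅ hst2
  linarith

end IsCandidate

set_option maxRecDepth 20000 in
lemma poly_ineq {b₁ b₂ b₃ b₄ h : ℝ} (h₁ : 0 ≤ b₁) (h₂ : 0 ≤ b₂) (h₃ : 0 ≤ b₃) (h₄ : 0 ≤ b₄)
    (hB : b₁ + b₂ + b₃ + b₄ ≤ 1)
    (hh : 9 * h = 5 * (b₁ + b₂ + b₃ + b₄) - 2 * (b₁ + b₂ + b₃ + b₄) ^ 2
      + (b₁ + b₂) * (b₃ + b₄)) :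
    5 * (((2 - h + b₁) * (2 + b₂) - 1) * ((2 - h + b₄) * (2 + b₃) - 1)) ≤
      17 + 7 * ((2 - h + b₁) * (2 - h + b₄) + 4 * h + 3 * h ^ 2) := by
  obtain ⟨s, hs, hs1⟩ : ∃ s, 0 ≤ s ∧ b₁ + b₂ + b₃ + b₄ + s = 1 :=
    ⟨1 - (b₁ + b₂ + b₃ + b₄), by linarith, by ring⟩
  have hh' : h = (5 * (b₁ + b₂ + b₃ + b₄) * (b₁ + b₂ + b₃ + b₄ + s) - 2 * (b₁ + b₂ + b₃ + b₄) ^ 2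
      + (b₁ + b₂) * (b₃ + b₄)) / 9 := by rw [hs1]; linarith
  have key : ∀ t H : ℝ, t = b₁ + b₂ + b₃ + b₄ + s →
      H = (5 * (b₁ + b₂ + b₃ + b₄) * (b₁ + b₂ + b₃ + b₄ + s) - 2 * (b₁ + b₂ + b₃ + b₄) ^ 2
        + (b₁ + b₂) * (b₃ + b₄)) / 9 →
      0 ≤ 17 * t ^ 6 + 7 * (((2 * t + b₁) * t - H) * ((2 * t + b₄) * t - H) * t ^ 2
        + 4 * H * t ^ 4 + 3 * H ^ 2 * t ^ 2)
        - 5 * ((((2 * t + b₁) * t - H) * (2 * t + b₂) - t ^ 3)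
          * (((2 * t + b₄) * t - H) * (2 * t + b₃) - t ^ 3)) := by
    intro t H ht hH
    subst ht hH
    ring_nf
    positivity
  have := key 1 h hs1.symm hh'
  linarith

lemma cycle_det_nonneg {E₁ e₂ e₃ E₄ p r h : ℝ}
    (hQ : ∀ x₁ x₂ x₃ x₄ : ℝ, 0 ≤ E₁ * x₁ ^ 2 + e₂ * x₂ ^ 2 + e₃ * x₃ ^ 2 + E₄ * x₄ ^ 2
      - 2 * p * x₁ * x₂ - 2 * x₂ * x₃ - 2 * r * x₃ * x₄ - 2 * h * x₁ * x₄) :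
    E₁ * E₄ + 2 * (p * r) * h + h ^ 2 * (e₂ * e₃ - 1) ≤
      (E₁ * e₂ - p ^ 2) * (e₃ * E₄ - r ^ 2) := by
  have hM : (!![E₁, -p, 0, -h; -p, e₂, -1, 0; 0, -1, e₃, -r; -h, 0, -r, E₄] :
      Matrix (Fin 4) (Fin 4) ℝ).PosSemidef := by
    refine Matrix.PosSemidef.of_dotProduct_mulVec_nonneg ?_ fun x => ?_
    · ext i j
      fin_cases i <;> fin_cases j <;> simp
    · refine (hQ (x 0) (x 1) (x 2) (x 3)).trans_eq ?_
      simp [dotProduct, mulVec, Fin.sum_univ_four]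
      ring
  have := hM.det_nonneg
  simp [det_succ_row_zero, Fin.sum_univ_succ, Fin.succAbove] at this
  linarith

lemma lt_mul_of_mul_lt_mul {K X Y s t : ℝ} (hK4 : 4 ≤ K) (hK9 : K ≤ 9) (hX : 0 ≤ X) (hY : 0 ≤ Y)
    (hs : 0 < s) (ht : 0 < t) (hXY : K ≤ X * Y) (hst : 1 < s * t) :
    17 + 7 * K < 5 * ((X + s) * (Y + t)) := by
  have hS : (12 + 2 * K) / 5 ≤ X * t + Y * s := by
    refine le_of_sq_le_sq ?_ (by positivity)
    have : K * 1 ≤ (X * Y) * (s * t) :=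
      mul_le_mul hXY hst.le (by norm_num) (by positivity)
    nlinarith only [sq_nonneg (X * t - Y * s), this,
      mul_nonneg (sub_nonneg.2 hK4) (sub_nonneg.2 hK9)]
  linarith only [hS, hXY, hst]

lemma not_cycle_form_nonneg {b₁ b₂ b₃ b₄ p r h : ℝ} (h₁ : 0 ≤ b₁) (h₂ : 0 ≤ b₂) (h₃ : 0 ≤ b₃)
    (h₄ : 0 ≤ b₄) (hB : b₁ + b₂ + b₃ + b₄ ≤ 1)
    (hh : 9 * h = 5 * (b₁ + b₂ + b₃ + b₄) - 2 * (b₁ + b₂ + b₃ + b₄) ^ 2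
      + (b₁ + b₂) * (b₃ + b₄)) (hp : 0 ≤ p) (hr : 0 ≤ r) (hp1 : 1 < p ^ 2) (hr1 : 1 < r ^ 2)
    (hpr : 1 < (p ^ 2 - 1) * (r ^ 2 - 1)) :
    ¬ ∀ x₁ x₂ x₃ x₄ : ℝ, 0 ≤ (2 - h + b₁) * x₁ ^ 2 + (2 + b₂) * x₂ ^ 2 + (2 + b₃) * x₃ ^ 2
      + (2 - h + b₄) * x₄ ^ 2 - 2 * p * x₁ * x₂ - 2 * x₂ * x₃ - 2 * r * x₃ * x₄
      - 2 * h * x₁ * x₄ := by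
  intro hQ
  have hh0 : 0 ≤ h := by nlinarith [mul_nonneg (add_nonneg h₁ h₂) (add_nonneg h₃ h₄)]
  have hh1 : h ≤ 5 / 9 := by
    nlinarith [sq_nonneg (b₁ + b₂ - b₃ - b₄), sq_nonneg (b₁ + b₂ + b₃ + b₄ - 1)]
  have hx : p ^ 2 ≤ (2 - h + b₁) * (2 + b₂) := by
    have := hQ (2 + b₂) p 0 0
    have : 0 ≤ (2 + b₂) * ((2 - h + b₁) * (2 + b₂) - p ^ 2) := by linarith
    linarith [nonneg_of_mul_nonneg_right this (by linarith : 0 < 2 + b₂)]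
  have hy : r ^ 2 ≤ (2 + b₃) * (2 - h + b₄) := by
    have := hQ 0 0 r (2 + b₃)
    have : 0 ≤ (2 + b₃) * ((2 + b₃) * (2 - h + b₄) - r ^ 2) := by linarith
    linarith [nonneg_of_mul_nonneg_right this (by linarith : 0 < 2 + b₃)]
  have h2 : 2 ≤ p * r := by
    refine le_of_sq_le_sq ?_ (mul_nonneg hp hr)
    nlinarith only [sq_nonneg (p ^ 2 - r ^ 2), hpr, hp1, hr1]
  have hdet := cycle_det_nonneg hQ
  have hpoly := poly_ineq h₁ h₂ h₃ h₄ hB hh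
  generalize hK : (2 - h + b₁) * (2 - h + b₄) + 4 * h + 3 * h ^ 2 = K at hpoly
  have hK' : K = 4 + 4 * h ^ 2 + (2 - h) * (b₁ + b₄) + b₁ * b₄ := by rw [← hK]; ring
  have hb14 : 0 ≤ b₁ * b₄ := mul_nonneg h₁ h₄
  have hK4 : 4 ≤ K := by
    have := mul_nonneg (by linarith : 0 ≤ 2 - h) (add_nonneg h₁ h₄)
    have := sq_nonneg h
    linarith
  have hK9 : K ≤ 9 := by
    have := mul_nonneg hh0 (add_nonneg h₁ h₄)
    have : b₁ * b₄ ≤ 1 := mul_le_one₀ (by linarith) h₄ (by linarith)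
    have : h ^ 2 ≤ (5 / 9) ^ 2 := pow_le_pow_left₀ hh0 hh1 2
    linarith
  have hxy : K ≤ ((2 - h + b₁) * (2 + b₂) - p ^ 2) * ((2 + b₃) * (2 - h + b₄) - r ^ 2) := by
    have := mul_le_mul_of_nonneg_right h2 hh0
    have : 0 ≤ h ^ 2 * ((2 + b₂) * (2 + b₃) - 4) :=
      mul_nonneg (sq_nonneg h) (by linarith [mul_nonneg h₂ h₃])
    linarith
  generalize hX : (2 - h + b₁) * (2 + b₂) - p ^ 2 = X at hxy
  generalize hY : (2 + b₃) * (2 - h + b₄) - r ^ 2 = Y at hxy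
  generalize hs : p ^ 2 - 1 = s at hpr
  generalize ht : r ^ 2 - 1 = t at hpr
  have e₁ : (2 - h + b₁) * (2 + b₂) - 1 = X + s := by linarith
  have e₂ : (2 - h + b₄) * (2 + b₃) - 1 = Y + t := by linarith
  rw [e₁, e₂] at hpoly
  exact absurd (lt_mul_of_mul_lt_mul hK4 hK9 (by linarith) (by linarith) (by linarith)
    (by linarith) hxy hpr) hpoly.not_gt

lemma nine_mul_cycle_weight_le {b₁ b₂ b₃ b₄ h δ : ℝ} (h₁ : 0 ≤ b₁) (h₂ : 0 ≤ b₂) (h₃ : 0 ≤ b₃)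
    (h₄ : 0 ≤ b₄) (hB : b₁ + b₂ + b₃ + b₄ ≤ 1)
    (hh : 9 * h = 5 * (b₁ + b₂ + b₃ + b₄) - 2 * (b₁ + b₂ + b₃ + b₄) ^ 2
      + (b₁ + b₂) * (b₃ + b₄))
    (hδ : δ = b₁ / (1 + b₁) + b₂ / (1 + b₂) + b₃ / (1 + b₃) + b₄ / (1 + b₄)) :
    h * (1 + δ) ≤ δ := by
  have sub : ∀ {x y : ℝ}, 0 ≤ x → 0 ≤ y → (x + y) / (1 + (x + y)) ≤ x / (1 + x) + y / (1 + y) := by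
    intro x y hx hy
    rw [add_div]
    exact add_le_add (div_le_div_of_nonneg_left hx (by linarith) (by linarith))
      (div_le_div_of_nonneg_left hy (by linarith) (by linarith))
  have hβγ := add_le_add (sub h₁ h₂) (sub h₃ h₄)
  have hβ : 0 ≤ b₁ + b₂ := by linarith
  have hγ : 0 ≤ b₃ + b₄ := by linarith
  have hle : (b₁ + b₂) + (b₃ + b₄) ≤ 1 := by linarith
  have hh' : 9 * h = 5 * ((b₁ + b₂) + (b₃ + b₄)) - 2 * ((b₁ + b₂) + (b₃ + b₄)) ^ 2
      + (b₁ + b₂) * (b₃ + b₄) := by rw [hh]; ring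
  have hδ' : (b₁ + b₂) / (1 + (b₁ + b₂)) + (b₃ + b₄) / (1 + (b₃ + b₄)) ≤ δ := by linarith
  clear hh hδ hβγ hB
  generalize b₁ + b₂ = β at *
  generalize b₃ + b₄ = γ at *
  have hπ : 0 ≤ β * γ := mul_nonneg hβ hγ
  have hπ1 : 4 * (β * γ) ≤ (β + γ) ^ 2 := by linarith [sq_nonneg (β - γ)]
  have hs2 : (β + γ) ^ 2 ≤ 1 := by
    have := mul_nonneg (sub_nonneg.2 hle) (add_nonneg zero_le_one (add_nonneg hβ hγ))
    linarith
  have hD : 0 < (1 + β) * (1 + γ) := by positivity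
  have key : β + γ + 2 * (β * γ) ≤ δ * ((1 + β) * (1 + γ)) := by
    have := mul_le_mul_of_nonneg_right hδ' hD.le
    have e : (β / (1 + β) + γ / (1 + γ)) * ((1 + β) * (1 + γ)) = β + γ + 2 * (β * γ) := by
      field_simp; ring
    linarith
  have hh1 : 0 ≤ 1 - h := by linarith [sq_nonneg (β + γ)]
  have k1 := mul_le_mul_of_nonneg_right key hh1
  have k2 : 0 ≤ 4 * ((β + γ) * (1 - (β + γ)) ^ 2) +
      β * γ * (17 * (1 - (β + γ)) + 6 * (β + γ) ^ 2 - 3 * (β * γ)) := by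
    have : 0 ≤ 17 * (1 - (β + γ)) + 6 * (β + γ) ^ 2 - 3 * (β * γ) := by linarith
    positivity
  have k3 : h * ((1 + β) * (1 + γ)) ≤ (β + γ + 2 * (β * γ)) * (1 - h) := by
    have : h = (5 * (β + γ) - 2 * (β + γ) ^ 2 + β * γ) / 9 := by linarith
    subst this
    linarith
  have k4 : (h * (1 + δ) - δ) * ((1 + β) * (1 + γ)) ≤ 0 := by linarith
  have := nonpos_of_mul_nonpos_left k4 hD
  linarith

lemma one_lt_of_split {X Y d₁ d₂ d₃ d₄ m s t : ℝ} (hd₁ : 0 < d₁) (hd₂ : 0 < d₂) (hd₃ : 0 < d₃)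
    (hd₄ : 0 < d₄) (hm : d₂ * d₃ < m ^ 2) (hm0 : 0 ≤ m) (hs : 0 < s) (ht : 0 < t)
    (h₁ : d₁ * (m * t) < (X ^ 2 - d₁ * d₂) * s) (h₂ : d₄ * (m * s) < (Y ^ 2 - d₃ * d₄) * t) :
    1 < X ^ 2 / (d₁ * d₂) ∧ 1 < Y ^ 2 / (d₃ * d₄) ∧
      1 < (X ^ 2 / (d₁ * d₂) - 1) * (Y ^ 2 / (d₃ * d₄) - 1) := by
  have hX : 0 < X ^ 2 - d₁ * d₂ :=
    pos_of_mul_pos_left (lt_of_le_of_lt (by positivity) h₁) hs.le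
  have hY : 0 < Y ^ 2 - d₃ * d₄ :=
    pos_of_mul_pos_left (lt_of_le_of_lt (by positivity) h₂) ht.le
  refine ⟨by rw [one_lt_div (by positivity)]; linarith,
    by rw [one_lt_div (by positivity)]; linarith, ?_⟩
  have e : (X ^ 2 / (d₁ * d₂) - 1) * (Y ^ 2 / (d₃ * d₄) - 1) =
      (X ^ 2 - d₁ * d₂) * (Y ^ 2 - d₃ * d₄) / (d₁ * d₂ * (d₃ * d₄)) := by
    field_simp
  rw [e, one_lt_div (by positivity)]
  have h₃ := mul_lt_mul'' h₁ h₂ (by positivity) (by positivity)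
  have h₄ : d₁ * d₄ * (d₂ * d₃) < d₁ * d₄ * m ^ 2 := by gcongr
  have h₅ : d₁ * d₄ * m ^ 2 * (s * t) < (X ^ 2 - d₁ * d₂) * (Y ^ 2 - d₃ * d₄) * (s * t) := by
    linarith
  have h₆ := lt_of_mul_lt_mul_right h₅ (by positivity)
  linarith

lemma sum_mul_le_of_form {A : Matrix (Fin 5) (Fin 5) ℝ} (hA : A.IsSymm) (h0 : ∀ i j, 0 ≤ A i j)
    (hf : ∀ x, x ⬝ᵥ A *ᵥ x ≤ 2 * (x ⬝ᵥ x)) {w : Fin 5 → ℝ} (hw0 : 0 ≤ w 0)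
    (hw : ∀ i, i ≠ 0 → 0 < w i)
    (hw2 : ∀ i, w i ^ 2 = 1 - A i i) (h01 : w 0 * w 1 ≤ A 0 1) (h04 : w 0 * w 4 ≤ A 0 4)
    (h23 : w 2 * w 3 ≤ A 2 3) {h : ℝ} (hh : h * (1 + w 0 ^ 2) ≤ w 0 ^ 2) {y₁ y₂ y₃ y₄ : ℝ}
    (hy₁ : 0 ≤ y₁) (hy₂ : 0 ≤ y₂) (hy₃ : 0 ≤ y₃) (hy₄ : 0 ≤ y₄) :
    2 * (A 1 2 / (w 1 * w 2)) * (y₁ * y₂) + 2 * (y₂ * y₃) + 2 * (A 3 4 / (w 3 * w 4)) * (y₃ * y₄) +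
        h * (y₁ + y₄) ^ 2 ≤
      (1 + 1 / w 1 ^ 2) * y₁ ^ 2 + (1 + 1 / w 2 ^ 2) * y₂ ^ 2 + (1 + 1 / w 3 ^ 2) * y₃ ^ 2 +
        (1 + 1 / w 4 ^ 2) * y₄ ^ 2 := by
  have hw1 := hw 1 (by decide)
  have hw2' := hw 2 (by decide)
  have hw3 := hw 3 (by decide)
  have hw4 := hw 4 (by decide)
  have hc : 0 < 1 + w 0 ^ 2 := by positivity
  have key := hf ![w 0 * (y₁ + y₄) / (1 + w 0 ^ 2), y₁ / w 1, y₂ / w 2, y₃ / w 3, y₄ / w 4]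
  rw [IsCandidate.form_eq hA, IsCandidate.dot_self_eq] at key
  simp only [Matrix.cons_val] at key
  have ha : ∀ i, A i i = 1 - w i ^ 2 := fun i => by rw [hw2]; ring
  rw [ha 0, ha 1, ha 2, ha 3, ha 4] at key
  have hz : 0 ≤ w 0 * (y₁ + y₄) / (1 + w 0 ^ 2) := by positivity
  have e0 : (1 + w 0 ^ 2) * (w 0 * (y₁ + y₄) / (1 + w 0 ^ 2)) = w 0 * (y₁ + y₄) := by field_simp
  generalize w 0 * (y₁ + y₄) / (1 + w 0 ^ 2) = c at key hz e0
  have b1 : 0 ≤ y₁ / w 1 := by positivity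
  have b2 : 0 ≤ y₂ / w 2 := by positivity
  have b3 : 0 ≤ y₃ / w 3 := by positivity
  have b4 : 0 ≤ y₄ / w 4 := by positivity
  have e1 : y₁ = w 1 * (y₁ / w 1) := by field_simp
  have e2 : y₂ = w 2 * (y₂ / w 2) := by field_simp
  have e3 : y₃ = w 3 * (y₃ / w 3) := by field_simp
  have e4 : y₄ = w 4 * (y₄ / w 4) := by field_simp
  have s : ∀ i, i ≠ 0 → ∀ z, (1 + 1 / w i ^ 2) * (w i * z) ^ 2 = (1 + w i ^ 2) * z ^ 2 := by
    intro i hi z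
    have := hw i hi
    field_simp
    ring
  generalize y₁ / w 1 = z₁ at *
  generalize y₂ / w 2 = z₂ at *
  generalize y₃ / w 3 = z₃ at *
  generalize y₄ / w 4 = z₄ at *
  subst e1 e2 e3 e4
  rw [s 1 (by decide), s 2 (by decide), s 3 (by decide), s 4 (by decide)]
  have p1 : 2 * (A 1 2 / (w 1 * w 2)) * (w 1 * z₁ * (w 2 * z₂)) = 2 * A 1 2 * (z₁ * z₂) := by
    field_simp
  have p2 : 2 * (A 3 4 / (w 3 * w 4)) * (w 3 * z₃ * (w 4 * z₄)) = 2 * A 3 4 * (z₃ * z₄) := by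
    field_simp
  rw [p1, p2]
  have q1 := mul_le_mul_of_nonneg_right h01 (mul_nonneg hz b1)
  have q2 := mul_le_mul_of_nonneg_right h04 (mul_nonneg hz b4)
  have q3 := mul_le_mul_of_nonneg_right h23 (mul_nonneg b2 b3)
  have r1 := mul_nonneg (h0 0 2) (mul_nonneg hz b2)
  have r2 := mul_nonneg (h0 0 3) (mul_nonneg hz b3)
  have r3 := mul_nonneg (h0 1 3) (mul_nonneg b1 b3)
  have r4 := mul_nonneg (h0 1 4) (mul_nonneg b1 b4)
  have r5 := mul_nonneg (h0 2 4) (mul_nonneg b2 b4)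
  have hS : h * (w 1 * z₁ + w 4 * z₄) ^ 2 ≤ c * (w 0 * (w 1 * z₁ + w 4 * z₄)) := by
    have t1 : c * (w 0 * (w 1 * z₁ + w 4 * z₄)) * (1 + w 0 ^ 2) =
        w 0 ^ 2 * (w 1 * z₁ + w 4 * z₄) ^ 2 := by
      linear_combination (w 0 * (w 1 * z₁ + w 4 * z₄)) * e0
    have t2 := mul_le_mul_of_nonneg_right hh (sq_nonneg (w 1 * z₁ + w 4 * z₄))
    refine le_of_mul_le_mul_right ?_ hc
    linarith
  have e0' : (1 + w 0 ^ 2) * c ^ 2 = c * (w 0 * (w 1 * z₁ + w 4 * z₄)) := by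
    linear_combination c * e0
  linarith

namespace IsCandidate

variable {A : Matrix (Fin 5) (Fin 5) ℝ}

lemma sq_div_sub_one (h0 : ∀ i j, 0 ≤ A i j)
    (hd : ∀ i, i ≠ 0 → 0 < 1 - A i i) (hs : IsSplit A 1 2 3 4)
    (h23 : IsStrong A 2 3) :
    1 < A 1 2 ^ 2 / ((1 - A 1 1) * (1 - A 2 2)) ∧ 1 < A 3 4 ^ 2 / ((1 - A 3 3) * (1 - A 4 4)) ∧
      1 < (A 1 2 ^ 2 / ((1 - A 1 1) * (1 - A 2 2)) - 1) *
        (A 3 4 ^ 2 / ((1 - A 3 3) * (1 - A 4 4)) - 1) := by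
  have hd1 := hd 1 (by decide)
  have hd2 := hd 2 (by decide)
  have hd3 := hd 3 (by decide)
  have hd4 := hd 4 (by decide)
  obtain ⟨p, p', q, q', hp, hp', hq, hq', h₁, h₂⟩ := hs
  have r1 := mul_nonneg (mul_nonneg (h0 1 3) hp.le) hq.le
  have r2 := mul_nonneg (mul_nonneg (h0 1 4) hp.le) hq'.le
  have r3 := mul_nonneg (mul_nonneg (h0 2 4) hp'.le) hq'.le
  have k₁ : A 2 3 * p' * q <
      2 * A 1 2 * p * p' - (1 - A 1 1) * p ^ 2 - (1 - A 2 2) * p' ^ 2 := by linarith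
  have k₂ : A 2 3 * p' * q <
      2 * A 3 4 * q * q' - (1 - A 3 3) * q ^ 2 - (1 - A 4 4) * q' ^ 2 := by linarith
  refine one_lt_of_split hd1 hd2 hd3 hd4 h23 (h0 2 3) hp' hq ?_ ?_
  · refine lt_of_mul_lt_mul_right ?_ hp'.le
    have := mul_lt_mul_of_pos_left k₁ hd1
    linarith [sq_nonneg ((1 - A 1 1) * p - A 1 2 * p')]
  · refine lt_of_mul_lt_mul_right ?_ hq.le
    have := mul_lt_mul_of_pos_left k₂ hd4
    linarith [sq_nonneg ((1 - A 4 4) * q' - A 3 4 * q)]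

lemma not_isStrong_of_cycle (h : IsCandidate A) (hmax : ∀ i, A i i ≤ A 0 0)
    (hs : IsSplit A 1 2 3 4) (h01 : IsStrong A 0 1) (h23 : IsStrong A 2 3) :
    ¬ IsStrong A 0 4 := by
  intro h04
  have hd : ∀ i : Fin 5, i ≠ 0 → 0 < 1 - A i i := fun i hi => by linarith [h.half_le hmax hi]
  obtain ⟨hP, hR, hPR⟩ := sq_div_sub_one h.2.1 hd hs h23
  set w : Fin 5 → ℝ := fun i => √(1 - A i i) with hw
  have hw2 : ∀ i, w i ^ 2 = 1 - A i i := fun i => Real.sq_sqrt (h.diag_le_one i)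
  have hw0 : ∀ i, i ≠ 0 → 0 < w i := fun i hi => Real.sqrt_pos.2 (hd i hi)
  have hstrong : ∀ i j, IsStrong A i j → w i * w j ≤ A i j := fun i j hij => by
    refine le_of_sq_le_sq ?_ (h.2.1 i j)
    rw [mul_pow, hw2, hw2]
    exact hij.le
  have hb : ∀ i, i ≠ 0 → 1 / w i ^ 2 = 1 + A i i / (1 - A i i) := fun i hi => by
    rw [hw2]; have := hd i hi; field_simp; ring
  have hb0 : ∀ i, 0 ≤ A i i / (1 - A i i) := fun i => div_nonneg (h.2.1 i i) (h.diag_le_one i)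
  have hba : ∀ i, i ≠ 0 → A i i / (1 - A i i) / (1 + A i i / (1 - A i i)) = A i i := fun i hi => by
    have := hd i hi; field_simp; ring
  have htr := h.trace_eq
  have hB : A 1 1 / (1 - A 1 1) + A 2 2 / (1 - A 2 2) + A 3 3 / (1 - A 3 3) + A 4 4 / (1 - A 4 4)
      ≤ 1 := by
    rcases eq_or_lt_of_le (h.diag_le_one 0) with h00 | h00
    · have := h.2.1 1 1
      have := h.2.1 2 2
      have := h.2.1 3 3
      have := h.2.1 4 4
      rw [show A 1 1 = 0 by linarith, show A 2 2 = 0 by linarith, show A 3 3 = 0 by linarith,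
        show A 4 4 = 0 by linarith]
      norm_num
    · have hle : ∀ i, A i i / (1 - A i i) ≤ A i i / (1 - A 0 0) := fun i =>
        div_le_div_of_nonneg_left (h.2.1 i i) h00 (by linarith [hmax i])
      calc _ ≤ A 1 1 / (1 - A 0 0) + A 2 2 / (1 - A 0 0) + A 3 3 / (1 - A 0 0) +
            A 4 4 / (1 - A 0 0) := by linarith [hle 1, hle 2, hle 3, hle 4]
        _ = 1 := by
          rw [← add_div, ← add_div, ← add_div, div_eq_one_iff_eq h00.ne']
          linarith
  have hwt := fun b => nine_mul_cycle_weight_le (h := b) (δ := w 0 ^ 2) (hb0 1) (hb0 2) (hb0 3)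
    (hb0 4) hB
  rw [hba 1 (by decide), hba 2 (by decide), hba 3 (by decide), hba 4 (by decide)] at hwt
  obtain ⟨k, hk⟩ : ∃ k : ℝ, 9 * k = 5 * (A 1 1 / (1 - A 1 1) + A 2 2 / (1 - A 2 2) +
      A 3 3 / (1 - A 3 3) + A 4 4 / (1 - A 4 4)) - 2 * (A 1 1 / (1 - A 1 1) + A 2 2 / (1 - A 2 2) +
      A 3 3 / (1 - A 3 3) + A 4 4 / (1 - A 4 4)) ^ 2 + (A 1 1 / (1 - A 1 1) + A 2 2 / (1 - A 2 2)) *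
      (A 3 3 / (1 - A 3 3) + A 4 4 / (1 - A 4 4)) := ⟨_, mul_div_cancel₀ _ (by norm_num)⟩
  replace hwt := hwt k hk (by rw [hw2]; linarith)
  have hk0 : 0 ≤ k := by
    have hB0 := add_nonneg (add_nonneg (add_nonneg (hb0 1) (hb0 2)) (hb0 3)) (hb0 4)
    have := mul_nonneg hB0 (sub_nonneg.2 hB)
    have := mul_nonneg (add_nonneg (hb0 1) (hb0 2)) (add_nonneg (hb0 3) (hb0 4))
    linarith
  have hsq : ∀ i j, (A i j / (w i * w j)) ^ 2 = A i j ^ 2 / ((1 - A i i) * (1 - A j j)) :=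
    fun i j => by rw [div_pow, mul_pow, hw2, hw2]
  have hp0 : ∀ i j, 0 ≤ A i j / (w i * w j) := fun i j =>
    div_nonneg (h.2.1 i j) (mul_nonneg (Real.sqrt_nonneg _) (Real.sqrt_nonneg _))
  rw [← hsq, ← hsq] at hPR
  rw [← hsq] at hP hR
  refine not_cycle_form_nonneg (hb0 1) (hb0 2) (hb0 3) (hb0 4) hB hk (hp0 1 2) (hp0 3 4) hP hR hPR
    fun x₁ x₂ x₃ x₄ => ?_
  have key := sum_mul_le_of_form h.1 h.2.1 h.2.2.2.1 (Real.sqrt_nonneg _) hw0 hw2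
    (hstrong _ _ h01) (hstrong _ _ h04) (hstrong _ _ h23) hwt (abs_nonneg x₁) (abs_nonneg x₂)
    (abs_nonneg x₃) (abs_nonneg x₄)
  rw [hb 1 (by decide), hb 2 (by decide), hb 3 (by decide), hb 4 (by decide)] at key
  have m : ∀ x y : ℝ, x * y ≤ |x| * |y| := fun x y => by rw [← abs_mul]; exact le_abs_self _
  have m1 := mul_le_mul_of_nonneg_left (m x₁ x₂) (hp0 1 2)
  have m2 := m x₂ x₃
  have m3 := mul_le_mul_of_nonneg_left (m x₃ x₄) (hp0 3 4)
  have m4 := mul_le_mul_of_nonneg_left (m x₁ x₄) hk0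
  rw [add_sq, sq_abs, sq_abs, sq_abs, sq_abs] at key
  linarith

lemma not_isSplit (h : IsCandidate A) (hmax : ∀ i, A i i ≤ A 0 0) : ¬ IsSplit A 1 2 3 4 := by
  intro hs
  have hperm : ∀ b c d e : Fin 5, Function.Bijective ![0, b, c, d, e] →
      IsSplit A b c d e → IsStrong A 0 b → IsStrong A c d → IsStrong A 0 e → False :=
    fun b c d e hσ hs' h₁ h₂ h₃ => by
      refine (h.of_bijective hσ).not_isStrong_of_cycle (fun i => hmax _) hs' ?_ ?_ ?_
      exacts [h₁, h₂, h₃]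
  rcases h.exists_isStrong_cycle hs with ⟨h₁, h₂⟩ | ⟨h₁, h₂⟩ | ⟨h₁, h₂, h₃⟩ | ⟨h₁, h₂, h₃⟩ |
    ⟨h₁, h₂, h₃⟩ | ⟨h₁, h₂, h₃⟩
  · exact h.not_isStrong_of_isSplit hmax hs h₁ h₂
  · exact (h.of_bijective (a := 0) (b := 1) (c := 2) (d := 4) (e := 3)
      (by decide)).not_isStrong_of_isSplit (fun i => hmax _) (hs.swap_right h.1) h₁ h₂
  · exact hperm 1 2 3 4 (by decide) hs h₁ h₂ h₃
  · exact hperm 2 1 3 4 (by decide) (hs.swap_left h.1) h₁ h₂ h₃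
  · exact hperm 1 2 4 3 (by decide) (hs.swap_right h.1) h₁ h₂ h₃
  · exact hperm 2 1 4 3 (by decide) ((hs.swap_left h.1).swap_right h.1) h₁ h₂ h₃

end IsCandidate

lemma not_isCandidate (A : Matrix (Fin 5) (Fin 5) ℝ) : ¬ IsCandidate A := by
  intro hA
  obtain ⟨k, hk⟩ := Finite.exists_max fun i => A i i
  have h := hA.submatrix (Equiv.swap 0 k)
  have hmax : ∀ i, A.submatrix (Equiv.swap 0 k) (Equiv.swap 0 k) i i ≤
      A.submatrix (Equiv.swap 0 k) (Equiv.swap 0 k) 0 0 := fun i => by simpa using hk _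
  generalize A.submatrix (Equiv.swap 0 k) (Equiv.swap 0 k) = B at h hmax
  rcases h.exists_isSplit with hs | hs | hs
  · exact h.not_isSplit hmax hs
  · exact (h.of_bijective (a := 0) (b := 1) (c := 3) (d := 2) (e := 4) (by decide)).not_isSplit
      (fun i => hmax _) hs
  · exact (h.of_bijective (a := 0) (b := 1) (c := 4) (d := 2) (e := 3) (by decide)).not_isSplit
      (fun i => hmax _) hs

lemma exists_ne_zero_two_eqs (a b : Fin 3 → ℝ) :
    ∃ c : Fin 3 → ℝ, c ≠ 0 ∧ a ⬝ᵥ c = 0 ∧ b ⬝ᵥ c = 0 := by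
  obtain ⟨c, hc, h⟩ := (Matrix.exists_mulVec_eq_zero_iff (M := ![a, b, 0])).2
    (Matrix.det_eq_zero_of_row_eq_zero 2 fun j => rfl)
  exact ⟨c, hc, congrFun h 0, congrFun h 1⟩

lemma conditions_of_exists {l : Fin 5 → ℝ} (hl : Antitone l) (hsum : 1 / 2 * l 0 ≤ ∑ i, l i)
    {A : Matrix (Fin 5) (Fin 5) ℝ} (hA : A.IsSymm) (h0 : ∀ i j, 0 ≤ A i j)
    (hr : A.charpoly.roots = Finset.univ.val.map l) :
    (∀ i, |l i| ≤ l 0) ∧ l 1 + l 4 ≤ ∑ i, l i ∧ l 2 ≤ ∑ i, l i := by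
  obtain ⟨μ, v', hv', hAv', hx', hf', hμ, htr⟩ := exists_orthonormal_eigenvectors hA
  obtain ⟨σ, hσ⟩ := exists_perm_of_map_univ_eq (hμ.symm.trans hr)
  obtain rfl : l = μ ∘ σ := hσ.symm
  set v := v' ∘ σ with hvdef
  set l := μ ∘ σ with hldef
  have hv : ∀ i j, v i ⬝ᵥ v j = if i = j then 1 else 0 := fun i j => by
    simp [hvdef, hv', σ.injective.eq_iff]
  have hAv : ∀ i, A *ᵥ v i = l i • v i := fun i => hAv' _
  have hx : ∀ x, x ⬝ᵥ x = ∑ i, (v i ⬝ᵥ x) ^ 2 := fun x => by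
    rw [hx']; exact (Equiv.sum_comp σ fun i => (v' i ⬝ᵥ x) ^ 2).symm
  have hf : ∀ x, x ⬝ᵥ A *ᵥ x = ∑ i, l i * (v i ⬝ᵥ x) ^ 2 := fun x => by
    rw [hf']; exact (Equiv.sum_comp σ fun i => μ i * (v' i ⬝ᵥ x) ^ 2).symm
  have htr : A.trace = ∑ i, l i := htr.trans (Equiv.sum_comp σ μ).symm
  clear_value v l
  clear hv' hAv' hx' hf' hμ hr
  have hne : ∀ i, v i ≠ 0 := fun i h => by simpa [h] using hv i i
  have hle : ∀ x, x ⬝ᵥ A *ᵥ x ≤ l 0 * (x ⬝ᵥ x) := fun x => by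
    rw [hf, hx, Finset.mul_sum]
    exact Finset.sum_le_sum fun i _ => mul_le_mul_of_nonneg_right (hl (Fin.zero_le i)) (sq_nonneg _)
  have hge : ∀ x, l 4 * (x ⬝ᵥ x) ≤ x ⬝ᵥ A *ᵥ x := fun x => by
    rw [hf, hx, Finset.mul_sum]
    exact Finset.sum_le_sum fun i _ => mul_le_mul_of_nonneg_right (hl (Fin.le_last i)) (sq_nonneg _)
  have habs : ∀ i, |l i| ≤ l 0 := fun i => by
    have h₁ : |v i ⬝ᵥ A *ᵥ v i| ≤ (fun j => |v i j|) ⬝ᵥ A *ᵥ fun j => |v i j| := by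
      simp only [dotProduct, mulVec]
      refine (Finset.abs_sum_le_sum_abs _ _).trans (Finset.sum_le_sum fun j _ => ?_)
      rw [abs_mul]
      refine mul_le_mul_of_nonneg_left ((Finset.abs_sum_le_sum_abs _ _).trans
        (Finset.sum_le_sum fun k _ => ?_)) (abs_nonneg _)
      rw [abs_mul, abs_of_nonneg (h0 j k)]
    have h₂ : (fun j => |v i j|) ⬝ᵥ (fun j => |v i j|) = v i ⬝ᵥ v i := by
      simp [dotProduct]
    have h₃ := h₁.trans (hle _)
    rwa [h₂, hAv, dotProduct_smul, hv, if_pos rfl, smul_eq_mul, mul_one, mul_one] at h₃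
  refine ⟨habs, ?_, ?_⟩
  · rw [← htr]
    exact add_le_trace_of_eigenvectors hA h0 (hne 0) (hne 1) (by simp [hv]) (hAv 0) (hAv 1)
      (hl (by decide)) le_rfl hge
  · by_contra! hlt
    have hl0 : 0 ≤ l 0 := (abs_nonneg _).trans (habs 0)
    have ht : 0 < ∑ i, l i := by
      have := hl (show (0 : Fin 5) ≤ 2 by decide)
      rcases hl0.eq_or_lt with h | h <;> linarith
    refine not_isCandidate ((∑ i, l i)⁻¹ • A) ⟨?_, fun i j => ?_, ?_, fun x => ?_, fun f g => ?_⟩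
    · exact hA.smul _
    · exact mul_nonneg (inv_nonneg.2 ht.le) (h0 i j)
    · rw [trace_smul, htr, smul_eq_mul, inv_mul_cancel₀ ht.ne']
    · rw [smul_mulVec, dotProduct_smul, smul_eq_mul, inv_mul_le_iff₀ ht]
      have := hle x
      have hxx : 0 ≤ x ⬝ᵥ x := by rw [hx]; positivity
      have := mul_le_mul_of_nonneg_right hsum hxx
      linarith
    · obtain ⟨c, hc, hcf, hcg⟩ := exists_ne_zero_two_eqs
        ![f ⬝ᵥ v 0, f ⬝ᵥ v 1, f ⬝ᵥ v 2] ![g ⬝ᵥ v 0, g ⬝ᵥ v 1, g ⬝ᵥ v 2]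
      simp only [dotProduct, Fin.sum_univ_three] at hcf hcg
      simp only [Matrix.cons_val] at hcf hcg
      set x := c 0 • v 0 + c 1 • v 1 + c 2 • v 2 with hxdef
      have hvx : ∀ i, v i ⬝ᵥ x = c 0 * (if i = 0 then 1 else 0) + c 1 * (if i = 1 then 1 else 0) +
          c 2 * (if i = 2 then 1 else 0) := fun i => by
        simp only [hxdef, dotProduct_add, dotProduct_smul, hv, smul_eq_mul]
      have hxx : x ⬝ᵥ x = c 0 ^ 2 + c 1 ^ 2 + c 2 ^ 2 := by
        rw [hx]; simp [hvx, Fin.sum_univ_five]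
      have hxA : x ⬝ᵥ A *ᵥ x = l 0 * c 0 ^ 2 + l 1 * c 1 ^ 2 + l 2 * c 2 ^ 2 := by
        rw [hf]; simp [hvx, Fin.sum_univ_five]
      have hpos : 0 < c 0 ^ 2 + c 1 ^ 2 + c 2 ^ 2 := by
        refine lt_of_le_of_ne (by positivity) fun h => hc ?_
        rw [← dotProduct_self_eq_zero, dotProduct, Fin.sum_univ_three]
        linarith
      refine ⟨x, ?_, ?_, ?_⟩
      · simp only [hxdef, dotProduct_add, dotProduct_smul, smul_eq_mul]
        simp only [dotProduct]; linarith
      · simp only [hxdef, dotProduct_add, dotProduct_smul, smul_eq_mul]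
        simp only [dotProduct]; linarith
      · rw [smul_mulVec, dotProduct_smul, smul_eq_mul, lt_inv_mul_iff₀ ht, hxx, hxA]
        have h₀ := mul_le_mul_of_nonneg_right (hl (show (0 : Fin 5) ≤ 2 by decide)) (sq_nonneg (c 0))
        have h₁ := mul_le_mul_of_nonneg_right (hl (show (1 : Fin 5) ≤ 2 by decide)) (sq_nonneg (c 1))
        have h₂ := mul_lt_mul_of_pos_right hlt hpos
        linarith

lemma exists_isSymm_of_cubic {T f g f' g' s k j a b c : ℝ} (hT : 0 ≤ T) (hf : 0 ≤ f) (hg : 0 ≤ g)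
    (hf' : 0 ≤ f') (hg' : 0 ≤ g') (hs : 0 ≤ s) (hk : 0 ≤ k) (hj : 0 ≤ j)
    (h₁ : T + (f + g) + (f' + g') = a + b + c)
    (h₂ : T * (f + g) + T * (f' + g') + (f + g) * (f' + g') - 2 * s ^ 2 - 2 * k ^ 2 - 4 * j ^ 2 =
      a * b + a * c + b * c)
    (h₃ : T * (f + g) * (f' + g') + 8 * s * k * j - 4 * j ^ 2 * T - 2 * k ^ 2 * (f + g) -
      2 * s ^ 2 * (f' + g') = a * b * c) :
    ∃ A : Matrix (Fin 5) (Fin 5) ℝ, A.IsSymm ∧ (∀ i j, 0 ≤ A i j) ∧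
      A.charpoly.roots = {f - g, f' - g', a, b, c} := by
  refine ⟨!![T, s, s, k, k; s, f, g, j, j; s, g, f, j, j; k, j, j, f', g'; k, j, j, g', f'],
    ?_, ?_, ?_⟩
  · ext i j
    fin_cases i <;> fin_cases j <;> rfl
  · intro i j
    fin_cases i <;> fin_cases j <;> assumption
  · rw [← Polynomial.roots_multiset_prod_X_sub_C {f - g, f' - g', a, b, c}]
    congr 1
    refine Polynomial.funext fun x => ?_
    rw [Matrix.eval_charpoly]
    simp [Matrix.det_succ_row_zero, Fin.sum_univ_succ, Fin.succAbove, Matrix.submatrix]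
    linear_combination (-(x - (f - g)) * (x - (f' - g')) * x ^ 2) * h₁ +
      ((x - (f - g)) * (x - (f' - g')) * x) * h₂ - ((x - (f - g)) * (x - (f' - g'))) * h₃

section Realization

variable {l₁ l₂ l₃ l₄ l₅ : ℝ}

lemma exists_of_nonneg_of_add_nonneg (h24 : l₄ ≤ l₂) (h15 : l₅ ≤ l₁) (h3 : 0 ≤ l₃)
    (hs15 : 0 ≤ l₁ + l₅) (hs24 : 0 ≤ l₂ + l₄) :
    ∃ A : Matrix (Fin 5) (Fin 5) ℝ, A.IsSymm ∧ (∀ i j, 0 ≤ A i j) ∧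
      A.charpoly.roots = {l₁, l₂, l₃, l₄, l₅} := by
  obtain ⟨A, hA, h0, hr⟩ := exists_isSymm_of_cubic (T := l₃) (f := (l₁ + l₅) / 2)
    (g := (l₁ - l₅) / 2) (f' := (l₂ + l₄) / 2) (g' := (l₂ - l₄) / 2) (s := 0) (k := 0) (j := 0)
    (a := l₁) (b := l₂) (c := l₃) h3 (by linarith) (by linarith) (by linarith) (by linarith)
    le_rfl le_rfl le_rfl (by ring) (by ring) (by ring)
  refine ⟨A, hA, h0, hr.trans ?_⟩
  ring_nf
  ext x
  simp only [Multiset.insert_eq_cons, Multiset.count_cons, Multiset.count_singleton]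
  ring

lemma exists_of_nonneg_of_add_neg (h23 : l₃ ≤ l₂) (h45 : l₅ ≤ l₄) (h3 : 0 ≤ l₃)
    (hs24 : l₂ + l₄ < 0) (ht : 0 ≤ l₁ + l₂ + l₄ + l₅) :
    ∃ A : Matrix (Fin 5) (Fin 5) ℝ, A.IsSymm ∧ (∀ i j, 0 ≤ A i j) ∧
      A.charpoly.roots = {l₁, l₂, l₃, l₄, l₅} := by
  have hj : √(-((l₁ + l₄) * (l₂ + l₄))) ^ 2 = -((l₁ + l₄) * (l₂ + l₄)) :=
    Real.sq_sqrt (neg_nonneg.2 (mul_nonpos_of_nonneg_of_nonpos (by linarith) hs24.le))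
  obtain ⟨A, hA, h0, hr⟩ := exists_isSymm_of_cubic (T := l₃) (f := 0) (g := -l₄)
    (f' := (l₁ + l₂ + l₄ + l₅) / 2) (g' := (l₁ + l₂ + l₄ - l₅) / 2) (s := 0) (k := 0)
    (j := √(-((l₁ + l₄) * (l₂ + l₄))) / 2)
    (a := l₁) (b := l₂) (c := l₃) h3 le_rfl (by linarith) (by linarith) (by linarith)
    le_rfl le_rfl (by positivity) (by ring) (by linear_combination -hj)
    (by linear_combination -l₃ * hj)
  refine ⟨A, hA, h0, hr.trans ?_⟩
  ring_nf
  ext x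
  simp only [Multiset.insert_eq_cons, Multiset.count_cons, Multiset.count_singleton]
  ring

lemma exists_of_neg_of_add_nonneg (h25 : l₅ ≤ l₂) (h34 : l₄ ≤ l₃) (h3 : l₃ < 0)
    (h1 : 0 ≤ l₁) (hs25 : 0 ≤ l₂ + l₅) (ht : 0 ≤ l₁ + l₃ + l₄) :
    ∃ A : Matrix (Fin 5) (Fin 5) ℝ, A.IsSymm ∧ (∀ i j, 0 ≤ A i j) ∧
      A.charpoly.roots = {l₁, l₂, l₃, l₄, l₅} := by
  have hs : √((-(l₁ + l₃ + l₄) * l₄ - l₁ * l₃) / 2) ^ 2 =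
      (-(l₁ + l₃ + l₄) * l₄ - l₁ * l₃) / 2 := Real.sq_sqrt (by
    have := mul_nonneg ht (show 0 ≤ -l₄ by linarith)
    have := mul_nonneg h1 (neg_nonneg.2 h3.le)
    linarith)
  obtain ⟨A, hA, h0, hr⟩ := exists_isSymm_of_cubic (T := l₁ + l₃ + l₄) (f := 0) (g := -l₄)
    (f' := (l₂ + l₅) / 2) (g' := (l₂ - l₅) / 2) (k := 0) (j := 0)
    (s := √((-(l₁ + l₃ + l₄) * l₄ - l₁ * l₃) / 2))
    (a := l₁) (b := l₂) (c := l₃) ht le_rfl (by linarith) (by linarith) (by linarith)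
    (by positivity) le_rfl le_rfl (by ring) (by linear_combination -2 * hs)
    (by linear_combination -2 * l₂ * hs)
  refine ⟨A, hA, h0, hr.trans ?_⟩
  ring_nf
  ext x
  simp only [Multiset.insert_eq_cons, Multiset.count_cons, Multiset.count_singleton]
  ring

lemma exists_of_neg_of_add_neg (h34 : l₄ ≤ l₃) (h45 : l₅ ≤ l₄)
    (h3 : l₃ < 0) (hs15 : 0 ≤ l₁ + l₅) (hs25 : l₂ + l₅ < 0) (ht : 0 ≤ l₁ + l₂ + l₃ + l₄ + l₅) :
    ∃ A : Matrix (Fin 5) (Fin 5) ℝ, A.IsSymm ∧ (∀ i j, 0 ≤ A i j) ∧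
      A.charpoly.roots = {l₁, l₂, l₃, l₄, l₅} := by
  have hD : 0 < l₁ + l₂ + l₅ - l₃ := by linarith
  have hr := Real.sq_sqrt (show (0 : ℝ) ≤ 1 / 2 by norm_num)
  have hc := Real.sq_sqrt (show 0 ≤ (l₁ + l₂ + l₄ + l₅) / (l₁ + l₂ + l₅ - l₃) from
    div_nonneg (by linarith) hD.le)
  have hd := Real.sq_sqrt (show 0 ≤ (-(l₃ + l₄)) / (l₁ + l₂ + l₅ - l₃) from
    div_nonneg (by linarith) hD.le)
  have hρ := Real.sq_sqrt (show 0 ≤ -((l₁ + l₅) * (l₂ + l₅)) from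
    neg_nonneg.2 (mul_nonpos_of_nonneg_of_nonpos hs15 hs25.le))
  have hr0 := Real.sqrt_nonneg (1 / 2)
  have hc0 := Real.sqrt_nonneg ((l₁ + l₂ + l₄ + l₅) / (l₁ + l₂ + l₅ - l₃))
  have hd0 := Real.sqrt_nonneg ((-(l₃ + l₄)) / (l₁ + l₂ + l₅ - l₃))
  have hρ0 := Real.sqrt_nonneg (-((l₁ + l₅) * (l₂ + l₅)))
  rw [eq_div_iff hD.ne'] at hc hd
  generalize √((l₁ + l₂ + l₄ + l₅) / (l₁ + l₂ + l₅ - l₃)) = c at *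
  generalize √((-(l₃ + l₄)) / (l₁ + l₂ + l₅ - l₃)) = d at *
  generalize √(-((l₁ + l₅) * (l₂ + l₅))) = ρ at *
  generalize √(1 / 2) = r at *
  have hcd : c ^ 2 + d ^ 2 = 1 := by
    refine mul_right_cancel₀ hD.ne' ?_
    linear_combination hc + hd
  have hs : 2 * ((l₁ + l₂ + l₅ - l₃) * c * d * r) ^ 2 =
      (l₁ + l₂ + l₄ + l₅) * (-(l₃ + l₄)) := by
    linear_combination 2 * ((l₁ + l₂ + l₅ - l₃) * c * d) ^ 2 * hr +
      d ^ 2 * (l₁ + l₂ + l₅ - l₃) * hc + (l₁ + l₂ + l₄ + l₅) * hd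
  have hk : 2 * (ρ * c * r) ^ 2 = ρ ^ 2 * c ^ 2 := by linear_combination 2 * ρ ^ 2 * c ^ 2 * hr
  have hskj : 8 * ((l₁ + l₂ + l₅ - l₃) * c * d * r) * (ρ * c * r) * (ρ * d / 2) =
      ρ ^ 2 * (c ^ 2 * (-(l₃ + l₄)) + d ^ 2 * (l₁ + l₂ + l₄ + l₅)) := by
    linear_combination 4 * (l₁ + l₂ + l₅ - l₃) * c ^ 2 * d ^ 2 * ρ ^ 2 * hr +
      ρ ^ 2 * c ^ 2 * hd + ρ ^ 2 * d ^ 2 * hc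
  have hs0 : 0 ≤ (l₁ + l₂ + l₅ - l₃) * c * d * r := by positivity
  obtain ⟨A, hA, h0, hr⟩ := exists_isSymm_of_cubic (T := l₁ + l₂ + l₃ + l₄ + l₅) (f := 0)
    (g := -l₄) (f' := 0) (g' := -l₅) (a := l₁) (b := l₂) (c := l₃) (j := ρ * d / 2) ht le_rfl
    (by linarith) le_rfl (by linarith) hs0 (show 0 ≤ ρ * c * r by positivity) (by positivity)
    (by ring) (by linear_combination -hs - hk - ρ ^ 2 * hcd - hρ)
    (by linear_combination hskj + l₄ * hk + l₅ * hs - l₃ * ρ ^ 2 * hcd - l₃ * hρ)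
  refine ⟨A, hA, h0, hr.trans ?_⟩
  ring_nf
  ext x
  simp only [Multiset.insert_eq_cons, Multiset.count_cons, Multiset.count_singleton]
  ring

end Realization

end

/-- Let `l1 ≥ l2 ≥ l3 ≥ l4 ≥ l5` be real numbers with
`l1 + l2 + l3 + l4 + l5 ≥ (1/2) * l1`. Then they are the eigenvalues (with
multiplicity) of a nonnegative symmetric 5×5 real matrix iff
(1) `l1 = max_i |l_i|`, (2) `l2 + l5 ≤ Σ l_i`, and (3) `l3 ≤ Σ l_i`. -/
theorem stmt_1 (l1 l2 l3 l4 l5 : ℝ)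
    (hord1 : l1 ≥ l2) (hord2 : l2 ≥ l3) (hord3 : l3 ≥ l4) (hord4 : l4 ≥ l5)
    (hsum : l1 + l2 + l3 + l4 + l5 ≥ (1 / 2) * l1) :
    (∃ A : Matrix (Fin 5) (Fin 5) ℝ, A.IsSymm ∧ (∀ i j, 0 ≤ A i j) ∧
        A.charpoly.roots = {l1, l2, l3, l4, l5}) ↔
      (l1 = max |l1| (max |l2| (max |l3| (max |l4| |l5|))) ∧
       l2 + l5 ≤ l1 + l2 + l3 + l4 + l5 ∧
       l3 ≤ l1 + l2 + l3 + l4 + l5) := by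
  have hroots : ({l1, l2, l3, l4, l5} : Multiset ℝ) =
      Finset.univ.val.map ![l1, l2, l3, l4, l5] := by
    rfl
  constructor
  · rintro ⟨A, hA, h0, hr⟩
    have hanti : Antitone ![l1, l2, l3, l4, l5] := by
      rw [Fin.antitone_iff_succ_le]
      intro i
      fin_cases i <;> assumption
    obtain ⟨habs, h₂, h₃⟩ := conditions_of_exists hanti
      (by simpa [Fin.sum_univ_five] using hsum) hA h0 (hr.trans hroots)
    rw [Fin.sum_univ_five] at h₂ h₃
    refine ⟨le_antisymm ((le_abs_self l1).trans (le_max_left _ _)) ?_, h₂, h₃⟩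
    simp only [max_le_iff]
    exact ⟨habs 0, habs 1, habs 2, habs 3, habs 4⟩
  · rintro ⟨hmax, h₂, h₃⟩
    have h15 : |l5| ≤ l1 := by
      rw [hmax]
      simp
    have h15' := (abs_le.1 h15).1
    have h1 : 0 ≤ l1 := (abs_nonneg _).trans h15
    rcases le_or_gt 0 l3 with h3 | h3
    · rcases le_or_gt 0 (l2 + l4) with h24 | h24
      · exact exists_of_nonneg_of_add_nonneg (by linarith) (by linarith) h3 (by linarith) h24
      · exact exists_of_nonneg_of_add_neg hord2 hord4 h3 h24 (by linarith)
    · rcases le_or_gt 0 (l2 + l5) with h25 | h25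
      · exact exists_of_neg_of_add_nonneg (by linarith) hord3 h3 h1 h25 (by linarith)
      · exact exists_of_neg_of_add_neg hord3 hord4 h3 (by linarith) h25 (by linarith)
end

section
/- The symmetric 5×5 matrix with rows (2/25, √130/25, √130/25, 0, 0), (√130/25, 0, 0, 0, 3√70/50), (√130/25, 0, 0, 3√70/50, 0), (0, 0, 3√70/50, 17/200, 91/200), (0, 3√70/50, 0, 91/200, 17/200) is nonnegative and its eigenvalues counted with multiplicity are 1, 7/20, 17/50, −18/25, −18/25; in particular its third largest eigenvalue 17/50 is strictly greater than its trace 1/4. -/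
/-- The characteristic polynomial of a symmetric 5×5 matrix invariant under the simultaneous
transposition of its second and third, and of its fourth and fifth, indices splits into a cubic
and a quadratic factor. -/
theorem eval_charpoly_of_swap_invariant (p a b q r x : ℝ) :
    (!![p, a, a, 0, 0; a, 0, 0, 0, b; a, 0, 0, b, 0; 0, 0, b, q, r; 0, b, 0, r, q] :
      Matrix (Fin 5) (Fin 5) ℝ).charpoly.eval x =
      ((x - p) * (x * (x - (q + r)) - b ^ 2) - 2 * a ^ 2 * (x - (q + r))) *
        (x * (x - (q - r)) - b ^ 2) := by
  rw [Matrix.eval_charpoly]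
  have h : Matrix.scalar (Fin 5) x -
      !![p, a, a, 0, 0; a, 0, 0, 0, b; a, 0, 0, b, 0; 0, 0, b, q, r; 0, b, 0, r, q] =
      !![x - p, -a, -a, 0, 0; -a, x, 0, 0, -b; -a, 0, x, -b, 0;
        0, 0, -b, x - q, -r; 0, -b, 0, -r, x - q] := by
    ext i j
    fin_cases i <;> fin_cases j <;> simp
  rw [h]
  simp [Matrix.det_succ_row_zero, Fin.sum_univ_succ, Fin.succAbove]
  ring

/-- The displayed symmetric 5×5 matrix is nonnegative, its eigenvalues with
multiplicity are `1, 7/20, 17/50, -18/25, -18/25`, its trace is `1/4`, and its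
third largest eigenvalue `17/50` is strictly greater than its trace `1/4`. -/
theorem stmt_2 :
    let A : Matrix (Fin 5) (Fin 5) ℝ :=
      !![2/25, Real.sqrt 130 / 25, Real.sqrt 130 / 25, 0, 0;
         Real.sqrt 130 / 25, 0, 0, 0, 3 * Real.sqrt 70 / 50;
         Real.sqrt 130 / 25, 0, 0, 3 * Real.sqrt 70 / 50, 0;
         0, 0, 3 * Real.sqrt 70 / 50, 17/200, 91/200;
         0, 3 * Real.sqrt 70 / 50, 0, 91/200, 17/200]
    (∀ i j, 0 ≤ A i j) ∧
    A.charpoly.roots = {1, 7/20, 17/50, -18/25, -18/25} ∧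
    A.trace = 1/4 ∧ (17/50 : ℝ) > 1/4 := by
  intro A
  have h130 : Real.sqrt 130 ^ 2 = 130 := Real.sq_sqrt (by norm_num)
  have h70 : Real.sqrt 70 ^ 2 = 70 := Real.sq_sqrt (by norm_num)
  have hA : A.charpoly = (({1, 7/20, 17/50, -18/25, -18/25} : Multiset ℝ).map
      fun a => Polynomial.X - Polynomial.C a).prod := by
    refine Polynomial.funext fun x => ?_
    rw [eval_charpoly_of_swap_invariant]
    simp only [div_pow, mul_pow, h130, h70, Multiset.insert_eq_cons, Multiset.map_cons,
      Multiset.map_singleton, Multiset.prod_cons, Multiset.prod_singleton, Polynomial.eval_mul,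
      Polynomial.eval_sub, Polynomial.eval_X, Polynomial.eval_C]
    ring
  refine ⟨fun i j => ?_, ?_, ?_, by norm_num⟩
  · fin_cases i <;> fin_cases j <;> simp [A] <;> positivity
  · rw [hA, Polynomial.roots_multiset_prod_X_sub_C]
  · simp [A, Matrix.trace, Fin.sum_univ_succ]
    norm_num
end

section
/- If ρ(A) ≤ 1 then S1 ≥ 0. -/
/-- Pattern H: if the spectral radius of `A` is at most 1, then `S1 ≥ 0`. -/
theorem stmt_3
    (s t a12 a13 a24 a25 a35 a45 : ℝ)
    (hs : 0 ≤ s) (ht : 0 ≤ t) (h12n : 0 ≤ a12) (h13n : 0 ≤ a13)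
    (h24n : 0 ≤ a24) (h25n : 0 ≤ a25) (h35n : 0 ≤ a35) (h45n : 0 ≤ a45)
    (hts : t + s ≤ 1/2)
    (A : Matrix (Fin 5) (Fin 5) ℝ)
    (hA : A = !![1/2 - t - s, a12, a13, 0, 0;
                 a12, 0, 0, a24, a25;
                 a13, 0, t, 0, a35;
                 0, a24, 0, s, a45;
                 0, a25, a35, a45, 0])
    (S1 : ℝ) (hS1 : S1 = 1 - s - a24^2 - (1 - s) * a25^2 - a45^2 - 2 * a24 * a25 * a45)
    (hρ : spectralRadius ℝ A ≤ 1) :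
    S1 ≥ 0 := by
  have hHerm : A.IsHermitian := by
    subst hA
    ext i j
    fin_cases i <;> fin_cases j <;> simp [Matrix.conjTranspose_apply]
  have hspec : ∀ k ∈ spectrum ℝ A, k ≤ 1 := by
    intro k hk
    have h : (‖k‖₊ : ENNReal) ≤ 1 :=
      (le_iSup₂ (f := fun k (_ : k ∈ spectrum ℝ A) => (‖k‖₊ : ENNReal)) k hk).trans hρ
    have h' : ‖k‖₊ ≤ 1 := by exact_mod_cast h
    exact (le_abs_self k).trans h'
  have hpsd : (1 - A).PosSemidef := by
    rw [Matrix.posSemidef_iff_isHermitian_and_spectrum_nonneg]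
    refine ⟨Matrix.isHermitian_one.sub hHerm, fun k hk => ?_⟩
    rw [← map_one (algebraMap ℝ (Matrix (Fin 5) (Fin 5) ℝ)), ← spectrum.singleton_sub_eq] at hk
    obtain ⟨_, rfl, x, hx, rfl⟩ := hk
    exact sub_nonneg.mpr (hspec x hx)
  have hdet := (hpsd.submatrix ![1, 3, 4]).det_nonneg
  rw [Matrix.det_fin_three] at hdet
  subst hA hS1
  simp at hdet
  linarith
end

section
/- If a24 ≤ (1/2)·√(1 − 2s), or a45 ≤ (1/2)·√(1 − 2s), or a13 ≤ (1/2)·√(2(1 − 2t)(t + s)), then λ3 ≤ 1/2. -/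
open Matrix in
/-- If the quadratic form of a real symmetric matrix is bounded by `c ‖x‖²` on the image of an
injective linear map from `V`, then at most `n - dim V` eigenvalues exceed `c`. -/
theorem Matrix.IsHermitian.card_lt_eigenvalues_add_finrank_le {n V : Type*} [Fintype n]
    [DecidableEq n] [AddCommGroup V] [Module ℝ V] {A : Matrix n n ℝ} (hA : A.IsHermitian)
    (L : V →ₗ[ℝ] n → ℝ) (hL : Function.Injective L) (c : ℝ)
    (h : ∀ v, L v ⬝ᵥ A *ᵥ L v ≤ c * (L v ⬝ᵥ L v)) :
    Fintype.card {i // c < hA.eigenvalues i} + Module.finrank ℝ V ≤ Fintype.card n := by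
  set U : Matrix n n ℝ := (hA.eigenvectorUnitary : Matrix n n ℝ)
  have hUU : U * Uᵀ = 1 := by
    have := Unitary.coe_mul_star_self hA.eigenvectorUnitary
    rwa [Unitary.coe_star, star_eq_conjTranspose, conjTranspose_eq_transpose_of_trivial] at this
  have hspec : A = U * diagonal hA.eigenvalues * Uᵀ := by
    have := hA.spectral_theorem
    rw [Unitary.conjStarAlgAut_apply] at this
    simpa [star_eq_conjTranspose, conjTranspose_eq_transpose_of_trivial,
      Function.comp_def] using this
  have hform (x : n → ℝ) :
      x ⬝ᵥ A *ᵥ x = ∑ i, hA.eigenvalues i * (Uᵀ *ᵥ x) i ^ 2 := by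
    conv_lhs => rw [hspec]
    rw [← mulVec_mulVec, ← mulVec_mulVec, dotProduct_mulVec, ← mulVec_transpose, dotProduct]
    exact Finset.sum_congr rfl fun i _ ↦ by rw [mulVec_diagonal]; ring
  have hnorm (x : n → ℝ) : x ⬝ᵥ x = ∑ i, (Uᵀ *ᵥ x) i ^ 2 := by
    have : x ⬝ᵥ x = x ⬝ᵥ (U * Uᵀ) *ᵥ x := by rw [hUU, one_mulVec]
    rw [this, ← mulVec_mulVec, dotProduct_mulVec, ← mulVec_transpose, dotProduct]
    exact Finset.sum_congr rfl fun i _ ↦ by ring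
  let T : V →ₗ[ℝ] ({i // ¬ c < hA.eigenvalues i} → ℝ) :=
    LinearMap.funLeft ℝ ℝ Subtype.val ∘ₗ Uᵀ.mulVecLin ∘ₗ L
  have hT : Function.Injective T := by
    rw [injective_iff_map_eq_zero]
    intro v hv
    have hzero (i : n) (hi : ¬ c < hA.eigenvalues i) : (Uᵀ *ᵥ L v) i = 0 :=
      congrFun hv ⟨i, hi⟩
    have hnonneg (i : n) : 0 ≤ (hA.eigenvalues i - c) * (Uᵀ *ᵥ L v) i ^ 2 := by
      by_cases hi : c < hA.eigenvalues i
      · have := sub_pos.2 hi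
        positivity
      · simp [hzero i hi]
    have hsum : ∑ i, (hA.eigenvalues i - c) * (Uᵀ *ᵥ L v) i ^ 2 = 0 := by
      refine le_antisymm ?_ (Finset.sum_nonneg fun i _ ↦ hnonneg i)
      have := h v
      rw [hform, hnorm, Finset.mul_sum] at this
      simpa [sub_mul, Finset.sum_sub_distrib] using this
    have hall (i : n) : (Uᵀ *ᵥ L v) i = 0 := by
      by_cases hi : c < hA.eigenvalues i
      · have := (Finset.sum_eq_zero_iff_of_nonneg fun i _ ↦ hnonneg i).1 hsum i (Finset.mem_univ i)
        simpa [(sub_pos.2 hi).ne'] using this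
      · exact hzero i hi
    have : L v ⬝ᵥ L v = 0 := by simp [hnorm, hall]
    exact (map_eq_zero_iff L hL).1 (dotProduct_self_eq_zero.1 this)
  have hrank := LinearMap.finrank_le_finrank_of_injective hT
  rw [Module.finrank_fintype_fun_eq_card, Fintype.card_subtype_compl] at hrank
  have := Fintype.card_subtype_le fun i ↦ c < hA.eigenvalues i
  omega

open Matrix in
/-- If a `5 × 5` real symmetric matrix has its quadratic form bounded by `c ‖x‖²` on a
three-dimensional subspace, then its third largest eigenvalue is at most `c`. -/
theorem Matrix.IsHermitian.third_root_charpoly_le {A : Matrix (Fin 5) (Fin 5) ℝ}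
    (hA : A.IsHermitian) {l1 l2 l3 l4 l5 : ℝ} (h12 : l2 ≤ l1) (h23 : l3 ≤ l2)
    (hroots : A.charpoly.roots = {l1, l2, l3, l4, l5})
    (L : (Fin 3 → ℝ) →ₗ[ℝ] Fin 5 → ℝ) (hL : Function.Injective L) (c : ℝ)
    (h : ∀ v, L v ⬝ᵥ A *ᵥ L v ≤ c * (L v ⬝ᵥ L v)) : l3 ≤ c := by
  by_contra! hc
  have hcard := hA.card_lt_eigenvalues_add_finrank_le L hL c h
  have hcount : (A.charpoly.roots.filter (c < ·)).card =
      Fintype.card {i // c < hA.eigenvalues i} := by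
    rw [hA.roots_charpoly_eq_eigenvalues, Multiset.filter_map, Multiset.card_map,
      Fintype.card_subtype]
    rfl
  have hthree : 3 ≤ (A.charpoly.roots.filter (c < ·)).card := by
    simp [hroots, Multiset.insert_eq_cons, Multiset.filter_cons_of_pos, hc, hc.trans_le h23,
      hc.trans_le (h23.trans h12)]
  simp at hcard
  omega

/-- A binary quadratic form `-p x² + 2 b x y - q y²` with `p, q ≥ 0` and `b² ≤ p q` is
nonpositive. -/
theorem two_mul_mul_mul_le_of_sq_le_mul {p q b : ℝ} (hp : 0 ≤ p) (hq : 0 ≤ q)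
    (hb : b ^ 2 ≤ p * q) (x y : ℝ) : 2 * b * x * y ≤ p * x ^ 2 + q * y ^ 2 := by
  refine le_of_abs_le (abs_le_of_sq_le_sq ?_ (by positivity))
  nlinarith [sq_nonneg (p * x ^ 2 - q * y ^ 2), mul_le_mul_of_nonneg_right hb (sq_nonneg (x * y))]

/-- Pattern H: if `a24 ≤ √(1-2s)/2` or `a45 ≤ √(1-2s)/2` or
`a13 ≤ √(2(1-2t)(t+s))/2`, then `l3 ≤ 1/2`. -/
theorem stmt_4
    (s t a12 a13 a24 a25 a35 a45 : ℝ)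
    (hs : 0 ≤ s) (ht : 0 ≤ t) (h12n : 0 ≤ a12) (h13n : 0 ≤ a13)
    (h24n : 0 ≤ a24) (h25n : 0 ≤ a25) (h35n : 0 ≤ a35) (h45n : 0 ≤ a45)
    (hts : t + s ≤ 1/2)
    (A : Matrix (Fin 5) (Fin 5) ℝ)
    (hA : A = !![1/2 - t - s, a12, a13, 0, 0;
                 a12, 0, 0, a24, a25;
                 a13, 0, t, 0, a35;
                 0, a24, 0, s, a45;
                 0, a25, a35, a45, 0])
    (l1 l2 l3 l4 l5 : ℝ)
    (hord1 : l1 ≥ l2) (hord2 : l2 ≥ l3) (hord3 : l3 ≥ l4) (hord4 : l4 ≥ l5)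
    (heig : A.charpoly.roots = {l1, l2, l3, l4, l5})
    (hcond : a24 ≤ 1/2 * Real.sqrt (1 - 2*s) ∨
             a45 ≤ 1/2 * Real.sqrt (1 - 2*s) ∨
             a13 ≤ 1/2 * Real.sqrt (2 * (1 - 2*t) * (t + s))) :
    l3 ≤ 1/2 := by
  subst hA
  have hsym : (!![1/2 - t - s, a12, a13, 0, 0; a12, 0, 0, a24, a25; a13, 0, t, 0, a35;
      0, a24, 0, s, a45; 0, a25, a35, a45, 0] : Matrix (Fin 5) (Fin 5) ℝ).IsHermitian := by
    ext i j
    fin_cases i <;> fin_cases j <;> rfl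
  have sq_le {a r : ℝ} (ha : 0 ≤ a) (hr : 0 ≤ r) (h : a ≤ 1/2 * √r) : a ^ 2 ≤ r / 4 := by
    have := pow_le_pow_left₀ ha h 2
    rw [mul_pow, Real.sq_sqrt hr] at this
    linarith
  have hs' : 0 ≤ 1/2 - s := by linarith
  have ht' : 0 ≤ 1/2 - t := by linarith
  have inj {L : (Fin 3 → ℝ) →ₗ[ℝ] Fin 5 → ℝ} (e : Fin 3 → Fin 5)
      (hL : ∀ v i, L v (e i) = v i) : Function.Injective L :=
    fun v w h ↦ funext fun i ↦ by rw [← hL v, ← hL w, h]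
  rcases hcond with h | h | h
  · have hb : a24 ^ 2 ≤ 1/2 * (1/2 - s) := by linarith [sq_le h24n (by linarith) h]
    refine hsym.third_root_charpoly_le hord1 hord2 heig
      (LinearMap.pi ![0, .proj 0, .proj 1, .proj 2, 0])
      (inj ![1, 2, 3] fun v i ↦ by fin_cases i <;> rfl) _ fun v ↦ ?_
    have := two_mul_mul_mul_le_of_sq_le_mul one_half_pos.le hs' hb (v 0) (v 2)
    simp [dotProduct, Matrix.mulVec, Fin.sum_univ_succ]
    nlinarith [mul_nonneg ht' (sq_nonneg (v 1))]
  · have hb : a45 ^ 2 ≤ (1/2 - s) * (1/2) := by linarith [sq_le h45n (by linarith) h]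
    refine hsym.third_root_charpoly_le hord1 hord2 heig
      (LinearMap.pi ![.proj 0, 0, 0, .proj 1, .proj 2])
      (inj ![0, 3, 4] fun v i ↦ by fin_cases i <;> rfl) _ fun v ↦ ?_
    have := two_mul_mul_mul_le_of_sq_le_mul hs' one_half_pos.le hb (v 1) (v 2)
    simp [dotProduct, Matrix.mulVec, Fin.sum_univ_succ]
    nlinarith [mul_nonneg (add_nonneg ht hs) (sq_nonneg (v 0))]
  · have hb : a13 ^ 2 ≤ (t + s) * (1/2 - t) := by
      linarith [sq_le h13n (mul_nonneg (by linarith) (add_nonneg ht hs)) h]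
    refine hsym.third_root_charpoly_le hord1 hord2 heig
      (LinearMap.pi ![.proj 0, 0, .proj 1, .proj 2, 0])
      (inj ![0, 2, 3] fun v i ↦ by fin_cases i <;> rfl) _ fun v ↦ ?_
    have := two_mul_mul_mul_le_of_sq_le_mul (add_nonneg ht hs) ht' hb (v 0) (v 1)
    simp [dotProduct, Matrix.mulVec, Fin.sum_univ_succ]
    nlinarith [mul_nonneg hs' (sq_nonneg (v 2))]
end

section
/- If ρ(A) ≤ 1, a24 > 0 and a45 > 0, then a12 ≤ (1/2)·√(2(1 + 2t + 2s)·S1 / (1 − s − a45²)) and a35 ≤ √((1 − t)·S1 / (1 − s − a24²)). -/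
/-- If the spectral radius of a real symmetric matrix is at most one, then `1 - A` is
positive semidefinite. -/
theorem Matrix.IsHermitian.posSemidef_one_sub_of_spectralRadius_le_one
    {n : Type*} [Fintype n] [DecidableEq n] {A : Matrix n n ℝ} (hA : A.IsHermitian)
    (hρ : spectralRadius ℝ A ≤ 1) : (1 - A).PosSemidef := by
  rw [Matrix.posSemidef_iff_isHermitian_and_spectrum_nonneg]
  refine ⟨Matrix.isHermitian_one.sub hA, fun μ hμ ↦ ?_⟩
  have hmem : 1 - μ ∈ spectrum ℝ A := by
    have h := (spectrum.singleton_sub_eq A (1 : ℝ)).symm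
    rw [map_one] at h
    rw [h, Set.singleton_sub] at hμ
    obtain ⟨x, hx, rfl⟩ := hμ
    simpa using hx
  have hnorm : (‖1 - μ‖₊ : ENNReal) ≤ 1 :=
    (le_iSup₂ (f := fun k (_ : k ∈ spectrum ℝ A) ↦ (‖k‖₊ : ENNReal)) (1 - μ) hmem).trans hρ
  have habs : |1 - μ| ≤ 1 := by
    have : ‖1 - μ‖₊ ≤ 1 := by exact_mod_cast hnorm
    exact_mod_cast this
  simpa using (abs_le.mp habs).2

/-- Pattern H: if `ρ(A) ≤ 1`, `a24 > 0` and `a45 > 0`, then upper bounds on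
`a12` and `a35` hold. -/
theorem stmt_5
    (s t a12 a13 a24 a25 a35 a45 : ℝ)
    (hs : 0 ≤ s) (ht : 0 ≤ t) (h12n : 0 ≤ a12) (h13n : 0 ≤ a13)
    (h24n : 0 ≤ a24) (h25n : 0 ≤ a25) (h35n : 0 ≤ a35) (h45n : 0 ≤ a45)
    (hts : t + s ≤ 1/2)
    (A : Matrix (Fin 5) (Fin 5) ℝ)
    (hA : A = !![1/2 - t - s, a12, a13, 0, 0;
                 a12, 0, 0, a24, a25;
                 a13, 0, t, 0, a35;
                 0, a24, 0, s, a45;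
                 0, a25, a35, a45, 0])
    (S1 : ℝ) (hS1 : S1 = 1 - s - a24^2 - (1 - s) * a25^2 - a45^2 - 2 * a24 * a25 * a45)
    (hρ : spectralRadius ℝ A ≤ 1)
    (h24pos : 0 < a24) (h45pos : 0 < a45) :
    a12 ≤ 1/2 * Real.sqrt (2 * (1 + 2*t + 2*s) * S1 / (1 - s - a45^2)) ∧
    a35 ≤ Real.sqrt ((1 - t) * S1 / (1 - s - a24^2)) := by
  have hsymm : A.IsHermitian := by
    subst hA
    ext i j
    fin_cases i <;> fin_cases j <;> rfl
  have hpsd := hsymm.posSemidef_one_sub_of_spectralRadius_le_one hρ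
  have h245 := (hpsd.submatrix ![1, 3, 4]).det_nonneg
  have h1245 := (hpsd.submatrix ![0, 1, 3, 4]).det_nonneg
  have h2345 := (hpsd.submatrix ![1, 2, 3, 4]).det_nonneg
  rw [Matrix.det_fin_three] at h245
  rw [Matrix.det_succ_row_zero] at h1245 h2345
  simp only [Fin.sum_univ_four, Matrix.det_fin_three, Matrix.submatrix_apply] at h1245 h2345
  simp [hA, Fin.succAbove] at h245 h1245 h2345
  have hS1_nonneg : 0 ≤ S1 := by subst hS1; linarith
  have hd45 : 0 < 1 - s - a45 ^ 2 := by
    nlinarith [mul_nonneg (by linarith : 0 ≤ 1 - s) (sq_nonneg a25), pow_pos h24pos 2,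
      mul_nonneg (mul_nonneg h24n h25n) h45n]
  have hd24 : 0 < 1 - s - a24 ^ 2 := by
    nlinarith [mul_nonneg (by linarith : 0 ≤ 1 - s) (sq_nonneg a25), pow_pos h45pos 2,
      mul_nonneg (mul_nonneg h24n h25n) h45n]
  constructor
  · have h : (2 * a12) ^ 2 ≤ 2 * (1 + 2*t + 2*s) * S1 / (1 - s - a45^2) := by
      rw [le_div_iff₀ hd45, hS1]
      linarith
    linarith [Real.le_sqrt_of_sq_le h]
  · apply Real.le_sqrt_of_sq_le
    rw [le_div_iff₀ hd24, hS1]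
    linarith
end
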